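/- arXiv:1210.1070 — 2 statements merged into one kernel-verified Lean document; each statement's English description precedes it below -/
import Mathlib

section
/- Let v be continuous on the closed half-space {z ∈ ℝ^N : z₁ ≥ 0}, harmonic and strictly positive on the open half-space {z₁ > 0}, and vanishing on the hyperplane {z₁ = 0}. Then there exists a constant c > 0 such that v(z) = c z₁ for all z with z₁ ≥ 0. -/
open MeasureTheory Filter Set Metric

noncomputable section

/-- The Laplacian on `ℝ^N` (as `EuclideanSpace`): sum of the pure second partial
derivatives. -/
def lapE {d : ℕ} (u : EuclideanSpace ℝ (Fin (d+2)) → ℝ) (z : EuclideanSpace ℝ (Fin (d+2))) : ℝ :=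
  ∑ i : Fin (d+2), fderiv ℝ (fun z' => fderiv ℝ u z' (EuclideanSpace.single i 1)) z
    (EuclideanSpace.single i 1)

/-- `|∇u|²`, the squared norm of the gradient. -/
def gradSqE {d : ℕ} (u : EuclideanSpace ℝ (Fin (d+2)) → ℝ) (z : EuclideanSpace ℝ (Fin (d+2))) : ℝ :=
  ∑ i : Fin (d+2), (fderiv ℝ u z (EuclideanSpace.single i 1))^2

/-- The open half-space `H = {z ∈ ℝ^N : z₁ > 0}`. -/
def HalfSpace (d : ℕ) : Set (EuclideanSpace ℝ (Fin (d+2))) :=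
  {z | 0 < z 0}

/-- A positive solution on the half-space `H`: continuous on the closure of `H`, twice
continuously differentiable and harmonic in `H`, positive in `H`, vanishing on `{z₁ = 0}`. -/
def IsPosSolHS {d : ℕ} (v : EuclideanSpace ℝ (Fin (d+2)) → ℝ) : Prop :=
  ContinuousOn v (closure (HalfSpace d)) ∧
  ContDiffOn ℝ 2 v (HalfSpace d) ∧
  (∀ z ∈ HalfSpace d, lapE v z = 0) ∧
  (∀ z ∈ HalfSpace d, 0 < v z) ∧
  (∀ z : EuclideanSpace ℝ (Fin (d+2)), z 0 = 0 → v z = 0)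

/-! ### Calculus of the Laplacian `lapE` -/

/-- The `i`-th standard basis vector of `ℝ^(d+2)`. -/
abbrev basisVec {d : ℕ} (i : Fin (d + 2)) : EuclideanSpace ℝ (Fin (d + 2)) :=
  EuclideanSpace.single i 1

section Laplacian

variable {d : ℕ}

lemma isOpen_halfSpace : IsOpen (HalfSpace d) := by
  have : Continuous fun z : EuclideanSpace ℝ (Fin (d + 2)) => z 0 := by fun_prop
  exact isOpen_lt continuous_const this

lemma ContDiffAt.fderiv_apply_one {u : EuclideanSpace ℝ (Fin (d + 2)) → ℝ}
    {z : EuclideanSpace ℝ (Fin (d + 2))} (hu : ContDiffAt ℝ 2 u z)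
    (e : EuclideanSpace ℝ (Fin (d + 2))) : ContDiffAt ℝ 1 (fun y => fderiv ℝ u y e) z :=
  (hu.fderiv_right (m := 1) (by norm_num)).clm_apply contDiffAt_const

lemma ContDiff.fderiv_apply_one {u : EuclideanSpace ℝ (Fin (d + 2)) → ℝ}
    (hu : ContDiff ℝ 2 u) (e : EuclideanSpace ℝ (Fin (d + 2))) :
    ContDiff ℝ 1 (fun y => fderiv ℝ u y e) :=
  (hu.fderiv_right (m := 1) (by norm_num)).clm_apply contDiff_const

lemma lapE_sub {f g : EuclideanSpace ℝ (Fin (d + 2)) → ℝ} {z : EuclideanSpace ℝ (Fin (d + 2))}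
    (hf : ContDiffAt ℝ 2 f z) (hg : ContDiffAt ℝ 2 g z) :
    lapE (fun y => f y - g y) z = lapE f z - lapE g z := by
  unfold lapE
  rw [← Finset.sum_sub_distrib]
  refine Finset.sum_congr rfl fun i _ => ?_
  have : (fun y => fderiv ℝ (fun y => f y - g y) y (basisVec i)) =ᶠ[nhds z]
      fun y => fderiv ℝ f y (basisVec i) - fderiv ℝ g y (basisVec i) := by
    filter_upwards [hf.eventually (by simp), hg.eventually (by simp)] with y h1 h2
    rw [fderiv_fun_sub (h1.differentiableAt (by simp)) (h2.differentiableAt (by simp))]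
    rfl
  rw [this.fderiv_eq, fderiv_fun_sub ((hf.fderiv_apply_one _).differentiableAt (by simp))
    ((hg.fderiv_apply_one _).differentiableAt (by simp))]
  rfl

lemma lapE_add {f g : EuclideanSpace ℝ (Fin (d + 2)) → ℝ} {z : EuclideanSpace ℝ (Fin (d + 2))}
    (hf : ContDiffAt ℝ 2 f z) (hg : ContDiffAt ℝ 2 g z) :
    lapE (fun y => f y + g y) z = lapE f z + lapE g z := by
  have h := lapE_sub (hf.add hg) hg
  simp only [add_sub_cancel_right] at h
  exact (sub_eq_iff_eq_add.1 h.symm)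

lemma lapE_comp_add_right (f : EuclideanSpace ℝ (Fin (d + 2)) → ℝ)
    (h z : EuclideanSpace ℝ (Fin (d + 2))) :
    lapE (fun y => f (y + h)) z = lapE f (z + h) := by
  unfold lapE
  refine Finset.sum_congr rfl fun i _ => ?_
  simp only [fderiv_comp_add_right]
  rw [fderiv_comp_add_right (f := fun y => fderiv ℝ f y (basisVec i))]

lemma lapE_mul {f g : EuclideanSpace ℝ (Fin (d + 2)) → ℝ}
    (hf : ContDiff ℝ 2 f) (hg : ContDiff ℝ 2 g) (z : EuclideanSpace ℝ (Fin (d + 2))) :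
    lapE (fun y => f y * g y) z = f z * lapE g z
      + 2 * ∑ i, fderiv ℝ f z (basisVec i) * fderiv ℝ g z (basisVec i) + g z * lapE f z := by
  unfold lapE
  rw [Finset.mul_sum, Finset.mul_sum, Finset.mul_sum, ← Finset.sum_add_distrib,
    ← Finset.sum_add_distrib]
  refine Finset.sum_congr rfl fun i _ => ?_
  have h1 := hf.differentiable (by simp)
  have h2 := hg.differentiable (by simp)
  have h3 := (hf.fderiv_apply_one (basisVec i)).differentiable (by simp)
  have h4 := (hg.fderiv_apply_one (basisVec i)).differentiable (by simp)
  have : (fun y => fderiv ℝ (fun y => f y * g y) y (basisVec i)) =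
      fun y => f y * fderiv ℝ g y (basisVec i) + g y * fderiv ℝ f y (basisVec i) := by
    ext y
    rw [fderiv_fun_mul (h1 y) (h2 y)]
    simp
  rw [this, fderiv_fun_add ((h1 z).fun_mul (h4 z)) ((h2 z).fun_mul (h3 z)), fderiv_fun_mul (h1 z) (h4 z),
    fderiv_fun_mul (h2 z) (h3 z)]
  simp
  ring

lemma hasFDerivAt_comp_coord_zero {χ : ℝ → ℝ} {c : ℝ} {z : EuclideanSpace ℝ (Fin (d + 2))}
    (h : HasDerivAt χ c (z 0)) :
    HasFDerivAt (fun y : EuclideanSpace ℝ (Fin (d + 2)) => χ (y 0))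
      (c • (EuclideanSpace.proj (0 : Fin (d + 2)) : EuclideanSpace ℝ (Fin (d + 2)) →L[ℝ] ℝ)) z :=
  h.comp_hasFDerivAt z
    (EuclideanSpace.proj (0 : Fin (d + 2)) : EuclideanSpace ℝ (Fin (d + 2)) →L[ℝ] ℝ).hasFDerivAt

lemma fderiv_comp_coord_zero {χ χ' : ℝ → ℝ} (h : ∀ t, HasDerivAt χ (χ' t) t)
    (z : EuclideanSpace ℝ (Fin (d + 2))) (i : Fin (d + 2)) :
    fderiv ℝ (fun y : EuclideanSpace ℝ (Fin (d + 2)) => χ (y 0)) z (basisVec i) =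
      if i = 0 then χ' (z 0) else 0 := by
  rw [(hasFDerivAt_comp_coord_zero (h (z 0))).fderiv]
  simp [eq_comm]

lemma lapE_comp_coord_zero {χ χ' χ'' : ℝ → ℝ} (h : ∀ t, HasDerivAt χ (χ' t) t)
    (h' : ∀ t, HasDerivAt χ' (χ'' t) t) (z : EuclideanSpace ℝ (Fin (d + 2))) :
    lapE (fun y => χ (y 0)) z = χ'' (z 0) := by
  unfold lapE
  simp only [fderiv_comp_coord_zero h]
  rw [Finset.sum_eq_single 0]
  · simp only [if_true]
    rw [fderiv_comp_coord_zero h']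
    simp
  · intro i _ hi
    simp [hi]
  · simp

lemma hasFDerivAt_comp_norm_sq {H : ℝ → ℝ} {c l : ℝ} {a z : EuclideanSpace ℝ (Fin (d + 2))}
    (h : HasDerivAt H c (l ^ 2 * ‖z - a‖ ^ 2)) :
    HasFDerivAt (fun y => H (l ^ 2 * ‖y - a‖ ^ 2))
      (c • (l ^ 2 • (2 • innerSL ℝ (z - a)))) z := by
  have h1 : HasFDerivAt (fun y => ‖y - a‖ ^ 2) (2 • innerSL ℝ (z - a)) z := by
    have := (hasStrictFDerivAt_norm_sq (z - a)).hasFDerivAt.comp z ((hasFDerivAt_id z).sub_const a)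
    simpa [Function.comp_def] using this
  exact h.comp_hasFDerivAt z (h1.const_mul (l ^ 2))

lemma fderiv_comp_norm_sq {H η : ℝ → ℝ} (h : ∀ t, HasDerivAt H (η t) t) (l : ℝ)
    (a z : EuclideanSpace ℝ (Fin (d + 2))) (i : Fin (d + 2)) :
    fderiv ℝ (fun y => H (l ^ 2 * ‖y - a‖ ^ 2)) z (basisVec i) =
      2 * l ^ 2 * (η (l ^ 2 * ‖z - a‖ ^ 2) * (z i - a i)) := by
  rw [(hasFDerivAt_comp_norm_sq (h _)).fderiv]
  simp [EuclideanSpace.inner_single_right]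
  ring

lemma lapE_comp_norm_sq {H η η' : ℝ → ℝ} (h : ∀ t, HasDerivAt H (η t) t)
    (h' : ∀ t, HasDerivAt η (η' t) t) (l : ℝ) (a z : EuclideanSpace ℝ (Fin (d + 2))) :
    lapE (fun y => H (l ^ 2 * ‖y - a‖ ^ 2)) z =
      2 * l ^ 2 * ((d + 2) * η (l ^ 2 * ‖z - a‖ ^ 2)
        + 2 * (l ^ 2 * ‖z - a‖ ^ 2) * η' (l ^ 2 * ‖z - a‖ ^ 2)) := by
  unfold lapE
  have key : ∀ i : Fin (d + 2), fderiv ℝ (fun y => fderiv ℝ (fun y => H (l ^ 2 * ‖y - a‖ ^ 2)) y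
      (basisVec i)) z (basisVec i) = 2 * l ^ 2 * η (l ^ 2 * ‖z - a‖ ^ 2)
        + 4 * l ^ 4 * η' (l ^ 2 * ‖z - a‖ ^ 2) * (z - a) i ^ 2 := by
    intro i
    simp only [fderiv_comp_norm_sq h]
    have h1 := hasFDerivAt_comp_norm_sq (l := l) (a := a) (z := z) (h' _)
    have h2 : HasFDerivAt (fun y : EuclideanSpace ℝ (Fin (d + 2)) => y i - a i)
        (EuclideanSpace.proj i : EuclideanSpace ℝ (Fin (d + 2)) →L[ℝ] ℝ) z :=
      (EuclideanSpace.proj i : EuclideanSpace ℝ (Fin (d + 2)) →L[ℝ] ℝ).hasFDerivAt.sub_const _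
    rw [((h1.fun_mul h2).const_mul (2 * l ^ 2)).fderiv]
    simp [EuclideanSpace.inner_single_right]
    ring
  rw [Finset.sum_congr rfl fun i _ => key i, Finset.sum_add_distrib, ← Finset.mul_sum
    _ _ (4 * l ^ 4 * _), ← EuclideanSpace.real_norm_sq_eq]
  simp
  ring

lemma fderiv_fderiv_apply_nonpos_of_isLocalMax {u : EuclideanSpace ℝ (Fin (d + 2)) → ℝ}
    {z : EuclideanSpace ℝ (Fin (d + 2))} (hu : ContDiffAt ℝ 2 u z) (hz : IsLocalMax u z)
    (e : EuclideanSpace ℝ (Fin (d + 2))) :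
    fderiv ℝ (fun y => fderiv ℝ u y e) z e ≤ 0 := by
  by_contra! hlt
  have hline : Tendsto (fun t : ℝ => z + t • e) (nhds 0) (nhds z) := by
    have : Continuous fun t : ℝ => z + t • e := by fun_prop
    simpa using this.tendsto 0
  have hdl : ∀ t : ℝ, HasDerivAt (fun t : ℝ => z + t • e) e t := fun t => by
    simpa using ((hasDerivAt_id t).smul_const e).const_add z
  set φ : ℝ → ℝ := fun t => u (z + t • e) with hφ
  have hd1 : ∀ᶠ t in nhds (0 : ℝ), HasDerivAt φ (fderiv ℝ u (z + t • e) e) t := by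
    filter_upwards [hline.eventually (hu.eventually (by simp))] with t ht
    exact (ht.differentiableAt (by simp)).hasFDerivAt.comp_hasDerivAt t (hdl t)
  have hd1' : deriv φ =ᶠ[nhds 0] fun t => fderiv ℝ u (z + t • e) e :=
    hd1.mono fun t ht => ht.deriv
  have hd2 : deriv (deriv φ) 0 = fderiv ℝ (fun y => fderiv ℝ u y e) z e := by
    rw [hd1'.deriv_eq]
    have h3 : DifferentiableAt ℝ (fun y => fderiv ℝ u y e) (z + (0 : ℝ) • e) := by
      simpa using (hu.fderiv_apply_one e).differentiableAt (by simp)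
    have := h3.hasFDerivAt.comp_hasDerivAt (0 : ℝ) (hdl 0)
    simpa [Function.comp_def] using this.deriv
  have hmax : IsLocalMax φ 0 := by
    have h0 : φ 0 = u z := by simp [hφ]
    filter_upwards [hline.eventually hz] with t ht
    rw [h0]
    exact ht
  have hmin : IsLocalMin φ 0 :=
    isLocalMin_of_deriv_deriv_pos (by rw [hd2]; exact hlt) hmax.deriv_eq_zero
      hd1.self_of_nhds.continuousAt
  have hconst : φ =ᶠ[nhds 0] fun _ => φ 0 := by
    filter_upwards [hmax, hmin] with t h1 h2
    exact le_antisymm h1 h2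
  have hderiv : deriv φ =ᶠ[nhds 0] fun _ => 0 := by
    filter_upwards [hconst.eventuallyEq_nhds] with t ht
    rw [ht.deriv_eq]
    simp
  rw [← hd2, hderiv.deriv_eq] at hlt
  simp at hlt

lemma lapE_nonpos_of_isLocalMax {u : EuclideanSpace ℝ (Fin (d + 2)) → ℝ}
    {z : EuclideanSpace ℝ (Fin (d + 2))} (hu : ContDiffAt ℝ 2 u z) (hz : IsLocalMax u z) :
    lapE u z ≤ 0 :=
  Finset.sum_nonpos fun _ _ => fderiv_fderiv_apply_nonpos_of_isLocalMax hu hz _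

lemma integrable_mul_of_tsupport_subset {f g : EuclideanSpace ℝ (Fin (d + 2)) → ℝ}
    {U : Set (EuclideanSpace ℝ (Fin (d + 2)))} (hU : IsOpen U) (hf : ContinuousOn f U)
    (hg : Continuous g) (hgc : HasCompactSupport g) (hgU : tsupport g ⊆ U) :
    Integrable (fun z => f z * g z) := by
  refine Continuous.integrable_of_hasCompactSupport ?_ hgc.mul_left
  refine continuous_of_tsupport fun z hz => ?_
  have hz' : z ∈ U := hgU (tsupport_mul_subset_right hz)
  exact (hf.continuousAt (hU.mem_nhds hz')).mul hg.continuousAt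

/-- **Green's identity** for a function harmonic on an open set against a compactly supported
test function. -/
lemma integral_mul_lapE_eq_zero {v ψ : EuclideanSpace ℝ (Fin (d + 2)) → ℝ}
    {U : Set (EuclideanSpace ℝ (Fin (d + 2)))} (hU : IsOpen U) (hv : ContDiffOn ℝ 2 v U)
    (hharm : ∀ z ∈ U, lapE v z = 0) (hψ : ContDiff ℝ 2 ψ) (hψc : HasCompactSupport ψ)
    (hψU : tsupport ψ ⊆ U) : ∫ z, v z * lapE ψ z = 0 := by
  have hvat : ∀ z ∈ U, ContDiffAt ℝ 2 v z := fun z hz => hv.contDiffAt (hU.mem_nhds hz)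
  have hv0 : ContinuousOn v U := hv.continuousOn
  have hv1 : ∀ i, ContinuousOn (fun y => fderiv ℝ v y (basisVec i)) U := fun i z hz =>
    ((hvat z hz).fderiv_apply_one _).continuousAt.continuousWithinAt
  have hv2 : ∀ i, ContinuousOn
      (fun y => fderiv ℝ (fun y => fderiv ℝ v y (basisVec i)) y (basisVec i)) U := fun i z hz =>
    ((((hvat z hz).fderiv_apply_one _).fderiv_right (m := 0) (by norm_num)).clm_apply
      contDiffAt_const).continuousAt.continuousWithinAt
  have hψ1 : ∀ i, ContDiff ℝ 1 (fun y => fderiv ℝ ψ y (basisVec i)) :=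
    fun i => hψ.fderiv_apply_one _
  have hc1 : ∀ i, HasCompactSupport (fun y => fderiv ℝ ψ y (basisVec i)) :=
    fun i => hψc.fderiv_apply ℝ _
  have hs1 : ∀ i, tsupport (fun y => fderiv ℝ ψ y (basisVec i)) ⊆ tsupport ψ :=
    fun i => tsupport_fderiv_apply_subset ℝ _
  have hψ2 : ∀ i, Continuous
      (fun y => fderiv ℝ (fun y => fderiv ℝ ψ y (basisVec i)) y (basisVec i)) := fun i =>
    (((hψ1 i).fderiv_right (m := 0) (by norm_num)).clm_apply contDiff_const).continuous
  have hc2 : ∀ i, HasCompactSupport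
      (fun y => fderiv ℝ (fun y => fderiv ℝ ψ y (basisVec i)) y (basisVec i)) :=
    fun i => (hc1 i).fderiv_apply ℝ _
  have hs2 : ∀ i, tsupport
      (fun y => fderiv ℝ (fun y => fderiv ℝ ψ y (basisVec i)) y (basisVec i)) ⊆ tsupport ψ :=
    fun i => (tsupport_fderiv_apply_subset ℝ _).trans (hs1 i)
  have hI2 : ∀ i, Integrable (fun z => v z *
      fderiv ℝ (fun y => fderiv ℝ ψ y (basisVec i)) z (basisVec i)) := fun i =>
    integrable_mul_of_tsupport_subset hU hv0 (hψ2 i) (hc2 i) ((hs2 i).trans hψU)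
  have hI1 : ∀ i, Integrable (fun z => fderiv ℝ v z (basisVec i) *
      fderiv ℝ ψ z (basisVec i)) := fun i =>
    integrable_mul_of_tsupport_subset hU (hv1 i) (hψ1 i).continuous (hc1 i) ((hs1 i).trans hψU)
  have hI0 : ∀ i, Integrable (fun z =>
      fderiv ℝ (fun y => fderiv ℝ v y (basisVec i)) z (basisVec i) * ψ z) := fun i =>
    integrable_mul_of_tsupport_subset hU (hv2 i) hψ.continuous hψc hψU
  have key : ∀ i, ∫ z, v z * fderiv ℝ (fun y => fderiv ℝ ψ y (basisVec i)) z (basisVec i) =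
      ∫ z, fderiv ℝ (fun y => fderiv ℝ v y (basisVec i)) z (basisVec i) * ψ z := by
    intro i
    rw [integral_mul_fderiv_eq_neg_fderiv_mul_of_integrable (hI1 i) (hI2 i)
      (integrable_mul_of_tsupport_subset hU hv0 (hψ1 i).continuous (hc1 i) ((hs1 i).trans hψU))
      (fun z hz => (hvat z (hψU (hs1 i hz))).differentiableAt (by simp))
      (fun z _ => (hψ1 i).differentiable (by simp) z),
      integral_mul_fderiv_eq_neg_fderiv_mul_of_integrable (hI0 i) (hI1 i)
      (integrable_mul_of_tsupport_subset hU (hv1 i) hψ.continuous hψc hψU)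
      (fun z hz => ((hvat z (hψU hz)).fderiv_apply_one _).differentiableAt (by simp))
      (fun z _ => hψ.differentiable (by simp) z), neg_neg]
  calc ∫ z, v z * lapE ψ z
      = ∑ i, ∫ z, v z * fderiv ℝ (fun y => fderiv ℝ ψ y (basisVec i)) z (basisVec i) := by
        rw [← integral_finsetSum _ fun i _ => hI2 i]
        simp only [lapE, Finset.mul_sum]
    _ = ∫ z, lapE v z * ψ z := by
        rw [Finset.sum_congr rfl fun i _ => key i, ← integral_finsetSum _ fun i _ => hI0 i]
        simp only [lapE, Finset.sum_mul]
    _ = 0 := by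
        rw [← integral_zero (EuclideanSpace ℝ (Fin (d + 2))) ℝ]
        congr 1
        ext z
        by_cases hz : z ∈ tsupport ψ
        · rw [hharm z (hψU hz), zero_mul]
        · rw [image_eq_zero_of_notMem_tsupport hz, mul_zero]

end Laplacian

/-! ### A smooth radial profile -/

/-- A smooth nonnegative decreasing function on `ℝ`, positive exactly on `(-∞, 1)`. -/
def profile (s : ℝ) : ℝ := expNegInvGlue (1 - s)

/-- The primitive of `profile` vanishing on `[1, ∞)`. -/
def profilePrimitive (s : ℝ) : ℝ := ∫ t in (1 : ℝ)..s, profile t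

section Profile

open scoped ContDiff

lemma contDiff_profile : ContDiff ℝ ∞ profile :=
  expNegInvGlue.contDiff.comp (contDiff_const.sub contDiff_id)

lemma continuous_profile : Continuous profile := contDiff_profile.continuous

lemma profile_nonneg (s : ℝ) : 0 ≤ profile s := expNegInvGlue.nonneg _

lemma profile_pos {s : ℝ} (hs : s < 1) : 0 < profile s :=
  expNegInvGlue.pos_of_pos (by linarith)

lemma profile_eq_zero {s : ℝ} (hs : 1 ≤ s) : profile s = 0 :=
  expNegInvGlue.zero_of_nonpos (by linarith)

lemma profile_antitone : Antitone profile := fun _ _ h =>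
  expNegInvGlue.monotone (by linarith)

lemma hasDerivAt_profile (s : ℝ) : HasDerivAt profile (deriv profile s) s :=
  (contDiff_profile.differentiable (by simp) s).hasDerivAt

lemma continuous_deriv_profile : Continuous (deriv profile) :=
  contDiff_profile.continuous_deriv (by simp)

lemma deriv_profile_eq_zero {s : ℝ} (hs : 1 < s) : deriv profile s = 0 := by
  have : profile =ᶠ[nhds s] fun _ => 0 := by
    filter_upwards [Ioi_mem_nhds hs] with t ht using profile_eq_zero (le_of_lt ht)
  rw [this.deriv_eq]
  simp

lemma exists_bound_mul_deriv_profile : ∃ C, 0 ≤ C ∧ ∀ s, 0 ≤ s → |s * deriv profile s| ≤ C := by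
  obtain ⟨C, hC⟩ := (isCompact_Icc (a := (0 : ℝ)) (b := 1)).exists_bound_of_continuousOn
    (continuous_id.mul continuous_deriv_profile).continuousOn
  refine ⟨max C 0, le_max_right _ _, fun s hs => ?_⟩
  rcases le_or_gt s 1 with h | h
  · exact (hC s ⟨hs, h⟩).trans (le_max_left _ _)
  · rw [deriv_profile_eq_zero h]
    simp

lemma hasDerivAt_profilePrimitive (s : ℝ) : HasDerivAt profilePrimitive (profile s) s :=
  intervalIntegral.integral_hasDerivAt_right (continuous_profile.intervalIntegrable _ _)
    (continuous_profile.stronglyMeasurableAtFilter _ _) continuous_profile.continuousAt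

lemma contDiff_profilePrimitive : ContDiff ℝ ∞ profilePrimitive := by
  rw [contDiff_infty_iff_deriv]
  refine ⟨fun s => (hasDerivAt_profilePrimitive s).differentiableAt, ?_⟩
  rw [show deriv profilePrimitive = profile from
    funext fun s => (hasDerivAt_profilePrimitive s).deriv]
  exact contDiff_profile

lemma profilePrimitive_eq_zero {s : ℝ} (hs : 1 ≤ s) : profilePrimitive s = 0 := by
  unfold profilePrimitive
  rw [intervalIntegral.integral_congr (g := fun _ => (0 : ℝ))]
  · simp
  · intro t ht
    rw [uIcc_of_le hs] at ht
    exact profile_eq_zero ht.1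

variable {d : ℕ}

lemma one_le_sq_mul_norm_sq {l : ℝ} (hl : 0 < l) {a z : EuclideanSpace ℝ (Fin (d + 2))}
    (hz : 1 / l ≤ ‖z - a‖) : 1 ≤ l ^ 2 * ‖z - a‖ ^ 2 := by
  rw [div_le_iff₀ hl] at hz
  nlinarith [norm_nonneg (z - a)]

lemma profile_eq_zero_of_le_dist {l : ℝ} (hl : 0 < l) {a z : EuclideanSpace ℝ (Fin (d + 2))}
    (hz : 1 / l ≤ ‖z - a‖) : profile (l ^ 2 * ‖z - a‖ ^ 2) = 0 :=
  profile_eq_zero (one_le_sq_mul_norm_sq hl hz)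

/-- The radial profile of a small ball is dominated by that of a larger ball. -/
lemma profile_le_mul_profile {l m : ℝ} (hl : 0 < l) (hm : 0 < m)
    {a b : EuclideanSpace ℝ (Fin (d + 2))} (h : m * (1 / l + ‖a - b‖) ≤ 1 / 2)
    (z : EuclideanSpace ℝ (Fin (d + 2))) :
    profile (l ^ 2 * ‖z - a‖ ^ 2) ≤
      profile 0 / profile (1 / 4) * profile (m ^ 2 * ‖z - b‖ ^ 2) := by
  have hq : 0 < profile (1 / 4) := profile_pos (by norm_num)
  rcases le_or_gt (1 / l) ‖z - a‖ with hz | hz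
  · rw [profile_eq_zero_of_le_dist hl hz]
    have := profile_nonneg 0
    have := profile_nonneg (m ^ 2 * ‖z - b‖ ^ 2)
    positivity
  · have h1 : ‖z - b‖ ≤ ‖z - a‖ + ‖a - b‖ := norm_sub_le_norm_sub_add_norm_sub _ _ _
    have h2 : m * ‖z - b‖ ≤ 1 / 2 :=
      (mul_le_mul_of_nonneg_left (by linarith) hm.le).trans h
    have h3 : m ^ 2 * ‖z - b‖ ^ 2 ≤ 1 / 4 := by
      nlinarith [mul_nonneg hm.le (norm_nonneg (z - b))]
    rw [div_mul_eq_mul_div, le_div_iff₀ hq]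
    exact mul_le_mul (profile_antitone (by positivity)) (profile_antitone h3) hq.le
      (profile_nonneg 0)

lemma contDiff_profile_norm_sq (l : ℝ) (a : EuclideanSpace ℝ (Fin (d + 2))) :
    ContDiff ℝ ∞ fun z => profile (l ^ 2 * ‖z - a‖ ^ 2) :=
  contDiff_profile.comp (contDiff_const.mul ((contDiff_id.sub contDiff_const).norm_sq ℝ))

lemma contDiff_profilePrimitive_norm_sq (l : ℝ) (a : EuclideanSpace ℝ (Fin (d + 2))) :
    ContDiff ℝ 2 fun z => profilePrimitive (l ^ 2 * ‖z - a‖ ^ 2) :=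
  (contDiff_profilePrimitive.comp
    (contDiff_const.mul ((contDiff_id.sub contDiff_const).norm_sq ℝ))).of_le (by norm_cast)

lemma tsupport_subset_closedBall_of_eq_zero {f : EuclideanSpace ℝ (Fin (d + 2)) → ℝ}
    {a : EuclideanSpace ℝ (Fin (d + 2))} {r : ℝ} (h : ∀ z, r ≤ ‖z - a‖ → f z = 0) :
    tsupport f ⊆ closedBall a r := by
  refine closure_minimal (fun z hz => ?_) isClosed_closedBall
  rw [mem_closedBall, dist_eq_norm]
  by_contra hlt
  exact hz (h z (le_of_not_ge hlt))

lemma tsupport_profile_norm_sq_subset {l : ℝ} (hl : 0 < l)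
    (a : EuclideanSpace ℝ (Fin (d + 2))) :
    tsupport (fun z => profile (l ^ 2 * ‖z - a‖ ^ 2)) ⊆ closedBall a (1 / l) :=
  tsupport_subset_closedBall_of_eq_zero fun _ hz => profile_eq_zero_of_le_dist hl hz

lemma tsupport_profilePrimitive_norm_sq_subset {l : ℝ} (hl : 0 < l)
    (a : EuclideanSpace ℝ (Fin (d + 2))) :
    tsupport (fun z => profilePrimitive (l ^ 2 * ‖z - a‖ ^ 2)) ⊆ closedBall a (1 / l) :=
  tsupport_subset_closedBall_of_eq_zero fun _ hz =>
    profilePrimitive_eq_zero (one_le_sq_mul_norm_sq hl hz)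

lemma hasCompactSupport_profile_norm_sq {l : ℝ} (hl : 0 < l)
    (a : EuclideanSpace ℝ (Fin (d + 2))) :
    HasCompactSupport (fun z => profile (l ^ 2 * ‖z - a‖ ^ 2)) :=
  (isCompact_closedBall a (1 / l)).of_isClosed_subset (isClosed_tsupport _)
    (tsupport_profile_norm_sq_subset hl a)

lemma hasCompactSupport_profilePrimitive_norm_sq {l : ℝ} (hl : 0 < l)
    (a : EuclideanSpace ℝ (Fin (d + 2))) :
    HasCompactSupport (fun z => profilePrimitive (l ^ 2 * ‖z - a‖ ^ 2)) :=
  (isCompact_closedBall a (1 / l)).of_isClosed_subset (isClosed_tsupport _)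
    (tsupport_profilePrimitive_norm_sq_subset hl a)

lemma abs_profile_le {s : ℝ} (hs : 0 ≤ s) : |profile s| ≤ profile 0 := by
  rw [abs_of_nonneg (profile_nonneg s)]
  exact profile_antitone hs

lemma integrable_mul_profile {f : EuclideanSpace ℝ (Fin (d + 2)) → ℝ} (hf : Integrable f)
    (l : ℝ) (a : EuclideanSpace ℝ (Fin (d + 2))) :
    Integrable fun z => f z * profile (l ^ 2 * ‖z - a‖ ^ 2) :=
  hf.mul_bdd (c := profile 0) (contDiff_profile_norm_sq l a).continuous.aestronglyMeasurable
    (Eventually.of_forall fun _ => abs_profile_le (by positivity))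

lemma hasDerivAt_integral_mul_profile {f : EuclideanSpace ℝ (Fin (d + 2)) → ℝ}
    (hf : Integrable f) (a : EuclideanSpace ℝ (Fin (d + 2))) {l : ℝ} (hl : 0 < l) :
    Integrable (fun z => f z * (2 * l * ‖z - a‖ ^ 2 * deriv profile (l ^ 2 * ‖z - a‖ ^ 2))) ∧
    HasDerivAt (fun l => ∫ z, f z * profile (l ^ 2 * ‖z - a‖ ^ 2))
      (∫ z, f z * (2 * l * ‖z - a‖ ^ 2 * deriv profile (l ^ 2 * ‖z - a‖ ^ 2))) l := by
  obtain ⟨C, hC0, hC⟩ := exists_bound_mul_deriv_profile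
  refine hasDerivAt_integral_of_dominated_loc_of_deriv_le
    (F' := fun l z => f z * (2 * l * ‖z - a‖ ^ 2 * deriv profile (l ^ 2 * ‖z - a‖ ^ 2)))
    (bound := fun z => ‖f z‖ * (4 * C / l))
    (Ioi_mem_nhds (show l / 2 < l by linarith)) ?_ (integrable_mul_profile hf l a) ?_ ?_
    (hf.norm.mul_const _) ?_
  · exact Eventually.of_forall fun x => (integrable_mul_profile hf x a).aestronglyMeasurable
  · have : Continuous fun z : EuclideanSpace ℝ (Fin (d + 2)) =>
        2 * l * ‖z - a‖ ^ 2 * deriv profile (l ^ 2 * ‖z - a‖ ^ 2) := by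
      have := continuous_deriv_profile
      fun_prop
    exact hf.aestronglyMeasurable.mul this.aestronglyMeasurable
  · refine Eventually.of_forall fun z x hx => ?_
    have hx' : l / 2 < x := hx
    have hx0 : 0 < x := by linarith
    rw [norm_mul]
    refine mul_le_mul_of_nonneg_left ?_ (norm_nonneg _)
    have h1 : 2 * x * ‖z - a‖ ^ 2 * deriv profile (x ^ 2 * ‖z - a‖ ^ 2) =
        2 / x * (x ^ 2 * ‖z - a‖ ^ 2 * deriv profile (x ^ 2 * ‖z - a‖ ^ 2)) := by
      field_simp
    rw [h1, norm_mul, Real.norm_of_nonneg (by positivity)]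
    calc 2 / x * ‖x ^ 2 * ‖z - a‖ ^ 2 * deriv profile (x ^ 2 * ‖z - a‖ ^ 2)‖
        ≤ 2 / x * C := mul_le_mul_of_nonneg_left (hC _ (by positivity)) (by positivity)
      _ ≤ 4 * C / l := by
        rw [div_mul_eq_mul_div, div_le_div_iff₀ hx0 hl]
        nlinarith
  · refine Eventually.of_forall fun z x _ => ?_
    have h1 : HasDerivAt (fun x : ℝ => x ^ 2 * ‖z - a‖ ^ 2) (2 * x * ‖z - a‖ ^ 2) x := by
      simpa using (hasDerivAt_pow 2 x).mul_const (‖z - a‖ ^ 2)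
    have h2 := ((hasDerivAt_profile _).comp x h1).const_mul (f z)
    exact h2.congr_deriv (by ring)

/-- If the scale derivative of a weighted average vanishes, then the average does not depend
on the scale. -/
lemma pow_mul_integral_mul_profile_eq {f : EuclideanSpace ℝ (Fin (d + 2)) → ℝ}
    (hf : Integrable f) (a : EuclideanSpace ℝ (Fin (d + 2))) (m : ℕ) {l₀ : ℝ} (hl₀ : 0 ≤ l₀)
    (h : ∀ l, l₀ < l → ∫ z, f z * (m * profile (l ^ 2 * ‖z - a‖ ^ 2)
      + 2 * (l ^ 2 * ‖z - a‖ ^ 2) * deriv profile (l ^ 2 * ‖z - a‖ ^ 2)) = 0)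
    {l l' : ℝ} (hl : l₀ < l) (hl' : l₀ < l') :
    l ^ m * ∫ z, f z * profile (l ^ 2 * ‖z - a‖ ^ 2) =
      l' ^ m * ∫ z, f z * profile (l' ^ 2 * ‖z - a‖ ^ 2) := by
  have hd : ∀ x ∈ Ioi l₀, HasDerivAt
      (fun l => l ^ m * ∫ z, f z * profile (l ^ 2 * ‖z - a‖ ^ 2)) 0 x := by
    intro x hx
    have hx0 : 0 < x := lt_of_le_of_lt hl₀ hx
    obtain ⟨hint, hder⟩ := hasDerivAt_integral_mul_profile hf a hx0
    refine ((hasDerivAt_pow m x).fun_mul hder).congr_deriv ?_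
    have h1 := h x hx
    have h2 : ∀ z, f z * (m * profile (x ^ 2 * ‖z - a‖ ^ 2)
        + 2 * (x ^ 2 * ‖z - a‖ ^ 2) * deriv profile (x ^ 2 * ‖z - a‖ ^ 2)) =
        m * (f z * profile (x ^ 2 * ‖z - a‖ ^ 2)) +
        x * (f z * (2 * x * ‖z - a‖ ^ 2 * deriv profile (x ^ 2 * ‖z - a‖ ^ 2))) :=
      fun z => by ring
    simp only [h2] at h1
    rw [integral_add ((integrable_mul_profile hf x a).const_mul _) (hint.const_mul _),
      integral_const_mul, integral_const_mul] at h1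
    rcases m with _ | m
    · simp only [CharP.cast_eq_zero, zero_mul, zero_add, mul_eq_zero, hx0.ne', false_or] at h1
      rw [h1]
      simp
    · rw [Nat.add_sub_cancel, pow_succ x m]
      linear_combination x ^ m * h1
  exact isOpen_Ioi.is_const_of_deriv_eq_zero isPreconnected_Ioi
    (fun x hx => (hd x hx).differentiableAt.differentiableWithinAt) (fun x hx => (hd x hx).deriv)
    hl hl'

end Profile

/-! ### The weighted mean value property -/

/-- The integral of the radial profile over `ℝ^(d+2)`. -/
def profileMass (d : ℕ) : ℝ := ∫ z : EuclideanSpace ℝ (Fin (d + 2)), profile (‖z‖ ^ 2)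

section MeanValue

variable {d : ℕ}

lemma continuous_profile_norm_sq :
    Continuous fun z : EuclideanSpace ℝ (Fin (d + 2)) => profile (‖z‖ ^ 2) :=
  continuous_profile.comp (by fun_prop)

lemma hasCompactSupport_profile_norm_sq_zero :
    HasCompactSupport fun z : EuclideanSpace ℝ (Fin (d + 2)) => profile (‖z‖ ^ 2) := by
  simpa using hasCompactSupport_profile_norm_sq (d := d) one_pos 0

lemma profileMass_pos : 0 < profileMass d := by
  refine continuous_profile_norm_sq.integral_pos_of_hasCompactSupport_nonneg_nonzero
    hasCompactSupport_profile_norm_sq_zero (fun z => profile_nonneg _) (x := 0) ?_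
  simpa using (profile_pos one_pos).ne'

lemma profile_terms_eq_zero {l : ℝ} (hl : 0 < l) {a z : EuclideanSpace ℝ (Fin (d + 2))}
    (hz : 1 / l < ‖z - a‖) :
    profile (l ^ 2 * ‖z - a‖ ^ 2) = 0 ∧ deriv profile (l ^ 2 * ‖z - a‖ ^ 2) = 0 ∧
      profilePrimitive (l ^ 2 * ‖z - a‖ ^ 2) = 0 := by
  have h : 1 < l ^ 2 * ‖z - a‖ ^ 2 := by
    rw [div_lt_iff₀ hl] at hz
    nlinarith [norm_nonneg (z - a)]
  exact ⟨profile_eq_zero h.le, deriv_profile_eq_zero h, profilePrimitive_eq_zero h.le⟩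

lemma tendsto_pow_mul_integral_mul_profile {f : EuclideanSpace ℝ (Fin (d + 2)) → ℝ}
    (hf : Integrable f) {x : EuclideanSpace ℝ (Fin (d + 2))} (hx : ContinuousAt f x) :
    Tendsto (fun l : ℝ => l ^ (d + 2) * ∫ z, f z * profile (l ^ 2 * ‖z - x‖ ^ 2)) atTop
      (nhds (profileMass d * f x)) := by
  have hc := profileMass_pos (d := d)
  have h := tendsto_integral_comp_smul_smul_of_integrable' (μ := volume) (x₀ := x)
    (φ := fun z : EuclideanSpace ℝ (Fin (d + 2)) => (profileMass d)⁻¹ * profile (‖z‖ ^ 2))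
    (fun z => mul_nonneg (inv_nonneg.2 hc.le) (profile_nonneg _))
    (by rw [integral_const_mul]; exact inv_mul_cancel₀ hc.ne') ?_ hf hx
  · refine (h.const_mul (profileMass d)).congr fun l => ?_
    rw [← integral_const_mul, ← integral_const_mul]
    congr 1
    ext z
    rw [finrank_euclideanSpace_fin, norm_smul, mul_pow, norm_sub_rev, Real.norm_eq_abs, sq_abs,
      smul_eq_mul]
    field_simp
  · refine tendsto_const_nhds.congr' ?_
    have : ∀ᶠ z in Bornology.cobounded (EuclideanSpace ℝ (Fin (d + 2))), 1 ≤ ‖z‖ :=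
      tendsto_norm_cobounded_atTop.eventually_ge_atTop 1
    filter_upwards [this] with z hz
    rw [profile_eq_zero (one_le_pow₀ hz)]
    simp

/-- **Weighted mean value property** of harmonic functions. -/
lemma pow_mul_integral_mul_profile_eq_of_harmonic {v : EuclideanSpace ℝ (Fin (d + 2)) → ℝ}
    {U : Set (EuclideanSpace ℝ (Fin (d + 2)))} (hU : IsOpen U) (hv : ContDiffOn ℝ 2 v U)
    (hharm : ∀ z ∈ U, lapE v z = 0) {x : EuclideanSpace ℝ (Fin (d + 2))} {r : ℝ} (hr : 0 < r)
    (hball : closedBall x r ⊆ U) {l : ℝ} (hl : 1 / r < l) :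
    l ^ (d + 2) * ∫ z, v z * profile (l ^ 2 * ‖z - x‖ ^ 2) = profileMass d * v x := by
  have hint : Integrable ((closedBall x r).indicator v) :=
    (integrable_indicator_iff isClosed_closedBall.measurableSet).2
      ((hv.continuousOn.mono hball).integrableOn_compact (isCompact_closedBall x r))
  have hnhds : closedBall x r ∈ nhds x := closedBall_mem_nhds x hr
  have heq : (closedBall x r).indicator v =ᶠ[nhds x] v := by
    filter_upwards [hnhds] with z hz using indicator_of_mem hz v
  have hxU : x ∈ U := hball (mem_closedBall_self hr.le)
  have hcont : ContinuousAt ((closedBall x r).indicator v) x :=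
    (hv.continuousOn.continuousAt (hU.mem_nhds hxU)).congr heq.symm
  have hrpos : 0 < 1 / r := by positivity
  have hind : ∀ l, 1 / r < l → ∀ g : EuclideanSpace ℝ (Fin (d + 2)) → ℝ,
      (∀ z, 1 / l < ‖z - x‖ → g z = 0) → ∀ z, (closedBall x r).indicator v z * g z = v z * g z := by
    intro l hl g hg z
    by_cases hz : z ∈ closedBall x r
    · rw [indicator_of_mem hz]
    · rw [hg z, mul_zero, mul_zero]
      rw [mem_closedBall, dist_eq_norm, not_le] at hz
      exact lt_trans (by rwa [one_div_lt (hrpos.trans hl) hr]) hz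
  have hconst : ∀ l', 1 / r < l' →
      l' ^ (d + 2) * ∫ z, (closedBall x r).indicator v z * profile (l' ^ 2 * ‖z - x‖ ^ 2) =
      l ^ (d + 2) * ∫ z, (closedBall x r).indicator v z * profile (l ^ 2 * ‖z - x‖ ^ 2) := by
    intro l' hl'
    refine pow_mul_integral_mul_profile_eq hint x (d + 2) hrpos.le (fun l hl => ?_) hl' hl
    have hl0 : 0 < l := hrpos.trans hl
    have hgreen := integral_mul_lapE_eq_zero hU hv hharm
      (contDiff_profilePrimitive_norm_sq l x) (hasCompactSupport_profilePrimitive_norm_sq hl0 x)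
      ((tsupport_profilePrimitive_norm_sq_subset hl0 x).trans ((closedBall_subset_closedBall
        (by rw [one_div_le hl0 hr]; exact hl.le)).trans hball))
    simp only [lapE_comp_norm_sq hasDerivAt_profilePrimitive hasDerivAt_profile] at hgreen
    rw [integral_congr_ae (Eventually.of_forall (hind l hl _ fun z hz => by
      obtain ⟨h1, h2, -⟩ := profile_terms_eq_zero hl0 hz
      rw [h1, h2]; simp))]
    have h2 : ∀ z, v z * (2 * l ^ 2 * (((d : ℝ) + 2) * profile (l ^ 2 * ‖z - x‖ ^ 2)
        + 2 * (l ^ 2 * ‖z - x‖ ^ 2) * deriv profile (l ^ 2 * ‖z - x‖ ^ 2))) =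
        2 * l ^ 2 * (v z * (((d + 2 : ℕ) : ℝ) * profile (l ^ 2 * ‖z - x‖ ^ 2)
        + 2 * (l ^ 2 * ‖z - x‖ ^ 2) * deriv profile (l ^ 2 * ‖z - x‖ ^ 2))) :=
      fun z => by push_cast; ring
    simp only [h2] at hgreen
    rw [integral_const_mul] at hgreen
    exact (mul_eq_zero.1 hgreen).resolve_left (by positivity)
  have hlim := tendsto_pow_mul_integral_mul_profile hint hcont
  rw [heq.self_of_nhds] at hlim
  have hlim2 := hlim.congr' ((eventually_gt_atTop (1 / r)).mono hconst)
  rw [← tendsto_nhds_unique tendsto_const_nhds hlim2]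
  congr 1
  exact integral_congr_ae (Eventually.of_forall fun z => (hind l hl _ (fun z hz =>
    (profile_terms_eq_zero (hrpos.trans hl) hz).1) z).symm)

end MeanValue

/-! ### A smooth cutoff away from the boundary -/

/-- A smooth function vanishing on `(-∞, 1]` and equal to the identity on `[2, ∞)`. -/
def ramp (t : ℝ) : ℝ := t * Real.smoothTransition (t - 1)

section Ramp

open scoped ContDiff

lemma contDiff_ramp : ContDiff ℝ ∞ ramp :=
  contDiff_id.mul (Real.smoothTransition.contDiff.comp (contDiff_id.sub contDiff_const))

lemma contDiff_deriv_ramp : ContDiff ℝ ∞ (deriv ramp) :=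
  (contDiff_infty_iff_deriv.1 contDiff_ramp).2

lemma continuous_deriv_deriv_ramp : Continuous (deriv (deriv ramp)) :=
  contDiff_deriv_ramp.continuous_deriv (by simp)

lemma hasDerivAt_ramp (t : ℝ) : HasDerivAt ramp (deriv ramp t) t :=
  (contDiff_ramp.differentiable (by simp) t).hasDerivAt

lemma hasDerivAt_deriv_ramp (t : ℝ) : HasDerivAt (deriv ramp) (deriv (deriv ramp) t) t :=
  (contDiff_deriv_ramp.differentiable (by simp) t).hasDerivAt

lemma ramp_eq_zero {t : ℝ} (ht : t ≤ 1) : ramp t = 0 := by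
  rw [ramp, Real.smoothTransition.zero_of_nonpos (by linarith), mul_zero]

lemma ramp_eq_self {t : ℝ} (ht : 2 ≤ t) : ramp t = t := by
  rw [ramp, Real.smoothTransition.one_of_one_le (by linarith), mul_one]

lemma abs_ramp_le (t : ℝ) : |ramp t| ≤ |t| := by
  rw [ramp, abs_mul, abs_of_nonneg (Real.smoothTransition.nonneg _)]
  exact mul_le_of_le_one_right (abs_nonneg t) (Real.smoothTransition.le_one _)

lemma ramp_eventuallyEq_zero {t : ℝ} (ht : t < 1) : ramp =ᶠ[nhds t] fun _ => 0 := by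
  filter_upwards [Iio_mem_nhds ht] with s hs using ramp_eq_zero (le_of_lt hs)

lemma ramp_eventuallyEq_id {t : ℝ} (ht : 2 < t) : ramp =ᶠ[nhds t] id := by
  filter_upwards [Ioi_mem_nhds ht] with s hs using ramp_eq_self (le_of_lt hs)

lemma deriv_ramp_eq_zero {t : ℝ} (ht : t < 1) : deriv ramp t = 0 := by
  rw [(ramp_eventuallyEq_zero ht).deriv_eq]
  simp

lemma deriv_ramp_eq_one {t : ℝ} (ht : 2 < t) : deriv ramp t = 1 := by
  rw [(ramp_eventuallyEq_id ht).deriv_eq]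
  simp

lemma deriv_deriv_ramp_eq_zero_of_lt {t : ℝ} (ht : t < 1) : deriv (deriv ramp) t = 0 := by
  rw [(ramp_eventuallyEq_zero ht).deriv.deriv_eq]
  simp

lemma deriv_deriv_ramp_eq_zero_of_gt {t : ℝ} (ht : 2 < t) : deriv (deriv ramp) t = 0 := by
  rw [(ramp_eventuallyEq_id ht).deriv.deriv_eq]
  simp

lemma exists_bound_deriv_ramp :
    ∃ C, 0 ≤ C ∧ ∀ t, |deriv ramp t| ≤ C ∧ |deriv (deriv ramp) t| ≤ C := by
  obtain ⟨A, hA⟩ := (isCompact_Icc (a := (1 : ℝ)) (b := 2)).exists_bound_of_continuousOn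
    contDiff_deriv_ramp.continuous.continuousOn
  obtain ⟨B, hB⟩ := (isCompact_Icc (a := (1 : ℝ)) (b := 2)).exists_bound_of_continuousOn
    continuous_deriv_deriv_ramp.continuousOn
  have hA0 : 0 ≤ A := (norm_nonneg _).trans (hA 1 (by norm_num))
  have hB0 : 0 ≤ B := (norm_nonneg _).trans (hB 1 (by norm_num))
  refine ⟨A + B + 1, by linarith, fun t => ?_⟩
  rcases lt_or_ge t 1 with h | h
  · rw [deriv_ramp_eq_zero h, deriv_deriv_ramp_eq_zero_of_lt h, abs_zero]
    constructor <;> linarith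
  rcases le_or_gt t 2 with h' | h'
  · have h1 := hA t ⟨h, h'⟩
    have h2 := hB t ⟨h, h'⟩
    rw [Real.norm_eq_abs] at h1 h2
    constructor <;> linarith
  · rw [deriv_ramp_eq_one h', deriv_deriv_ramp_eq_zero_of_gt h', abs_zero, abs_one]
    constructor <;> linarith

end Ramp

/-! ### The weighted mean value property at the boundary -/

/-- The closed half-space `{z : 0 ≤ z₁}`. -/
def closedHalfSpace (d : ℕ) : Set (EuclideanSpace ℝ (Fin (d + 2))) := {z | 0 ≤ z 0}

section Boundary

variable {d : ℕ}

lemma isClosed_closedHalfSpace : IsClosed (closedHalfSpace d) := by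
  have : Continuous fun z : EuclideanSpace ℝ (Fin (d + 2)) => z 0 := by fun_prop
  exact isClosed_le continuous_const this

lemma abs_coord_sub_le (z p : EuclideanSpace ℝ (Fin (d + 2))) (i : Fin (d + 2)) :
    |z i - p i| ≤ ‖z - p‖ := by
  simpa using PiLp.norm_apply_le (z - p) i

lemma volume_slab_inter_closedBall_le (p : EuclideanSpace ℝ (Fin (d + 2))) {r t : ℝ}
    (hr : 0 ≤ r) (ht : 0 ≤ t) :
    volume.real ({z : EuclideanSpace ℝ (Fin (d + 2)) | 0 ≤ z 0 ∧ z 0 ≤ t} ∩ closedBall p r) ≤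
      t * (2 * r) ^ (d + 1) := by
  set a : Fin (d + 2) → ℝ := fun i => if i = 0 then 0 else p i - r with ha
  set b : Fin (d + 2) → ℝ := fun i => if i = 0 then t else p i + r with hb
  have hab : a ≤ b := by
    intro i
    simp only [ha, hb]
    split_ifs <;> linarith
  have hsub : ({z : EuclideanSpace ℝ (Fin (d + 2)) | 0 ≤ z 0 ∧ z 0 ≤ t} ∩ closedBall p r) ⊆
      (fun z : EuclideanSpace ℝ (Fin (d + 2)) => z.ofLp) ⁻¹' (Icc a b) := by
    rintro z ⟨⟨h0, h1⟩, hz⟩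
    rw [mem_closedBall, dist_eq_norm] at hz
    have hc : ∀ i, p i - r ≤ z i ∧ z i ≤ p i + r := fun i => by
      have := abs_le.1 ((abs_coord_sub_le z p i).trans hz)
      constructor <;> linarith [this.1, this.2]
    refine ⟨fun i => ?_, fun i => ?_⟩
    · simp only [ha]
      split_ifs with hi
      · rw [hi]; exact h0
      · exact (hc i).1
    · simp only [hb]
      split_ifs with hi
      · rw [hi]; exact h1
      · exact (hc i).2
  have hmp := PiLp.volume_preserving_ofLp (Fin (d + 2))
  have hvol : volume ((fun z : EuclideanSpace ℝ (Fin (d + 2)) => z.ofLp) ⁻¹' (Icc a b)) =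
      volume (Icc a b) := hmp.measure_preimage measurableSet_Icc.nullMeasurableSet
  have hfin : volume ((fun z : EuclideanSpace ℝ (Fin (d + 2)) => z.ofLp) ⁻¹' (Icc a b)) ≠ ⊤ := by
    rw [hvol]
    exact isCompact_Icc.measure_ne_top
  refine (measureReal_mono hsub hfin).trans (le_of_eq ?_)
  rw [measureReal_def, hvol, Real.volume_Icc_pi_toReal hab, Fin.prod_univ_succ]
  have : ∀ i : Fin (d + 1), b i.succ - a i.succ = 2 * r := fun i => by
    simp only [ha, hb, Fin.succ_ne_zero, if_false]
    ring
  rw [Finset.prod_congr rfl fun i _ => this i]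
  simp [ha, hb]

/-- A function continuous up to the boundary and vanishing there is locally uniformly small
near the boundary. -/
lemma exists_abs_le_of_near_boundary {v : EuclideanSpace ℝ (Fin (d + 2)) → ℝ}
    (hcont : ContinuousOn v (closedHalfSpace d))
    (hbd : ∀ z : EuclideanSpace ℝ (Fin (d + 2)), z 0 = 0 → v z = 0)
    (p : EuclideanSpace ℝ (Fin (d + 2))) (r : ℝ) {δ : ℝ} (hδ : 0 < δ) :
    ∃ t > 0, ∀ z ∈ closedBall p r, 0 ≤ z 0 → z 0 ≤ t → |v z| ≤ δ := by
  have hK : IsCompact (closedBall p (r + 1) ∩ closedHalfSpace d) :=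
    (isCompact_closedBall _ _).inter_right isClosed_closedHalfSpace
  have huc := hK.uniformContinuousOn_of_continuous (hcont.mono inter_subset_right)
  obtain ⟨t, ht, H⟩ := Metric.uniformContinuousOn_iff.1 huc δ hδ
  refine ⟨min (t / 2) 1, by positivity, fun z hz h0 hzt => ?_⟩
  have hzt1 : z 0 ≤ t / 2 := hzt.trans (min_le_left _ _)
  have hzt2 : z 0 ≤ 1 := hzt.trans (min_le_right _ _)
  set q : EuclideanSpace ℝ (Fin (d + 2)) := z - z 0 • basisVec 0 with hq
  have hq0 : q 0 = 0 := by simp [hq]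
  have hdist : dist z q = z 0 := by
    rw [dist_eq_norm, hq, sub_sub_cancel, norm_smul]
    simp [abs_of_nonneg h0]
  have hqK : q ∈ closedBall p (r + 1) := by
    rw [mem_closedBall] at hz ⊢
    have := dist_triangle q z p
    rw [dist_comm q z, hdist] at this
    linarith
  have := H z ⟨closedBall_subset_closedBall (by linarith) hz, h0⟩ q
    ⟨hqK, hq0.ge⟩ (by rw [hdist]; linarith)
  rw [hbd q hq0, dist_zero_right] at this
  exact this.le

end Boundary

section BoundaryFlux

variable {d : ℕ}

lemma hasDerivAt_scaled_ramp {ε : ℝ} (hε : 0 < ε) (t : ℝ) :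
    HasDerivAt (fun t => ε * ramp (t / ε)) (deriv ramp (t / ε)) t := by
  have h := ((hasDerivAt_ramp (t / ε)).comp t ((hasDerivAt_id t).div_const ε)).const_mul ε
  exact h.congr_deriv (by field_simp)

lemma hasDerivAt_deriv_scaled_ramp {ε : ℝ} (t : ℝ) :
    HasDerivAt (fun t => deriv ramp (t / ε)) (deriv (deriv ramp) (t / ε) / ε) t := by
  have h := (hasDerivAt_deriv_ramp (t / ε)).comp t ((hasDerivAt_id t).div_const ε)
  exact h.congr_deriv (by ring)

lemma contDiff_scaled_ramp_coord (ε : ℝ) :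
    ContDiff ℝ 2 fun z : EuclideanSpace ℝ (Fin (d + 2)) => ε * ramp (z 0 / ε) :=
  contDiff_const.mul ((contDiff_ramp.of_le (by norm_cast)).comp
    ((EuclideanSpace.proj (0 : Fin (d + 2)) :
      EuclideanSpace ℝ (Fin (d + 2)) →L[ℝ] ℝ).contDiff.div_const ε))

lemma lapE_scaled_ramp_mul {ε : ℝ} (hε : 0 < ε) {p : EuclideanSpace ℝ (Fin (d + 2))}
    (hp : p 0 = 0) (l : ℝ) (z : EuclideanSpace ℝ (Fin (d + 2))) :
    lapE (fun y => ε * ramp (y 0 / ε) * profilePrimitive (l ^ 2 * ‖y - p‖ ^ 2)) z =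
      (ε * ramp (z 0 / ε) * (2 * l ^ 2 * ((d + 2) * profile (l ^ 2 * ‖z - p‖ ^ 2)
        + 2 * (l ^ 2 * ‖z - p‖ ^ 2) * deriv profile (l ^ 2 * ‖z - p‖ ^ 2)))
      + deriv ramp (z 0 / ε) * (4 * l ^ 2 * profile (l ^ 2 * ‖z - p‖ ^ 2) * z 0))
      + deriv (deriv ramp) (z 0 / ε) / ε * profilePrimitive (l ^ 2 * ‖z - p‖ ^ 2) := by
  rw [lapE_mul (contDiff_scaled_ramp_coord ε) (contDiff_profilePrimitive_norm_sq l p)]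
  simp only [fderiv_comp_coord_zero (hasDerivAt_scaled_ramp hε),
    fderiv_comp_norm_sq hasDerivAt_profilePrimitive]
  rw [lapE_comp_norm_sq hasDerivAt_profilePrimitive hasDerivAt_profile,
    lapE_comp_coord_zero (hasDerivAt_scaled_ramp hε) hasDerivAt_deriv_scaled_ramp]
  simp only [ite_mul, zero_mul, Finset.sum_ite_eq', Finset.mem_univ, if_true, hp]
  ring

/-- The half ball of radius `r`. -/
def halfBall (p : EuclideanSpace ℝ (Fin (d + 2))) (r : ℝ) :
    Set (EuclideanSpace ℝ (Fin (d + 2))) := closedBall p r ∩ closedHalfSpace d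

lemma isCompact_halfBall (p : EuclideanSpace ℝ (Fin (d + 2))) (r : ℝ) :
    IsCompact (halfBall p r) :=
  (isCompact_closedBall p r).inter_right isClosed_closedHalfSpace

lemma integral_halfBall_green {v : EuclideanSpace ℝ (Fin (d + 2)) → ℝ}
    (hcont : ContinuousOn v (closedHalfSpace d))
    (hC2 : ContDiffOn ℝ 2 v (HalfSpace d)) (hharm : ∀ z ∈ HalfSpace d, lapE v z = 0)
    {p : EuclideanSpace ℝ (Fin (d + 2))} (hp : p 0 = 0) {l : ℝ} (hl : 0 < l)
    {ε : ℝ} (hε : 0 < ε) :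
    (∫ z in halfBall p (1 / l), v z * (ε * ramp (z 0 / ε) *
        (2 * l ^ 2 * ((d + 2) * profile (l ^ 2 * ‖z - p‖ ^ 2)
        + 2 * (l ^ 2 * ‖z - p‖ ^ 2) * deriv profile (l ^ 2 * ‖z - p‖ ^ 2)))
      + deriv ramp (z 0 / ε) * (4 * l ^ 2 * profile (l ^ 2 * ‖z - p‖ ^ 2) * z 0)))
    + (∫ z in halfBall p (1 / l), v z * (deriv (deriv ramp) (z 0 / ε) / ε *
        profilePrimitive (l ^ 2 * ‖z - p‖ ^ 2))) = 0 := by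
  have hK := isCompact_halfBall p (1 / l)
  have hvK : ContinuousOn v (halfBall p (1 / l)) := hcont.mono inter_subset_right
  have h1 := continuous_deriv_profile
  have h2 := continuous_profile
  have h3 := contDiff_ramp.continuous
  have h4 := contDiff_deriv_ramp.continuous
  have h5 := continuous_deriv_deriv_ramp
  have h6 := contDiff_profilePrimitive.continuous
  have hc : Continuous fun z : EuclideanSpace ℝ (Fin (d + 2)) => z 0 / ε := by fun_prop
  rw [← integral_add]
  · have hsupp : tsupport (fun y : EuclideanSpace ℝ (Fin (d + 2)) =>
        ε * ramp (y 0 / ε) * profilePrimitive (l ^ 2 * ‖y - p‖ ^ 2)) ⊆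
        {z | ε ≤ z 0} := by
      refine closure_minimal (fun z hz => ?_) (isClosed_le continuous_const (by fun_prop))
      by_contra hlt
      refine hz ?_
      have : z 0 / ε ≤ 1 := by
        rw [div_le_one hε]
        exact (not_le.1 hlt).le
      simp [ramp_eq_zero this]
    have hg := integral_mul_lapE_eq_zero isOpen_halfSpace hC2 hharm
      ((contDiff_scaled_ramp_coord ε).mul (contDiff_profilePrimitive_norm_sq l p))
      ((hasCompactSupport_profilePrimitive_norm_sq hl p).mul_left)
      (hsupp.trans fun z hz => lt_of_lt_of_le hε hz)
    simp only [lapE_scaled_ramp_mul hε hp] at hg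
    refine Eq.trans ?_
      ((setIntegral_eq_integral_of_forall_compl_eq_zero (s := halfBall p (1 / l)) ?_).trans hg)
    · simp only [mul_add]
    · intro z hz
      rcases lt_or_ge (z 0) 0 with h0 | h0
      · have : z 0 / ε < 1 := lt_of_lt_of_le (div_neg_of_neg_of_pos h0 hε) zero_le_one
        rw [ramp_eq_zero this.le, deriv_ramp_eq_zero this, deriv_deriv_ramp_eq_zero_of_lt this]
        simp
      · have : 1 / l < ‖z - p‖ := by
          by_contra hle
          refine hz ⟨?_, h0⟩
          rw [mem_closedBall, dist_eq_norm]
          exact not_lt.1 hle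
        obtain ⟨e1, e2, e3⟩ := profile_terms_eq_zero hl this
        rw [e1, e2, e3]
        simp
  · refine (hvK.mul (Continuous.continuousOn ?_)).integrableOn_compact hK
    fun_prop
  · refine (hvK.mul (Continuous.continuousOn ?_)).integrableOn_compact hK
    fun_prop

lemma tendsto_integral_halfBall {v : EuclideanSpace ℝ (Fin (d + 2)) → ℝ}
    (hcont : ContinuousOn v (closedHalfSpace d))
    (hbd : ∀ z : EuclideanSpace ℝ (Fin (d + 2)), z 0 = 0 → v z = 0)
    {p : EuclideanSpace ℝ (Fin (d + 2))} {l : ℝ} :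
    Tendsto (fun ε : ℝ => ∫ z in halfBall p (1 / l), v z * (ε * ramp (z 0 / ε) *
        (2 * l ^ 2 * ((d + 2) * profile (l ^ 2 * ‖z - p‖ ^ 2)
        + 2 * (l ^ 2 * ‖z - p‖ ^ 2) * deriv profile (l ^ 2 * ‖z - p‖ ^ 2)))
      + deriv ramp (z 0 / ε) * (4 * l ^ 2 * profile (l ^ 2 * ‖z - p‖ ^ 2) * z 0)))
      (nhdsWithin 0 (Ioi 0))
      (nhds (∫ z in halfBall p (1 / l), v z * (z 0 *
        (2 * l ^ 2 * ((d + 2) * profile (l ^ 2 * ‖z - p‖ ^ 2)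
        + 2 * (l ^ 2 * ‖z - p‖ ^ 2) * deriv profile (l ^ 2 * ‖z - p‖ ^ 2)))
      + 1 * (4 * l ^ 2 * profile (l ^ 2 * ‖z - p‖ ^ 2) * z 0)))) := by
  have hK := isCompact_halfBall p (1 / l)
  have hvK : ContinuousOn v (halfBall p (1 / l)) := hcont.mono inter_subset_right
  have h1 := continuous_deriv_profile
  have h2 := continuous_profile
  have h3 := contDiff_ramp.continuous
  have h4 := contDiff_deriv_ramp.continuous
  obtain ⟨C, hC0, hC⟩ := exists_bound_deriv_ramp
  set A : EuclideanSpace ℝ (Fin (d + 2)) → ℝ := fun z =>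
    2 * l ^ 2 * ((d + 2) * profile (l ^ 2 * ‖z - p‖ ^ 2)
        + 2 * (l ^ 2 * ‖z - p‖ ^ 2) * deriv profile (l ^ 2 * ‖z - p‖ ^ 2)) with hA
  set B : EuclideanSpace ℝ (Fin (d + 2)) → ℝ := fun z =>
    4 * l ^ 2 * profile (l ^ 2 * ‖z - p‖ ^ 2) * z 0 with hB
  have hAc : Continuous A := by fun_prop
  have hBc : Continuous B := by fun_prop
  refine tendsto_integral_filter_of_dominated_convergence
    (fun z => |v z| * (|z 0| * |A z| + C * |B z|)) ?_ ?_ ?_ ?_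
  · refine Eventually.of_forall fun ε => ?_
    have hc : Continuous fun z : EuclideanSpace ℝ (Fin (d + 2)) => z 0 / ε := by fun_prop
    refine ((hvK.mul (Continuous.continuousOn ?_)).integrableOn_compact hK).aestronglyMeasurable
    fun_prop
  · filter_upwards [self_mem_nhdsWithin] with ε hε
    have hε : 0 < ε := hε
    refine Eventually.of_forall fun z => ?_
    rw [norm_mul, Real.norm_eq_abs, Real.norm_eq_abs]
    refine mul_le_mul_of_nonneg_left ((abs_add_le _ _).trans ?_) (abs_nonneg _)
    rw [abs_mul (ε * ramp _), abs_mul (deriv ramp _), abs_mul ε, abs_of_pos hε]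
    refine add_le_add (mul_le_mul_of_nonneg_right ?_ (abs_nonneg _))
      (mul_le_mul_of_nonneg_right (hC _).1 (abs_nonneg _))
    refine (mul_le_mul_of_nonneg_left (abs_ramp_le _) hε.le).trans (le_of_eq ?_)
    rw [abs_div, abs_of_pos hε]
    field_simp
  · refine (hvK.abs.mul (Continuous.continuousOn ?_)).integrableOn_compact hK
    fun_prop
  · refine (ae_restrict_iff' hK.measurableSet).2 (Eventually.of_forall fun z hz => ?_)
    have h0 : 0 ≤ z 0 := hz.2
    rcases h0.eq_or_lt with h | h
    · simp [hbd z h.symm]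
    · refine tendsto_const_nhds.congr' ?_
      filter_upwards [Ioo_mem_nhdsGT (show (0 : ℝ) < z 0 / 2 by linarith)] with ε hε
      have h2 : 2 < z 0 / ε := by
        rw [lt_div_iff₀ hε.1]
        linarith [hε.2]
      rw [ramp_eq_self h2.le, deriv_ramp_eq_one h2, mul_div_cancel₀ _ hε.1.ne']

lemma tendsto_integral_halfBall_zero {v : EuclideanSpace ℝ (Fin (d + 2)) → ℝ}
    (hcont : ContinuousOn v (closedHalfSpace d))
    (hbd : ∀ z : EuclideanSpace ℝ (Fin (d + 2)), z 0 = 0 → v z = 0)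
    {p : EuclideanSpace ℝ (Fin (d + 2))} {l : ℝ} (hl : 0 < l) :
    Tendsto (fun ε : ℝ => ∫ z in halfBall p (1 / l), v z * (deriv (deriv ramp) (z 0 / ε) / ε *
        profilePrimitive (l ^ 2 * ‖z - p‖ ^ 2))) (nhdsWithin 0 (Ioi 0)) (nhds 0) := by
  obtain ⟨C, hC0, hC⟩ := exists_bound_deriv_ramp
  obtain ⟨G, hG⟩ := (isCompact_closedBall p (1 / l)).exists_bound_of_continuousOn
    (contDiff_profilePrimitive_norm_sq l p).continuous.continuousOn
  have hl1 : 0 < 1 / l := by positivity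
  have hG0 : 0 ≤ G := (norm_nonneg _).trans (hG p (mem_closedBall_self hl1.le))
  set D : ℝ := C * G * (2 * (2 * (1 / l)) ^ (d + 1)) with hD
  have hD0 : 0 ≤ D := by positivity
  rw [Metric.tendsto_nhds]
  intro δ hδ
  obtain ⟨t, ht, H⟩ := exists_abs_le_of_near_boundary hcont hbd p (1 / l)
    (show 0 < δ / (D + 1) by positivity)
  filter_upwards [Ioo_mem_nhdsGT (show (0 : ℝ) < t / 2 by linarith)] with ε hε
  have hε0 := hε.1
  set S : Set (EuclideanSpace ℝ (Fin (d + 2))) :=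
    {z : EuclideanSpace ℝ (Fin (d + 2)) | 0 ≤ z 0 ∧ z 0 ≤ 2 * ε} ∩ closedBall p (1 / l) with hS
  have hSm : MeasurableSet S := by
    have hc : Continuous fun z : EuclideanSpace ℝ (Fin (d + 2)) => z 0 := by fun_prop
    exact (((isClosed_le continuous_const hc).inter (isClosed_le hc continuous_const)).inter
      isClosed_closedBall).measurableSet
  have hSfin : volume S < ⊤ :=
    (measure_mono inter_subset_right).trans_lt (isCompact_closedBall p (1 / l)).measure_lt_top
  have hSK : S ⊆ halfBall p (1 / l) := fun z hz => ⟨hz.2, hz.1.1⟩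
  have hred : ∫ z in halfBall p (1 / l), v z * (deriv (deriv ramp) (z 0 / ε) / ε *
        profilePrimitive (l ^ 2 * ‖z - p‖ ^ 2)) = ∫ z in S, v z *
        (deriv (deriv ramp) (z 0 / ε) / ε * profilePrimitive (l ^ 2 * ‖z - p‖ ^ 2)) := by
    refine setIntegral_eq_of_subset_of_forall_sdiff_eq_zero
      (isCompact_halfBall p (1 / l)).measurableSet hSK fun z hz => ?_
    have h2 : 2 < z 0 / ε := by
      rw [lt_div_iff₀ hε0]
      by_contra hle
      exact hz.2 ⟨⟨hz.1.2, not_lt.1 hle⟩, hz.1.1⟩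
    rw [deriv_deriv_ramp_eq_zero_of_gt h2]
    simp
  rw [hred, dist_zero_right]
  have hb : ∀ z ∈ S, ‖v z * (deriv (deriv ramp) (z 0 / ε) / ε *
      profilePrimitive (l ^ 2 * ‖z - p‖ ^ 2))‖ ≤ δ / (D + 1) * (C / ε * G) := by
    intro z hz
    have e1 := H z hz.2 hz.1.1 (hz.1.2.trans (by linarith [hε.2]))
    have e2 := hG z hz.2
    have e3 := (hC (z 0 / ε)).2
    rw [norm_mul, norm_mul, norm_div, Real.norm_of_nonneg hε0.le]
    gcongr
    exacts [e1, e3]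
  refine (norm_setIntegral_le_of_norm_le_const hSfin hb).trans_lt ?_
  have hvol := volume_slab_inter_closedBall_le p hl1.le (show 0 ≤ 2 * ε by linarith)
  calc δ / (D + 1) * (C / ε * G) * volume.real S
      ≤ δ / (D + 1) * (C / ε * G) * (2 * ε * (2 * (1 / l)) ^ (d + 1)) := by gcongr
    _ = δ * (D / (D + 1)) := by
      rw [hD]
      field_simp
    _ < δ := by
      refine mul_lt_of_lt_one_right hδ ?_
      rw [div_lt_one (by linarith)]
      linarith

/-- Vanishing of the scale derivative of the weighted boundary average. -/
lemma integral_halfBall_eq_zero {v : EuclideanSpace ℝ (Fin (d + 2)) → ℝ}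
    (hcont : ContinuousOn v (closedHalfSpace d))
    (hC2 : ContDiffOn ℝ 2 v (HalfSpace d)) (hharm : ∀ z ∈ HalfSpace d, lapE v z = 0)
    (hbd : ∀ z : EuclideanSpace ℝ (Fin (d + 2)), z 0 = 0 → v z = 0)
    {p : EuclideanSpace ℝ (Fin (d + 2))} (hp : p 0 = 0) {l : ℝ} (hl : 0 < l) :
    ∫ z in halfBall p (1 / l), v z * z 0 * (((d + 4 : ℕ) : ℝ) * profile (l ^ 2 * ‖z - p‖ ^ 2)
        + 2 * (l ^ 2 * ‖z - p‖ ^ 2) * deriv profile (l ^ 2 * ‖z - p‖ ^ 2)) = 0 := by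
  have h := (tendsto_integral_halfBall hcont hbd (p := p) (l := l)).add
    (tendsto_integral_halfBall_zero hcont hbd (p := p) hl)
  have h0 : Tendsto (fun _ : ℝ => (0 : ℝ)) (nhdsWithin 0 (Ioi 0)) (nhds 0) := tendsto_const_nhds
  have h1 := tendsto_nhds_unique (h0.congr' (by
    filter_upwards [self_mem_nhdsWithin] with ε hε
    exact (integral_halfBall_green hcont hC2 hharm hp hl hε).symm)) h
  rw [add_zero] at h1
  have h2 : (2 * l ^ 2) * ∫ z in halfBall p (1 / l), v z * z 0 *
      (((d + 4 : ℕ) : ℝ) * profile (l ^ 2 * ‖z - p‖ ^ 2)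
        + 2 * (l ^ 2 * ‖z - p‖ ^ 2) * deriv profile (l ^ 2 * ‖z - p‖ ^ 2)) = 0 := by
    rw [h1, ← integral_const_mul]
    congr 1
    ext z
    push_cast
    ring
  exact (mul_eq_zero.1 h2).resolve_left (by positivity)

/-- The weighted average of `v z * z₁` around a boundary point does not depend on the scale. -/
lemma pow_mul_setIntegral_profile_eq {v : EuclideanSpace ℝ (Fin (d + 2)) → ℝ}
    (hcont : ContinuousOn v (closedHalfSpace d))
    (hC2 : ContDiffOn ℝ 2 v (HalfSpace d)) (hharm : ∀ z ∈ HalfSpace d, lapE v z = 0)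
    (hbd : ∀ z : EuclideanSpace ℝ (Fin (d + 2)), z 0 = 0 → v z = 0)
    {p : EuclideanSpace ℝ (Fin (d + 2))} (hp : p 0 = 0) {l l' : ℝ} (hl : 0 < l) (hl' : 0 < l') :
    l ^ (d + 4) * ∫ z in closedHalfSpace d, v z * z 0 * profile (l ^ 2 * ‖z - p‖ ^ 2) =
      l' ^ (d + 4) * ∫ z in closedHalfSpace d, v z * z 0 * profile (l' ^ 2 * ‖z - p‖ ^ 2) := by
  set l₀ : ℝ := min l l' / 2 with hl₀
  have hl₀pos : 0 < l₀ := by positivity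
  have hl₀l : l₀ < l := by
    have := min_le_left l l'
    have : 0 < min l l' := by positivity
    linarith
  have hl₀l' : l₀ < l' := by
    have := min_le_right l l'
    have : 0 < min l l' := by positivity
    linarith
  have hK := isCompact_halfBall p (1 / l₀)
  set f : EuclideanSpace ℝ (Fin (d + 2)) → ℝ :=
    (halfBall p (1 / l₀)).indicator fun z => v z * z 0 with hf
  have hfi : Integrable f := by
    have hc : Continuous fun z : EuclideanSpace ℝ (Fin (d + 2)) => z 0 := by fun_prop
    exact (integrable_indicator_iff hK.measurableSet).2
      (((hcont.mono inter_subset_right).mul hc.continuousOn).integrableOn_compact hK)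
  have hred : ∀ m, l₀ < m → ∀ g : EuclideanSpace ℝ (Fin (d + 2)) → ℝ,
      (∀ z, 1 / m < ‖z - p‖ → g z = 0) →
      (∫ z, f z * g z = ∫ z in halfBall p (1 / m), v z * z 0 * g z) ∧
      ∫ z, f z * g z = ∫ z in closedHalfSpace d, v z * z 0 * g z := by
    intro m hm g hg
    have hm0 : 0 < m := hl₀pos.trans hm
    have hsub : halfBall p (1 / m) ⊆ halfBall p (1 / l₀) :=
      inter_subset_inter_left _ (closedBall_subset_closedBall
        (one_div_le_one_div_of_le hl₀pos hm.le))
    have hz0 : ∀ z, z ∉ closedBall p (1 / m) → g z = 0 := fun z hz =>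
      hg z (by rwa [mem_closedBall, dist_eq_norm, not_le] at hz)
    have e1 : ∫ z, f z * g z = ∫ z in halfBall p (1 / m), v z * z 0 * g z := by
      rw [← integral_indicator (isCompact_halfBall p (1 / m)).measurableSet]
      congr 1
      ext z
      by_cases hz : z ∈ halfBall p (1 / m)
      · rw [indicator_of_mem hz, hf, indicator_of_mem (hsub hz)]
      · rw [indicator_of_notMem hz]
        by_cases hzb : z ∈ closedBall p (1 / m)
        · rw [hf, indicator_of_notMem fun h => hz ⟨hzb, h.2⟩, zero_mul]
        · rw [hz0 z hzb, mul_zero]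
    refine ⟨e1, e1.trans ?_⟩
    refine (setIntegral_eq_of_subset_of_forall_sdiff_eq_zero
      isClosed_closedHalfSpace.measurableSet inter_subset_right fun z hz => ?_).symm
    rw [hz0 z fun h => hz.2 ⟨h, hz.1⟩, mul_zero]
  have hmain := pow_mul_integral_mul_profile_eq hfi p (d + 4) hl₀pos.le (fun m hm => by
    have hm0 : 0 < m := hl₀pos.trans hm
    rw [(hred m hm _ fun z hz => by
      obtain ⟨e1, e2, -⟩ := profile_terms_eq_zero hm0 hz
      rw [e1, e2]; simp).1]
    exact integral_halfBall_eq_zero hcont hC2 hharm hbd hp hm0) hl₀l hl₀l'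
  rwa [(hred l hl₀l _ fun z hz => (profile_terms_eq_zero hl hz).1).2,
    (hred l' hl₀l' _ fun z hz => (profile_terms_eq_zero hl' hz).1).2] at hmain

end BoundaryFlux

section LinearGrowth

variable {d : ℕ}

lemma integrableOn_mul_coord_mul_profile {v : EuclideanSpace ℝ (Fin (d + 2)) → ℝ}
    (hcont : ContinuousOn v (closedHalfSpace d)) (p : EuclideanSpace ℝ (Fin (d + 2))) {l : ℝ}
    (hl : 0 < l) :
    IntegrableOn (fun z => v z * z 0 * profile (l ^ 2 * ‖z - p‖ ^ 2)) (closedHalfSpace d) := by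
  have h1 : IntegrableOn (fun z => v z * z 0 * profile (l ^ 2 * ‖z - p‖ ^ 2))
      (halfBall p (1 / l)) := by
    have hc : Continuous fun z : EuclideanSpace ℝ (Fin (d + 2)) => z 0 := by fun_prop
    exact (((hcont.mono inter_subset_right).mul hc.continuousOn).mul
      (contDiff_profile_norm_sq l p).continuous.continuousOn).integrableOn_compact
      (isCompact_halfBall p (1 / l))
  refine h1.of_forall_sdiff_eq_zero isClosed_closedHalfSpace.measurableSet fun z hz => ?_
  rw [profile_eq_zero_of_le_dist hl, mul_zero]
  by_contra hlt
  refine hz.2 ⟨?_, hz.1⟩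
  rw [mem_closedBall, dist_eq_norm]
  exact (not_le.1 hlt).le

/-- A positive harmonic function on the half-space with zero boundary values grows at most
linearly in the distance to the boundary. -/
lemma exists_le_mul_coord {v : EuclideanSpace ℝ (Fin (d + 2)) → ℝ}
    (hcont : ContinuousOn v (closedHalfSpace d))
    (hC2 : ContDiffOn ℝ 2 v (HalfSpace d)) (hharm : ∀ z ∈ HalfSpace d, lapE v z = 0)
    (hnonneg : ∀ z ∈ closedHalfSpace d, 0 ≤ v z)
    (hbd : ∀ z : EuclideanSpace ℝ (Fin (d + 2)), z 0 = 0 → v z = 0) :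
    ∃ C, 0 ≤ C ∧ ∀ x ∈ HalfSpace d, v x ≤ C * x 0 := by
  set I : EuclideanSpace ℝ (Fin (d + 2)) → ℝ → ℝ := fun p l =>
    ∫ z in closedHalfSpace d, v z * z 0 * profile (l ^ 2 * ‖z - p‖ ^ 2) with hI
  set K : ℝ := profile 0 / profile (1 / 4) with hK
  have hK0 : 0 ≤ K := div_nonneg (profile_nonneg _) (profile_nonneg _)
  have hms := isClosed_closedHalfSpace.measurableSet (α := EuclideanSpace ℝ (Fin (d + 2)))
  have hvz : ∀ z ∈ closedHalfSpace d, 0 ≤ v z * z 0 := fun z hz => mul_nonneg (hnonneg z hz) hz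
  have hI0 : ∀ p l, 0 ≤ I p l := fun p l => setIntegral_nonneg hms fun z hz =>
    mul_nonneg (hvz z hz) (profile_nonneg _)
  have hconst : ∀ p : EuclideanSpace ℝ (Fin (d + 2)), p 0 = 0 → ∀ l l' : ℝ, 0 < l → 0 < l' →
      l ^ (d + 4) * I p l = l' ^ (d + 4) * I p l' := fun p hp l l' hl hl' =>
    pow_mul_setIntegral_profile_eq hcont hC2 hharm hbd hp hl hl'
  have hA : ∀ p : EuclideanSpace ℝ (Fin (d + 2)), p 0 = 0 → ∀ l : ℝ, 0 < l →
      l ^ (d + 4) * I p l ≤ K * 4 ^ (d + 4) * I 0 1 := by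
    intro p hp l hl
    set k : ℝ := 1 / (1 + ‖p‖) with hk
    have hp1 : 0 < 1 + ‖p‖ := by positivity
    have hk0 : 0 < k := by positivity
    have hcmp : I p k ≤ K * I 0 (k / 4) := by
      rw [hI]
      simp only
      rw [← integral_const_mul]
      refine setIntegral_mono_on (integrableOn_mul_coord_mul_profile hcont p hk0)
        ((integrableOn_mul_coord_mul_profile hcont 0 (by positivity)).const_mul _) hms
        fun z hz => ?_
      have := profile_le_mul_profile hk0 (show 0 < k / 4 by positivity) (a := p) (b := 0) (by
        rw [sub_zero, hk]
        have : ‖p‖ / (1 + ‖p‖) ≤ 1 := by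
          rw [div_le_one hp1]; linarith
        field_simp
        nlinarith [norm_nonneg p]) z
      calc _ ≤ v z * z 0 * (K * profile ((k / 4) ^ 2 * ‖z - 0‖ ^ 2)) :=
            mul_le_mul_of_nonneg_left this (hvz z hz)
        _ = _ := by ring
    calc l ^ (d + 4) * I p l = k ^ (d + 4) * I p k := hconst p hp l k hl hk0
      _ ≤ k ^ (d + 4) * (K * I 0 (k / 4)) := by gcongr
      _ = K * 4 ^ (d + 4) * ((k / 4) ^ (d + 4) * I 0 (k / 4)) := by
        have e : k ^ (d + 4) = 4 ^ (d + 4) * (k / 4) ^ (d + 4) := by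
          rw [← mul_pow, mul_div_cancel₀ _ (by norm_num)]
        rw [e]
        ring
      _ = K * 4 ^ (d + 4) * I 0 1 := by
        rw [hconst 0 (by simp) (k / 4) 1 (by positivity) one_pos]
        simp
  have hmass := profileMass_pos (d := d)
  refine ⟨10 ^ (d + 2) * (25 / 2) * K * (K * 4 ^ (d + 4) * I 0 1) / profileMass d, ?_,
    fun x hx => ?_⟩
  · have := hI0 0 1
    positivity
  have hx0 : 0 < x 0 := hx
  set p : EuclideanSpace ℝ (Fin (d + 2)) := x - x 0 • basisVec 0 with hp
  have hp0 : p 0 = 0 := by simp [hp]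
  have hxp : ‖x - p‖ = x 0 := by
    rw [hp, sub_sub_cancel, norm_smul]
    simp [abs_of_pos hx0]
  set m : ℝ := 2 / (5 * x 0) with hm
  set l : ℝ := 4 / x 0 with hl
  have hm0 : 0 < m := by positivity
  have hl0 : 0 < l := by positivity
  have hl1 : 1 / l = x 0 / 4 := by rw [hl, one_div_div]
  have hnear : ∀ z : EuclideanSpace ℝ (Fin (d + 2)), ‖z - x‖ ≤ x 0 / 2 → x 0 / 2 ≤ z 0 :=
    fun z hz => by linarith [(abs_le.1 ((abs_coord_sub_le z x 0).trans hz)).1]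
  have hmean := pow_mul_integral_mul_profile_eq_of_harmonic isOpen_halfSpace hC2 hharm
    (x := x) (r := x 0 / 2) (by positivity) (fun z hz => by
      rw [mem_closedBall, dist_eq_norm] at hz
      exact lt_of_lt_of_le (by positivity) (hnear z hz)) (l := l) (by
      rw [hl, one_div_div]
      gcongr
      norm_num)
  have hoff : ∀ z : EuclideanSpace ℝ (Fin (d + 2)), z 0 < x 0 / 2 →
      profile (l ^ 2 * ‖z - x‖ ^ 2) = 0 := fun z hz => by
    refine profile_eq_zero_of_le_dist hl0 ?_
    by_contra hlt
    rw [hl1, not_le] at hlt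
    linarith [hnear z (by linarith)]
  have hle : ∫ z, v z * profile (l ^ 2 * ‖z - x‖ ^ 2) ≤ 2 / x 0 * K * I p m := by
    rw [← setIntegral_eq_integral_of_forall_compl_eq_zero (s := closedHalfSpace d) fun z hz => by
      rw [hoff z ((not_le.1 hz).trans (by positivity)), mul_zero]]
    rw [hI]
    simp only
    rw [← integral_const_mul]
    refine integral_mono_of_nonneg ((ae_restrict_iff' hms).2 (Eventually.of_forall fun z hz =>
      mul_nonneg (hnonneg z hz) (profile_nonneg _)))
      ((integrableOn_mul_coord_mul_profile hcont p hm0).const_mul _)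
      ((ae_restrict_iff' hms).2 (Eventually.of_forall fun z hz => ?_))
    simp only
    have hcmp := profile_le_mul_profile hl0 hm0 (a := x) (b := p) (by
      rw [hl1, hxp, hm]
      apply le_of_eq
      field_simp
      norm_num) z
    rcases lt_or_ge (z 0) (x 0 / 2) with h | h
    · rw [hoff z h, mul_zero]
      have := hvz z hz
      have := profile_nonneg (m ^ 2 * ‖z - p‖ ^ 2)
      positivity
    · have h1 : 1 ≤ 2 / x 0 * z 0 := by
        rw [div_mul_eq_mul_div, le_div_iff₀ hx0]
        linarith
      calc v z * profile (l ^ 2 * ‖z - x‖ ^ 2)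
          ≤ v z * (K * profile (m ^ 2 * ‖z - p‖ ^ 2)) :=
            mul_le_mul_of_nonneg_left hcmp (hnonneg z hz)
        _ ≤ v z * (K * profile (m ^ 2 * ‖z - p‖ ^ 2)) * (2 / x 0 * z 0) :=
            le_mul_of_one_le_right (mul_nonneg (hnonneg z hz)
              (mul_nonneg hK0 (profile_nonneg _))) h1
        _ = _ := by ring
  rw [div_mul_eq_mul_div, le_div_iff₀ hmass, mul_comm (v x), ← hmean]
  calc l ^ (d + 2) * ∫ z, v z * profile (l ^ 2 * ‖z - x‖ ^ 2)
      ≤ l ^ (d + 2) * (2 / x 0 * K * I p m) := by gcongr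
    _ = 10 ^ (d + 2) * (25 / 2) * K * (m ^ (d + 4) * I p m) * x 0 := by
      have e1 : l = 10 * m := by
        rw [hl, hm]
        field_simp
        norm_num
      have e2 : 2 / x 0 = 25 / 2 * m ^ 2 * x 0 := by
        rw [hm]
        field_simp
        norm_num
      rw [e1, e2, mul_pow]
      ring
    _ ≤ 10 ^ (d + 2) * (25 / 2) * K * (K * 4 ^ (d + 4) * I 0 1) * x 0 := by
      have := hA p hp0 m hm0
      gcongr

lemma exists_lipschitz_profile_norm_sq :
    ∃ Λ : ℝ, 0 ≤ Λ ∧ ∀ (l : ℝ), 0 < l → ∀ z a b : EuclideanSpace ℝ (Fin (d + 2)),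
      |profile (l ^ 2 * ‖z - a‖ ^ 2) - profile (l ^ 2 * ‖z - b‖ ^ 2)| ≤ Λ * (l * ‖a - b‖) := by
  have hcd : ContDiff ℝ 1 fun z : EuclideanSpace ℝ (Fin (d + 2)) => profile (‖z‖ ^ 2) :=
    (contDiff_profile.comp (contDiff_id.norm_sq ℝ)).of_le (by norm_cast)
  obtain ⟨Λ, hΛ⟩ := hcd.lipschitzWith_of_hasCompactSupport
    hasCompactSupport_profile_norm_sq_zero one_ne_zero
  refine ⟨Λ, Λ.2, fun l hl z a b => ?_⟩
  have h := hΛ.dist_le_mul (l • (z - a)) (l • (z - b))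
  have h1 : ∀ y : EuclideanSpace ℝ (Fin (d + 2)), ‖l • y‖ ^ 2 = l ^ 2 * ‖y‖ ^ 2 := fun y => by
    rw [norm_smul, mul_pow, Real.norm_eq_abs, sq_abs]
  rw [h1, h1, dist_eq_norm, dist_eq_norm, ← smul_sub, sub_sub_sub_cancel_left, norm_smul,
    Real.norm_of_nonneg hl.le, norm_sub_rev b a, Real.norm_eq_abs] at h
  exact h

/-- Tangential increments of `v` are bounded. -/
lemma exists_abs_sub_le {v : EuclideanSpace ℝ (Fin (d + 2)) → ℝ}
    (hC2 : ContDiffOn ℝ 2 v (HalfSpace d)) (hharm : ∀ z ∈ HalfSpace d, lapE v z = 0)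
    (hnonneg : ∀ z ∈ closedHalfSpace d, 0 ≤ v z) {C : ℝ} (hC0 : 0 ≤ C)
    (hC : ∀ x ∈ HalfSpace d, v x ≤ C * x 0)
    {h : EuclideanSpace ℝ (Fin (d + 2))} (hh : h 0 = 0) :
    ∃ M, 0 < M ∧ ∀ z ∈ HalfSpace d, v (z + h) - v z ≤ M := by
  obtain ⟨Λ, hΛ0, hΛ⟩ := exists_lipschitz_profile_norm_sq (d := d)
  set V : ℝ := volume.real (ball (0 : EuclideanSpace ℝ (Fin (d + 2))) 1) with hV
  have hV0 : 0 ≤ V := measureReal_nonneg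
  have hmass := profileMass_pos (d := d)
  refine ⟨16 * V * C * Λ * ‖h‖ / profileMass d + 1, by positivity, fun z hz => ?_⟩
  have hz0 : 0 < z 0 := hz
  set l : ℝ := 4 / z 0 with hl
  have hl0 : 0 < l := by positivity
  have hl1 : 1 / l = z 0 / 4 := by rw [hl, one_div_div]
  have hnear : ∀ x : EuclideanSpace ℝ (Fin (d + 2)), x 0 = z 0 → ∀ y ∈ closedBall x (z 0 / 2),
      0 < y 0 ∧ y 0 ≤ 2 * z 0 := fun x hx y hy => by
    rw [mem_closedBall, dist_eq_norm] at hy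
    have := abs_le.1 ((abs_coord_sub_le y x 0).trans hy)
    constructor <;> linarith [this.1, this.2]
  have hmean : ∀ x : EuclideanSpace ℝ (Fin (d + 2)), x 0 = z 0 →
      l ^ (d + 2) * ∫ y, v y * profile (l ^ 2 * ‖y - x‖ ^ 2) = profileMass d * v x := fun x hx =>
    pow_mul_integral_mul_profile_eq_of_harmonic isOpen_halfSpace hC2 hharm
      (r := z 0 / 2) (by positivity) (fun y hy => (hnear x hx y hy).1) (by
        rw [hl, one_div_div]
        gcongr
        norm_num)
  have hzh : (z + h) 0 = z 0 := by simp [hh]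
  set T : Set (EuclideanSpace ℝ (Fin (d + 2))) :=
    closedBall z (1 / l) ∪ closedBall (z + h) (1 / l) with hT
  have hTc : IsCompact T := (isCompact_closedBall _ _).union (isCompact_closedBall _ _)
  have hTy : ∀ y ∈ T, 0 < y 0 ∧ y 0 ≤ 2 * z 0 := by
    have hsub : 1 / l ≤ z 0 / 2 := by rw [hl1]; linarith
    rintro y (hy | hy)
    · exact hnear z rfl y (closedBall_subset_closedBall hsub hy)
    · exact hnear _ hzh y (closedBall_subset_closedBall hsub hy)
  have hvT : ContinuousOn v T := hC2.continuousOn.mono fun y hy => (hTy y hy).1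
  have hint : ∀ x : EuclideanSpace ℝ (Fin (d + 2)),
      IntegrableOn (fun y => v y * profile (l ^ 2 * ‖y - x‖ ^ 2)) T := fun x =>
    (hvT.mul (contDiff_profile_norm_sq l x).continuous.continuousOn).integrableOn_compact hTc
  have hred : ∀ x : EuclideanSpace ℝ (Fin (d + 2)), closedBall x (1 / l) ⊆ T →
      ∫ y, v y * profile (l ^ 2 * ‖y - x‖ ^ 2) =
        ∫ y in T, v y * profile (l ^ 2 * ‖y - x‖ ^ 2) := fun x hx => by
    refine (setIntegral_eq_integral_of_forall_compl_eq_zero fun y hy => ?_).symm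
    rw [profile_eq_zero_of_le_dist hl0, mul_zero]
    by_contra hlt
    refine hy (hx ?_)
    rw [mem_closedBall, dist_eq_norm]
    exact (not_le.1 hlt).le
  have hdiff : profileMass d * (v (z + h) - v z) = l ^ (d + 2) *
      ∫ y in T, v y * (profile (l ^ 2 * ‖y - (z + h)‖ ^ 2) - profile (l ^ 2 * ‖y - z‖ ^ 2)) := by
    simp only [mul_sub]
    rw [integral_sub (hint _) (hint _), ← hred _ subset_union_left,
      ← hred _ subset_union_right, mul_sub, hmean _ hzh, hmean _ rfl]
  have hvol : volume.real T ≤ 2 * ((1 / l) ^ (d + 2) * V) := by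
    have hb : ∀ x : EuclideanSpace ℝ (Fin (d + 2)),
        volume.real (closedBall x (1 / l)) = (1 / l) ^ (d + 2) * V := fun x => by
      rw [Measure.addHaar_real_closedBall _ _ (by positivity), finrank_euclideanSpace_fin]
    refine (measureReal_union_le _ _).trans ?_
    rw [hb, hb]
    linarith
  have hbound : ∀ y ∈ T, ‖v y * (profile (l ^ 2 * ‖y - (z + h)‖ ^ 2) -
      profile (l ^ 2 * ‖y - z‖ ^ 2))‖ ≤ C * (2 * z 0) * (Λ * (l * ‖h‖)) := by
    intro y hy
    obtain ⟨y1, y2⟩ := hTy y hy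
    have e1 : |v y| ≤ C * (2 * z 0) := by
      rw [abs_of_nonneg (hnonneg y y1.le)]
      exact (hC y y1).trans (by gcongr)
    have e2 := hΛ l hl0 y (z + h) z
    rw [add_sub_cancel_left] at e2
    rw [norm_mul, Real.norm_eq_abs, Real.norm_eq_abs]
    gcongr
  have hmain := (le_abs_self _).trans (norm_setIntegral_le_of_norm_le_const
    (hTc.measure_lt_top (μ := volume)) hbound)
  have : v (z + h) - v z ≤ 16 * V * C * Λ * ‖h‖ / profileMass d := by
    rw [le_div_iff₀ hmass, mul_comm, hdiff]
    calc _ ≤ l ^ (d + 2) * (C * (2 * z 0) * (Λ * (l * ‖h‖)) * volume.real T) := by gcongr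
      _ ≤ l ^ (d + 2) * (C * (2 * z 0) * (Λ * (l * ‖h‖)) * (2 * ((1 / l) ^ (d + 2) * V))) := by
        gcongr
      _ = (l * (1 / l)) ^ (d + 2) * (4 * V * C * Λ * ‖h‖ * (l * z 0)) := by
        rw [mul_pow]
        ring
      _ = 16 * V * C * Λ * ‖h‖ := by
        rw [mul_one_div_cancel hl0.ne', one_pow, hl, div_mul_cancel₀ _ hz0.ne']
        ring
  linarith

end LinearGrowth

section PhragmenLindelof

variable {d : ℕ}

/-- The barrier on the truncated slab `{0 ≤ z₁ ≤ L, ‖z‖ ≤ R}`. -/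
def barrier (A B L : ℝ) (z : EuclideanSpace ℝ (Fin (d + 2))) : ℝ :=
  (A * z 0 + B * (d + 3) * (z 0 * (L - z 0))) + B * ((1 : ℝ) ^ 2 * ‖z - 0‖ ^ 2)

lemma contDiff_coord_zero :
    ContDiff ℝ 2 fun z : EuclideanSpace ℝ (Fin (d + 2)) => z 0 :=
  (EuclideanSpace.proj (0 : Fin (d + 2)) : EuclideanSpace ℝ (Fin (d + 2)) →L[ℝ] ℝ).contDiff

lemma contDiff_barrier_coord (A B L : ℝ) : ContDiff ℝ 2
    fun z : EuclideanSpace ℝ (Fin (d + 2)) => A * z 0 + B * (d + 3) * (z 0 * (L - z 0)) := by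
  have h := contDiff_coord_zero (d := d)
  fun_prop

lemma contDiff_barrier_norm (B : ℝ) : ContDiff ℝ 2
    fun z : EuclideanSpace ℝ (Fin (d + 2)) => B * ((1 : ℝ) ^ 2 * ‖z - 0‖ ^ 2) :=
  contDiff_const.mul (contDiff_const.mul ((contDiff_id.sub contDiff_const).norm_sq ℝ))

lemma contDiff_barrier (A B L : ℝ) : ContDiff ℝ 2 (barrier (d := d) A B L) :=
  (contDiff_barrier_coord A B L).add (contDiff_barrier_norm B)

lemma lapE_barrier (A B L : ℝ) (z : EuclideanSpace ℝ (Fin (d + 2))) :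
    lapE (barrier A B L) z = -2 * B := by
  have h1 : ∀ t : ℝ, HasDerivAt (fun t => A * t + B * (d + 3) * (t * (L - t)))
      (A + B * (d + 3) * (L - 2 * t)) t := fun t => by
    have := ((hasDerivAt_id t).const_mul A).fun_add (((hasDerivAt_id t).fun_mul
      ((hasDerivAt_id t).const_sub L)).const_mul (B * (d + 3)))
    exact this.congr_deriv (by simp only [id_eq]; ring)
  have h2 : ∀ t : ℝ, HasDerivAt (fun t => A + B * ((d : ℝ) + 3) * (L - 2 * t))
      (-2 * (B * (d + 3))) t := fun t => by
    have := ((((hasDerivAt_id t).const_mul 2).const_sub L).const_mul (B * ((d : ℝ) + 3))).const_add A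
    exact this.congr_deriv (by ring)
  have h3 : ∀ t : ℝ, HasDerivAt (fun t => B * t) B t := fun t =>
    ((hasDerivAt_id t).const_mul B).congr_deriv (by ring)
  have h4 : ∀ t : ℝ, HasDerivAt (fun _ : ℝ => B) 0 t := fun t => hasDerivAt_const t B
  unfold barrier
  rw [lapE_add (contDiff_barrier_coord A B L).contDiffAt (contDiff_barrier_norm B).contDiffAt,
    lapE_comp_coord_zero h1 h2, lapE_comp_norm_sq h3 h4]
  ring

lemma le_barrier {w : EuclideanSpace ℝ (Fin (d + 2)) → ℝ}
    (hcont : ContinuousOn w (closedHalfSpace d))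
    (hC2 : ContDiffOn ℝ 2 w (HalfSpace d)) (hharm : ∀ z ∈ HalfSpace d, lapE w z = 0)
    (hbd : ∀ z : EuclideanSpace ℝ (Fin (d + 2)), z 0 = 0 → w z ≤ 0)
    {M : ℝ} (hM : 0 < M) (hwM : ∀ z ∈ HalfSpace d, w z ≤ M) {L R : ℝ} (hL : 0 < L) (hR : 0 < R)
    {z : EuclideanSpace ℝ (Fin (d + 2))} (hz0 : 0 ≤ z 0) (hzL : z 0 ≤ L) (hzR : ‖z‖ ≤ R) :
    w z ≤ barrier (M / L) (M / R ^ 2) L z := by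
  have hc : Continuous fun z : EuclideanSpace ℝ (Fin (d + 2)) => z 0 := by fun_prop
  set K : Set (EuclideanSpace ℝ (Fin (d + 2))) :=
    {z | z 0 ≤ L} ∩ halfBall 0 R with hKdef
  have hK : IsCompact K :=
    (isCompact_halfBall 0 R).inter_left (isClosed_le hc continuous_const)
  set b := barrier (d := d) (M / L) (M / R ^ 2) L with hb
  have hzK : z ∈ K := ⟨hzL, by simpa using hzR, hz0⟩
  have hu : ContinuousOn (fun z => w z - b z) K :=
    (hcont.mono fun z hz => hz.2.2).sub (contDiff_barrier _ _ _).continuous.continuousOn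
  obtain ⟨y, hyK, hy⟩ := hK.exists_isMaxOn ⟨z, hzK⟩ hu
  have hyz : w z - b z ≤ w y - b y := hy hzK
  suffices w y - b y ≤ 0 by linarith
  by_contra! hpos
  have hyL : y 0 ≤ L := hyK.1
  have hy0 : 0 ≤ y 0 := hyK.2.2
  have hyR : ‖y‖ ≤ R := by simpa using hyK.2.1
  have hB : 0 < M / R ^ 2 := by positivity
  have hA : 0 < M / L := by positivity
  have hby : b y = (M / L * y 0 + M / R ^ 2 * (d + 3) * (y 0 * (L - y 0))) +
      M / R ^ 2 * ‖y‖ ^ 2 := by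
    simp [hb, barrier]
  have t1 : 0 ≤ M / L * y 0 := by positivity
  have t2 : 0 ≤ M / R ^ 2 * (d + 3) * (y 0 * (L - y 0)) :=
    mul_nonneg (by positivity) (mul_nonneg hy0 (by linarith))
  have t3 : 0 ≤ M / R ^ 2 * ‖y‖ ^ 2 := by positivity
  have hy0' : 0 < y 0 := by
    rcases hy0.eq_or_lt with h | h
    · linarith [hbd y h.symm]
    · exact h
  have hwy := hwM y hy0'
  have hyL' : y 0 < L := by
    refine lt_of_le_of_ne hyL fun h => ?_
    rw [h, div_mul_cancel₀ _ hL.ne'] at t1 hby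
    rw [h] at t2
    linarith
  have hyR' : ‖y‖ < R := by
    refine lt_of_le_of_ne hyR fun h => ?_
    have hR2 : R ^ 2 ≠ 0 := by positivity
    rw [h, div_mul_cancel₀ _ hR2] at hby
    linarith
  have hnhds : K ∈ nhds y := by
    have : {z : EuclideanSpace ℝ (Fin (d + 2)) | z 0 < L ∧ 0 < z 0 ∧ ‖z‖ < R} ∈ nhds y :=
      ((isOpen_lt hc continuous_const).inter ((isOpen_lt continuous_const hc).inter
        (isOpen_lt continuous_norm continuous_const))).mem_nhds ⟨hyL', hy0', hyR'⟩
    filter_upwards [this] with x hx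
    exact ⟨hx.1.le, by simpa using hx.2.2.le, hx.2.1.le⟩
  have hw2 : ContDiffAt ℝ 2 w y := hC2.contDiffAt (isOpen_halfSpace.mem_nhds hy0')
  have hb2 : ContDiffAt ℝ 2 b y := (contDiff_barrier _ _ _).contDiffAt
  have hlap := lapE_nonpos_of_isLocalMax (hw2.sub hb2) (hy.isLocalMax hnhds)
  have h2 := lapE_sub hw2 hb2
  rw [hharm y hy0', hb, lapE_barrier] at h2
  rw [hb, h2] at hlap
  linarith

/-- **Phragmén–Lindelöf principle** in the half-space. -/
lemma nonpos_of_bounded_above {w : EuclideanSpace ℝ (Fin (d + 2)) → ℝ}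
    (hcont : ContinuousOn w (closedHalfSpace d))
    (hC2 : ContDiffOn ℝ 2 w (HalfSpace d)) (hharm : ∀ z ∈ HalfSpace d, lapE w z = 0)
    (hbd : ∀ z : EuclideanSpace ℝ (Fin (d + 2)), z 0 = 0 → w z ≤ 0)
    {M : ℝ} (hM : 0 < M) (hwM : ∀ z ∈ HalfSpace d, w z ≤ M)
    {z : EuclideanSpace ℝ (Fin (d + 2))} (hz0 : 0 ≤ z 0) : w z ≤ 0 := by
  set Q : ℝ := M * (z 0 + (d + 3) * z 0 + ‖z‖ ^ 2) with hQ
  have hlim : Tendsto (fun L : ℝ => Q / L) atTop (nhds 0) :=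
    tendsto_const_nhds.div_atTop tendsto_id
  refine ge_of_tendsto hlim ?_
  filter_upwards [eventually_ge_atTop 1, eventually_ge_atTop (z 0), eventually_ge_atTop ‖z‖]
    with L h1 h2 h3
  have hL : 0 < L := by linarith
  have hzR : ‖z‖ ≤ L ^ 2 := by nlinarith
  have h := le_barrier hcont hC2 hharm hbd hM hwM hL (show 0 < L ^ 2 by positivity) hz0 h2 hzR
  refine h.trans ?_
  have e1 : M / (L ^ 2) ^ 2 * L ≤ M / L := by
    rw [div_mul_eq_mul_div, div_le_div_iff₀ (by positivity) hL]
    have : L * L ≤ (L ^ 2) ^ 2 := by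
      nlinarith [pow_le_pow_right₀ h1 (show 2 ≤ 4 by norm_num)]
    nlinarith
  have e2 : M / (L ^ 2) ^ 2 ≤ M / L := by
    refine le_trans ?_ e1
    exact le_mul_of_one_le_right (by positivity) h1
  have e3 : M / (L ^ 2) ^ 2 * (d + 3) * (z 0 * (L - z 0)) ≤ M / L * ((d + 3) * z 0) := by
    calc M / (L ^ 2) ^ 2 * (d + 3) * (z 0 * (L - z 0))
        ≤ M / (L ^ 2) ^ 2 * (d + 3) * (z 0 * L) := by
          gcongr
          linarith
      _ = M / (L ^ 2) ^ 2 * L * ((d + 3) * z 0) := by ring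
      _ ≤ _ := by gcongr
  have e4 : M / (L ^ 2) ^ 2 * ‖z‖ ^ 2 ≤ M / L * ‖z‖ ^ 2 := by gcongr
  have e5 : Q / L = M / L * z 0 + M / L * ((d + 3) * z 0) + M / L * ‖z‖ ^ 2 := by
    rw [hQ]
    ring
  rw [e5]
  simp only [barrier, one_pow, one_mul, sub_zero]
  linarith

end PhragmenLindelof

section Rigidity

variable {d : ℕ}

/-- A nonnegative harmonic function on the half-space with zero boundary values does not increase
under tangential translations. -/
lemma add_tangential_le {v : EuclideanSpace ℝ (Fin (d + 2)) → ℝ}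
    (hcont : ContinuousOn v (closedHalfSpace d))
    (hC2 : ContDiffOn ℝ 2 v (HalfSpace d)) (hharm : ∀ z ∈ HalfSpace d, lapE v z = 0)
    (hnonneg : ∀ z ∈ closedHalfSpace d, 0 ≤ v z)
    (hbd : ∀ z : EuclideanSpace ℝ (Fin (d + 2)), z 0 = 0 → v z = 0)
    {h z : EuclideanSpace ℝ (Fin (d + 2))} (hh : h 0 = 0) (hz : 0 ≤ z 0) : v (z + h) ≤ v z := by
  obtain ⟨C, hC0, hC⟩ := exists_le_mul_coord hcont hC2 hharm hnonneg hbd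
  obtain ⟨M, hM, hv⟩ := exists_abs_sub_le hC2 hharm hnonneg hC0 hC hh
  have h0 : ∀ y : EuclideanSpace ℝ (Fin (d + 2)), (y + h) 0 = y 0 := fun y => by simp [hh]
  have hshift : ContDiff ℝ 2 fun y : EuclideanSpace ℝ (Fin (d + 2)) => y + h :=
    contDiff_id.add contDiff_const
  have hmaps : MapsTo (fun y : EuclideanSpace ℝ (Fin (d + 2)) => y + h) (HalfSpace d)
      (HalfSpace d) := fun y hy => show 0 < (y + h) 0 from (h0 y).symm ▸ hy
  have hmaps' : MapsTo (fun y : EuclideanSpace ℝ (Fin (d + 2)) => y + h) (closedHalfSpace d)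
      (closedHalfSpace d) := fun y hy => show 0 ≤ (y + h) 0 from (h0 y).symm ▸ hy
  have hvh : ContDiffOn ℝ 2 (fun y => v (y + h)) (HalfSpace d) :=
    hC2.comp hshift.contDiffOn hmaps
  have := nonpos_of_bounded_above (w := fun y => v (y + h) - v y)
    ((hcont.comp hshift.continuous.continuousOn hmaps').sub hcont) (hvh.sub hC2)
    (fun y hy => by
      have hn := isOpen_halfSpace.mem_nhds hy
      rw [lapE_sub (hvh.contDiffAt hn) (hC2.contDiffAt hn), lapE_comp_add_right, hharm y hy,
        hharm _ (hmaps hy), sub_zero])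
    (fun y hy => by rw [hbd y hy, hbd _ ((h0 y).trans hy), sub_zero]) hM hv hz
  linarith

lemma add_tangential_eq {v : EuclideanSpace ℝ (Fin (d + 2)) → ℝ}
    (hcont : ContinuousOn v (closedHalfSpace d))
    (hC2 : ContDiffOn ℝ 2 v (HalfSpace d)) (hharm : ∀ z ∈ HalfSpace d, lapE v z = 0)
    (hnonneg : ∀ z ∈ closedHalfSpace d, 0 ≤ v z)
    (hbd : ∀ z : EuclideanSpace ℝ (Fin (d + 2)), z 0 = 0 → v z = 0)
    {h z : EuclideanSpace ℝ (Fin (d + 2))} (hh : h 0 = 0) (hz : 0 ≤ z 0) : v (z + h) = v z := by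
  refine le_antisymm (add_tangential_le hcont hC2 hharm hnonneg hbd hh hz) ?_
  simpa using add_tangential_le hcont hC2 hharm hnonneg hbd (h := -h) (z := z + h)
    (by simp [hh]) (by simpa [hh] using hz)

/-- A harmonic function on the half-space, invariant under tangential translations, is affine
along the normal direction. -/
lemma exists_affine_of_tangential_invariant {v : EuclideanSpace ℝ (Fin (d + 2)) → ℝ}
    (hC2 : ContDiffOn ℝ 2 v (HalfSpace d)) (hharm : ∀ z ∈ HalfSpace d, lapE v z = 0)
    (hinv : ∀ h z : EuclideanSpace ℝ (Fin (d + 2)), h 0 = 0 → z ∈ HalfSpace d → v (z + h) = v z) :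
    ∃ a b : ℝ, ∀ t, 0 < t → v (t • basisVec 0) = a * t + b := by
  have hvat : ∀ z ∈ HalfSpace d, ContDiffAt ℝ 2 v z := fun z hz =>
    hC2.contDiffAt (isOpen_halfSpace.mem_nhds hz)
  have htan : ∀ z ∈ HalfSpace d, ∀ i : Fin (d + 2), i ≠ 0 → fderiv ℝ v z (basisVec i) = 0 := by
    intro z hz i hi
    have h1 : HasDerivAt (fun t : ℝ => v (z + t • basisVec i)) (fderiv ℝ v z (basisVec i)) 0 :=
      ((hvat z hz).differentiableAt (by simp)).hasFDerivAt.hasLineDerivAt (basisVec i)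
    have h2 : (fun t : ℝ => v (z + t • basisVec i)) = fun _ => v z :=
      funext fun t => hinv _ z (by simp [hi.symm]) hz
    rw [h2] at h1
    exact h1.unique (hasDerivAt_const _ _)
  have hnorm : ∀ z ∈ HalfSpace d,
      fderiv ℝ (fun y => fderiv ℝ v y (basisVec 0)) z (basisVec 0) = 0 := by
    intro z hz
    rw [← hharm z hz]
    unfold lapE
    rw [Finset.sum_eq_single 0]
    · intro i _ hi
      have : (fun y => fderiv ℝ v y (basisVec i)) =ᶠ[nhds z] fun _ => 0 := by
        filter_upwards [isOpen_halfSpace.mem_nhds hz] with y hy using htan y hy i hi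
      rw [this.fderiv_eq]
      simp
    · simp
  have hmem : ∀ t : ℝ, 0 < t → (t • basisVec 0 : EuclideanSpace ℝ (Fin (d + 2))) ∈ HalfSpace d :=
    fun t ht => show 0 < (t • basisVec 0 : EuclideanSpace ℝ (Fin (d + 2))) 0 by simpa using ht
  have hline : ∀ t : ℝ, HasDerivAt
      (fun t : ℝ => (t • basisVec 0 : EuclideanSpace ℝ (Fin (d + 2)))) (basisVec 0) t :=
    fun t => by simpa using (hasDerivAt_id t).smul_const (basisVec (d := d) 0)
  have hf : ∀ t : ℝ, 0 < t → HasDerivAt (fun t : ℝ => v (t • basisVec 0))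
      (fderiv ℝ v (t • basisVec 0) (basisVec 0)) t := fun t ht =>
    ((hvat _ (hmem t ht)).differentiableAt (by simp)).hasFDerivAt.comp_hasDerivAt t (hline t)
  have hg : ∀ t : ℝ, 0 < t → HasDerivAt
      (fun t : ℝ => fderiv ℝ v (t • basisVec 0) (basisVec 0)) 0 t := fun t ht => by
    have := (((hvat _ (hmem t ht)).fderiv_apply_one (basisVec 0)).differentiableAt
      (by simp)).hasFDerivAt.comp_hasDerivAt t (hline t)
    rwa [hnorm _ (hmem t ht)] at this
  set a : ℝ := fderiv ℝ v ((1 : ℝ) • basisVec 0) (basisVec 0) with ha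
  have hga : ∀ t : ℝ, 0 < t → fderiv ℝ v (t • basisVec 0) (basisVec 0) = a := fun t ht =>
    isOpen_Ioi.is_const_of_deriv_eq_zero isPreconnected_Ioi
      (fun x hx => (hg x hx).differentiableAt.differentiableWithinAt) (fun x hx => (hg x hx).deriv)
      ht (mem_Ioi.2 one_pos)
  have hfa : ∀ t : ℝ, 0 < t → HasDerivAt (fun t : ℝ => v (t • basisVec 0) - a * t) 0 t :=
    fun t ht => ((hf t ht).fun_sub ((hasDerivAt_id t).const_mul a)).congr_deriv (by
      rw [hga t ht]; ring)
  refine ⟨a, v ((1 : ℝ) • basisVec 0) - a * 1, fun t ht => ?_⟩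
  have : v (t • basisVec 0) - a * t = v ((1 : ℝ) • basisVec 0) - a * 1 :=
    isOpen_Ioi.is_const_of_deriv_eq_zero isPreconnected_Ioi
      (fun x hx => (hfa x hx).differentiableAt.differentiableWithinAt)
      (fun x hx => (hfa x hx).deriv) ht (mem_Ioi.2 one_pos)
  linarith

end Rigidity

/-- A function continuous on the closed half-space, harmonic and positive
on the open half-space and vanishing on the hyperplane `{z₁ = 0}` is `c z₁` for some
`c > 0`. -/
theorem statement5 {d : ℕ} (v : EuclideanSpace ℝ (Fin (d+2)) → ℝ)
    (hcont : ContinuousOn v {z : EuclideanSpace ℝ (Fin (d+2)) | 0 ≤ z 0})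
    (hC2 : ContDiffOn ℝ 2 v (HalfSpace d))
    (hharm : ∀ z ∈ HalfSpace d, lapE v z = 0)
    (hpos : ∀ z ∈ HalfSpace d, 0 < v z)
    (hbd : ∀ z : EuclideanSpace ℝ (Fin (d+2)), z 0 = 0 → v z = 0) :
    ∃ c : ℝ, 0 < c ∧ ∀ z : EuclideanSpace ℝ (Fin (d+2)), 0 ≤ z 0 → v z = c * z 0 := by
  have hnonneg : ∀ z ∈ closedHalfSpace d, 0 ≤ v z := fun z hz => by
    rcases (show 0 ≤ z 0 from hz).eq_or_lt with h | h
    · exact (hbd z h.symm).ge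
    · exact (hpos z h).le
  have hinv : ∀ h z : EuclideanSpace ℝ (Fin (d + 2)), h 0 = 0 → 0 ≤ z 0 → v (z + h) = v z :=
    fun h z hh hz => add_tangential_eq hcont hC2 hharm hnonneg hbd hh hz
  obtain ⟨a, b, hab⟩ := exists_affine_of_tangential_invariant hC2 hharm
    fun h z hh hz => hinv h z hh (le_of_lt hz)
  have hline : Continuous fun t : ℝ => (t • basisVec 0 : EuclideanSpace ℝ (Fin (d + 2))) := by
    fun_prop
  have hb : b = 0 := by
    have h1 : ContinuousOn (fun t : ℝ => v (t • basisVec 0)) (Ici 0) :=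
      hcont.comp hline.continuousOn fun t ht => by simpa using ht
    have h2 : Tendsto (fun t : ℝ => v (t • basisVec 0)) (nhdsWithin 0 (Ioi 0)) (nhds 0) := by
      have := (h1 0 self_mem_Ici).tendsto.mono_left (nhdsWithin_mono 0 Ioi_subset_Ici_self)
      rwa [hbd ((0 : ℝ) • basisVec 0) (by simp)] at this
    have h3 : Tendsto (fun t : ℝ => a * t + b) (nhdsWithin 0 (Ioi 0)) (nhds (a * 0 + b)) := by
      have : Continuous fun t : ℝ => a * t + b := by fun_prop
      exact this.continuousAt.tendsto.mono_left nhdsWithin_le_nhds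
    have h4 := tendsto_nhds_unique (h2.congr' (by
      filter_upwards [self_mem_nhdsWithin] with t ht using hab t ht)) h3
    linarith
  refine ⟨a, ?_, fun z hz => ?_⟩
  · have h1 := hab 1 one_pos
    have h2 := hpos ((1 : ℝ) • basisVec 0) (show 0 < ((1 : ℝ) • basisVec 0 :
      EuclideanSpace ℝ (Fin (d + 2))) 0 by simp)
    rw [h1, hb] at h2
    linarith
  · rcases hz.eq_or_lt with h | h
    · rw [hbd z h.symm, ← h, mul_zero]
    · have h1 := hinv (z 0 • basisVec 0 - z) z (by simp) hz
      rw [add_sub_cancel, hab _ h, hb, add_zero] at h1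
      exact h1.symm
end
end

section
/- Let w be harmonic on the full cylinder ℝ × U, continuous on its closure, vanishing on ℝ × ∂U, not identically zero, and such that ∫_{(−∞,x̄)×U} |∇w|² < +∞ for every x̄ ∈ ℝ. Then the frequency Ñ(w)(x) := (∫_{(−∞,x)×U} |∇w|²)/(∫_U w(x,y)² dy) is constant in x if and only if there exist a Dirichlet eigenvalue λ_k of −Δ on U and a corresponding eigenfunction ψ_k such that w(x,y) = e^{√λ_k x} ψ_k(y) for all (x,y) ∈ ℝ × U. -/
open MeasureTheory Filter Set

noncomputable section

/-- Second directional derivative of `u` at `z` in the direction `w`. -/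
def dd2 {d : ℕ} (u : ℝ × (Fin (d+1) → ℝ) → ℝ) (w z : ℝ × (Fin (d+1) → ℝ)) : ℝ :=
  fderiv ℝ (fun z' => fderiv ℝ u z' w) z w

/-- The Laplacian on `ℝ × ℝ^{N-1}`: sum of the pure second partial derivatives. -/
def lap {d : ℕ} (u : ℝ × (Fin (d+1) → ℝ) → ℝ) (z : ℝ × (Fin (d+1) → ℝ)) : ℝ :=
  dd2 u (1, 0) z + ∑ i : Fin (d+1), dd2 u (0, Pi.single i 1) z

/-- `|∇u|²`, the squared norm of the gradient. -/
def gradSq {d : ℕ} (u : ℝ × (Fin (d+1) → ℝ) → ℝ) (z : ℝ × (Fin (d+1) → ℝ)) : ℝ :=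
  (fderiv ℝ u z (1, 0))^2 + ∑ i : Fin (d+1), (fderiv ℝ u z (0, Pi.single i 1))^2

/-- The Laplacian on `ℝ^{N-1}`. -/
def lapU {d : ℕ} (ψ : (Fin (d+1) → ℝ) → ℝ) (y : Fin (d+1) → ℝ) : ℝ :=
  ∑ i : Fin (d+1), fderiv ℝ (fun y' => fderiv ℝ ψ y' (Pi.single i 1)) y (Pi.single i 1)

/-- `U` has smooth boundary: it is the sublevel set of a smooth function with
nonvanishing differential on the boundary. -/
def HasSmoothBoundary {d : ℕ} (U : Set (Fin (d+1) → ℝ)) : Prop :=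
  ∃ f : (Fin (d+1) → ℝ) → ℝ, ContDiff ℝ (⊤ : ℕ∞) f ∧ U = {y | f y < 0} ∧
    ∀ y ∈ frontier U, fderiv ℝ f y ≠ 0

/-- The set of Dirichlet eigenfunctions of `-Δ` on `U` for the value `lam`
(including the zero function). -/
def eigSet {d : ℕ} (U : Set (Fin (d+1) → ℝ)) (lam : ℝ) : Set ((Fin (d+1) → ℝ) → ℝ) :=
  {ψ | ContinuousOn ψ (closure U) ∧ ContDiffOn ℝ 2 ψ U ∧
    (∀ y ∈ U, lapU ψ y = -(lam * ψ y)) ∧ (∀ y ∈ frontier U, ψ y = 0)}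

/-- `lam` is a Dirichlet eigenvalue of `-Δ` on `U`. -/
def IsDirichletEigenvalue {d : ℕ} (U : Set (Fin (d+1) → ℝ)) (lam : ℝ) : Prop :=
  ∃ ψ ∈ eigSet U lam, ∃ y ∈ U, ψ y ≠ 0

/-- The half-cylinder `C = {(x,y) : x > 0, y ∈ U}`. -/
def CylSet {d : ℕ} (U : Set (Fin (d+1) → ℝ)) : Set (ℝ × (Fin (d+1) → ℝ)) :=
  {z | 0 < z.1 ∧ z.2 ∈ U}

/-- A positive solution on the half-cylinder `C`: continuous on the closure of `C`, twice
continuously differentiable and harmonic in `C`, positive in `C` and vanishing on `∂C`. -/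
def IsPosSolCyl {d : ℕ} (U : Set (Fin (d+1) → ℝ)) (v : ℝ × (Fin (d+1) → ℝ) → ℝ) : Prop :=
  ContinuousOn v (closure (CylSet U)) ∧
  ContDiffOn ℝ 2 v (CylSet U) ∧
  (∀ z ∈ CylSet U, lap v z = 0) ∧
  (∀ z ∈ CylSet U, 0 < v z) ∧
  (∀ z ∈ frontier (CylSet U), v z = 0)

/-- The full cylinder `ℝ × U`. -/
def FullCyl {d : ℕ} (U : Set (Fin (d+1) → ℝ)) : Set (ℝ × (Fin (d+1) → ℝ)) :=
  {z | z.2 ∈ U}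

/-- The frequency function on the full cylinder:
`Ñ(w)(x) = (∫_{(-∞,x)×U} |∇w|²) / (∫_U w(x,y)² dy)`. -/
def freqFull {d : ℕ} (U : Set (Fin (d+1) → ℝ)) (w : ℝ × (Fin (d+1) → ℝ) → ℝ) (x : ℝ) : ℝ :=
  (∫ z in Iio x ×ˢ U, gradSq w z) / (∫ y in U, (w (x, y))^2)

lemma integral_fderiv_apply_eq_zero {V : Type*} [NormedAddCommGroup V] [NormedSpace ℝ V]
    [FiniteDimensional ℝ V] [MeasurableSpace V] [BorelSpace V] (μ : Measure V)
    [μ.IsAddHaarMeasure] {F : V → ℝ} (hF : ContDiff ℝ 1 F) (hc : HasCompactSupport F) (e : V) :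
    ∫ z, fderiv ℝ F z e ∂μ = 0 := by
  have hcont : Continuous fun z => fderiv ℝ F z e :=
    (hF.continuous_fderiv one_ne_zero).clm_apply continuous_const
  have hcs : HasCompactSupport fun z => fderiv ℝ F z e := hc.fderiv_apply (𝕜 := ℝ) e
  have h := integral_mul_fderiv_eq_neg_fderiv_mul_of_integrable (𝕜 := ℝ) (μ := μ)
    (f := fun _ : V => (1 : ℝ)) (g := F) (v := e) (by simp)
    (by simpa using hcont.integrable_of_hasCompactSupport hcs)
    (by simpa using hF.continuous.integrable_of_hasCompactSupport hc)
    (fun _ _ => by fun_prop) (fun x _ => hF.differentiable one_ne_zero x)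
  simpa using h

lemma ae_fderiv_eq_zero_of_eq_zero {V : Type*} [NormedAddCommGroup V] [NormedSpace ℝ V]
    [FiniteDimensional ℝ V] [MeasurableSpace V] [BorelSpace V] (μ : Measure V)
    [μ.IsAddHaarMeasure] {Ω : Set V} (hΩ : IsOpen Ω) {u : V → ℝ} (hu : DifferentiableOn ℝ u Ω)
    (hc : Continuous u) : ∀ᵐ z ∂μ.restrict Ω, u z = 0 → fderiv ℝ u z = 0 := by
  have hZ : MeasurableSet {z | u z = 0} := (isClosed_eq hc continuous_const).measurableSet
  suffices h : ∀ᵐ z ∂μ.restrict ({z | u z = 0} ∩ Ω), fderiv ℝ u z = 0 by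
    rw [← Measure.restrict_restrict hZ, ae_restrict_iff' hZ] at h
    exact h
  rcases subsingleton_or_nontrivial V with hV | hV
  · exact Eventually.of_forall fun z => by ext x; simp [Subsingleton.elim x 0]
  obtain ⟨v, hv⟩ := exists_ne (0 : V)
  have hd : ∀ x ∈ {z | u z = 0} ∩ Ω, HasFDerivWithinAt (fun z => u z • v)
      ((fderiv ℝ u x).smulRight v) ({z | u z = 0} ∩ Ω) x := fun x hx =>
    (((hu x hx.2).differentiableAt (hΩ.mem_nhds hx.2)).hasFDerivAt.smul_const v).hasFDerivWithinAt
  have ha : ApproximatesLinearOn (fun z => u z • v) (0 : V →L[ℝ] V) ({z | u z = 0} ∩ Ω) 0 := by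
    intro x hx y hy
    have h1 : u x = 0 := hx.1
    have h2 : u y = 0 := hy.1
    simp [h1, h2]
  filter_upwards [ha.norm_fderiv_sub_le μ (hZ.inter hΩ.measurableSet) _ hd] with z hz
  simpa [hv] using hz

/-- A smooth function that vanishes near the origin and is the identity away from it. -/
lemma exists_truncation : ∃ η : ℝ → ℝ, ContDiff ℝ 1 η ∧ (∀ r, |r| ≤ 1 → η r = 0) ∧
    (∀ r, |η r| ≤ |r|) ∧ (∀ r, 2 ≤ |r| → η r = r) ∧ (∀ r, 2 < |r| → deriv η r = 1) ∧
    ∃ C, ∀ r, |deriv η r| ≤ C := by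
  have hcd : ContDiff ℝ 1 fun r : ℝ => r * Real.smoothTransition (r ^ 2 - 1) :=
    contDiff_id.mul (Real.smoothTransition.contDiff.comp ((contDiff_id.pow 2).sub contDiff_const))
  have hid : ∀ r : ℝ, 2 ≤ |r| → r * Real.smoothTransition (r ^ 2 - 1) = r := fun r hr => by
    rw [Real.smoothTransition.one_of_one_le (by nlinarith [sq_abs r]), mul_one]
  have hd1 : ∀ r : ℝ, 2 < |r| →
      deriv (fun r : ℝ => r * Real.smoothTransition (r ^ 2 - 1)) r = 1 := fun r hr => by
    have : (fun r : ℝ => r * Real.smoothTransition (r ^ 2 - 1)) =ᶠ[nhds r] id := by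
      filter_upwards [(isOpen_lt continuous_const continuous_abs).mem_nhds hr] with s hs
      exact hid s (le_of_lt hs)
    rw [this.deriv_eq, deriv_id]
  refine ⟨_, hcd, fun r hr => ?_, fun r => ?_, hid, hd1, ?_⟩
  · rw [Real.smoothTransition.zero_of_nonpos (by nlinarith [sq_abs r, abs_nonneg r]), mul_zero]
  · rw [abs_mul, abs_of_nonneg (Real.smoothTransition.nonneg _)]
    exact mul_le_of_le_one_right (abs_nonneg r) (Real.smoothTransition.le_one _)
  · obtain ⟨C, hC⟩ := (isCompact_Icc (a := (-2 : ℝ)) (b := 2)).exists_bound_of_continuousOn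
      (hcd.continuous_deriv le_rfl).continuousOn
    refine ⟨max C 1, fun r => ?_⟩
    rcases le_or_gt |r| 2 with h | h
    · exact (hC r (abs_le.1 h)).trans (le_max_left _ _)
    · rw [hd1 r h, abs_one]; exact le_max_right _ _

/-- The pointwise inner product of the gradients of `u` and `v`. -/
def gradDot {d : ℕ} (u v : ℝ × (Fin (d+1) → ℝ) → ℝ) (z : ℝ × (Fin (d+1) → ℝ)) : ℝ :=
  fderiv ℝ u z (1, 0) * fderiv ℝ v z (1, 0) +
    ∑ i : Fin (d+1), fderiv ℝ u z (0, Pi.single i 1) * fderiv ℝ v z (0, Pi.single i 1)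

/-- A function on the cylinder extended by zero, harmonic inside, with finite energy on left
half-cylinders and constant frequency `c`. -/
structure ConstFreq {d : ℕ} (U : Set (Fin (d+1) → ℝ)) (c : ℝ)
    (u : ℝ × (Fin (d+1) → ℝ) → ℝ) : Prop where
  cont : Continuous u
  zero : ∀ z : ℝ × (Fin (d+1) → ℝ), z.2 ∉ U → u z = 0
  c2 : ContDiffOn ℝ 2 u (FullCyl U)
  harm : ∀ z ∈ FullCyl U, lap u z = 0
  energy : ∀ x : ℝ, IntegrableOn (gradSq u) (Iio x ×ˢ U)
  freq : ∀ x : ℝ, ∫ z in Iio x ×ˢ U, gradSq u z = c * ∫ y in U, (u (x, y)) ^ 2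

section
variable {d : ℕ} {U : Set (Fin (d+1) → ℝ)} {c : ℝ} {u v : ℝ × (Fin (d+1) → ℝ) → ℝ}

instance isAddHaarMeasure_volume_prod :
    (volume : Measure (ℝ × (Fin (d+1) → ℝ))).IsAddHaarMeasure := by
  rw [Measure.volume_eq_prod]; infer_instance

lemma isOpen_fullCyl (hU : IsOpen U) : IsOpen (FullCyl U) := hU.preimage continuous_snd

lemma fullCyl_eq_univ_prod : FullCyl U = univ ×ˢ U := by
  ext z; simp [FullCyl]

lemma gradSq_eq_gradDot (z : ℝ × (Fin (d+1) → ℝ)) : gradSq u z = gradDot u u z := by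
  simp [gradSq, gradDot, sq]

lemma gradDot_comm (z : ℝ × (Fin (d+1) → ℝ)) : gradDot u v z = gradDot v u z := by
  simp [gradDot, mul_comm]

lemma gradSq_nonneg (z : ℝ × (Fin (d+1) → ℝ)) : 0 ≤ gradSq u z := by
  unfold gradSq; positivity

lemma sq_fderiv_le_gradSq (z : ℝ × (Fin (d+1) → ℝ)) :
    (fderiv ℝ u z (1, 0)) ^ 2 ≤ gradSq u z :=
  le_add_of_nonneg_right (by positivity)

lemma abs_mul_le_half_sq_add_sq (a b : ℝ) : |a * b| ≤ (a ^ 2 + b ^ 2) / 2 := by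
  rw [abs_le]; constructor <;> nlinarith [sq_nonneg (a + b), sq_nonneg (a - b)]

lemma abs_gradDot_le (z : ℝ × (Fin (d+1) → ℝ)) :
    |gradDot u v z| ≤ (gradSq u z + gradSq v z) / 2 := by
  have h : (gradSq u z + gradSq v z) / 2 =
      ((fderiv ℝ u z (1, 0)) ^ 2 + (fderiv ℝ v z (1, 0)) ^ 2) / 2 +
      ∑ i : Fin (d+1), ((fderiv ℝ u z (0, Pi.single i 1)) ^ 2 +
        (fderiv ℝ v z (0, Pi.single i 1)) ^ 2) / 2 := by
    simp only [gradSq, ← Finset.sum_div, Finset.sum_add_distrib]; ring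
  rw [h]
  refine (abs_add_le _ _).trans (add_le_add (abs_mul_le_half_sq_add_sq _ _) ?_)
  exact (Finset.abs_sum_le_sum_abs _ _).trans
    (Finset.sum_le_sum fun i _ => abs_mul_le_half_sq_add_sq _ _)

lemma ConstFreq.continuousOn_fderiv (hu : ConstFreq U c u) (hU : IsOpen U)
    (e : ℝ × (Fin (d+1) → ℝ)) : ContinuousOn (fun z => fderiv ℝ u z e) (FullCyl U) :=
  (hu.c2.continuousOn_fderiv_of_isOpen (isOpen_fullCyl hU) one_le_two).clm_apply
    continuousOn_const

lemma ConstFreq.continuousOn_gradDot (hu : ConstFreq U c u) (hv : ConstFreq U c v)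
    (hU : IsOpen U) : ContinuousOn (gradDot u v) (FullCyl U) :=
  ((hu.continuousOn_fderiv hU _).mul (hv.continuousOn_fderiv hU _)).add
    (continuousOn_finsetSum _ fun _ _ =>
      (hu.continuousOn_fderiv hU _).mul (hv.continuousOn_fderiv hU _))

lemma prod_subset_fullCyl (S : Set ℝ) : S ×ˢ U ⊆ FullCyl U := fun _ hz => hz.2

lemma ConstFreq.integrableOn_gradDot (hu : ConstFreq U c u) (hv : ConstFreq U c v)
    (hU : IsOpen U) (x : ℝ) : IntegrableOn (gradDot u v) (Iio x ×ˢ U) := by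
  refine Integrable.mono' (((hu.energy x).add (hv.energy x)).div_const 2)
    (((hu.continuousOn_gradDot hv hU).mono (prod_subset_fullCyl _)).aestronglyMeasurable
      (measurableSet_Iio.prod hU.measurableSet)) (Eventually.of_forall fun z => ?_)
  exact abs_gradDot_le z

lemma integrableOn_of_continuous (hUb : Bornology.IsBounded U) {g : ℝ × (Fin (d+1) → ℝ) → ℝ}
    (hg : Continuous g) (a b : ℝ) : IntegrableOn g (Ioo a b ×ˢ U) :=
  (hg.continuousOn.integrableOn_compact
    (isCompact_Icc.prod hUb.isCompact_closure)).mono_set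
    (prod_mono Ioo_subset_Icc_self subset_closure)

lemma ConstFreq.integrableOn_mul_fderiv (hu : ConstFreq U c u)
    (hU : IsOpen U) (hUb : Bornology.IsBounded U) (hv : Continuous v) (a b : ℝ) :
    IntegrableOn (fun z => v z * fderiv ℝ u z (1, 0)) (Ioo a b ×ˢ U) := by
  refine Integrable.mono' (((integrableOn_of_continuous hUb (hv.pow 2) a b).add
    ((hu.energy b).mono_set (prod_mono Ioo_subset_Iio_self subset_rfl))).div_const 2)
    ((hv.continuousOn.mul ((hu.continuousOn_fderiv hU _).mono
      (prod_subset_fullCyl _))).aestronglyMeasurable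
      (measurableSet_Ioo.prod hU.measurableSet)) (Eventually.of_forall fun z => ?_)
  refine (abs_mul_le_half_sq_add_sq _ _).trans ?_
  have := sq_fderiv_le_gradSq (u := u) z
  simp only [Pi.add_apply, Pi.pow_apply]
  linarith

lemma integrable_fst_mul (hU : IsOpen U) {S : Set ℝ}
    {G : ℝ × (Fin (d+1) → ℝ) → ℝ} (hG : IntegrableOn G (S ×ˢ U)) {f : ℝ → ℝ}
    (hf : Continuous f) {C : ℝ} (hC : ∀ x, |f x| ≤ C) (h0 : ∀ x, x ∉ S → f x = 0) :
    Integrable (fun z => f z.1 * G z) (volume.restrict (FullCyl U)) := by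
  have h1 : IntegrableOn (fun z => f z.1 * G z) (S ×ˢ U) :=
    hG.bdd_mul (c := C) (hf.comp continuous_fst).aestronglyMeasurable
      (Eventually.of_forall fun z => hC z.1)
  refine h1.of_forall_sdiff_eq_zero (isOpen_fullCyl hU).measurableSet fun z hz => ?_
  have : z.1 ∉ S := fun h => hz.2 ⟨h, hz.1⟩
  simp [h0 _ this]

lemma exists_Ioo_of_hasCompactSupport {f : ℝ → ℝ} (hf : HasCompactSupport f) :
    ∃ R > 0, ∀ x, x ∉ Ioo (-R) R → f x = 0 := by
  obtain ⟨R, hR⟩ := hf.isCompact.isBounded.subset_ball 0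
  refine ⟨max R 1, by positivity, fun x hx => ?_⟩
  by_contra h
  have h1 := hR (subset_tsupport f h)
  rw [Real.ball_eq_Ioo] at h1
  apply hx
  have := le_max_left R 1
  constructor <;> [have := h1.1; have := h1.2] <;> linarith

/-- Differentiating `θ · (truncation of v) · ∂ₑu` in the direction `e`. -/
lemma fderiv_test_apply (hU : IsOpen U) (hu : ConstFreq U c u) (hv : ConstFreq U c v)
    {θ η : ℝ → ℝ} (hθ : ContDiff ℝ 1 θ) (hη : ContDiff ℝ 1 η) {K : ℝ} (hK : K ≠ 0)
    (e : ℝ × (Fin (d+1) → ℝ)) {z : ℝ × (Fin (d+1) → ℝ)} (hz : z ∈ FullCyl U) :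
    fderiv ℝ (fun z => θ z.1 * (η (K * v z) / K) * fderiv ℝ u z e) z e =
      deriv θ z.1 * e.1 * (η (K * v z) / K) * fderiv ℝ u z e +
      θ z.1 * (deriv η (K * v z) * (fderiv ℝ v z e * fderiv ℝ u z e)) +
      θ z.1 * (η (K * v z) / K) * dd2 u e z := by
  have hnz := (isOpen_fullCyl hU).mem_nhds hz
  have h1 : HasFDerivAt (fun z : ℝ × (Fin (d+1) → ℝ) => θ z.1)
      (deriv θ z.1 • ContinuousLinearMap.fst ℝ ℝ (Fin (d+1) → ℝ)) z :=
    ((hθ.differentiable one_ne_zero) z.1).hasDerivAt.comp_hasFDerivAt z hasFDerivAt_fst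
  have hvd : HasFDerivAt v (fderiv ℝ v z) z :=
    ((hv.c2.contDiffAt hnz).differentiableAt two_ne_zero).hasFDerivAt
  have h2 : HasFDerivAt (fun z => η (K * v z))
      (deriv η (K * v z) • (K • fderiv ℝ v z)) z :=
    ((hη.differentiable one_ne_zero) (K * v z)).hasDerivAt.comp_hasFDerivAt z (hvd.const_mul K)
  have h3 : HasFDerivAt (fun z => fderiv ℝ u z e) (fderiv ℝ (fun z => fderiv ℝ u z e) z) z := by
    have h := (hu.c2.contDiffAt hnz).fderiv_right (m := 1) (by norm_num)
    exact ((h.differentiableAt one_ne_zero).clm_apply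
      (differentiableAt_const e)).hasFDerivAt
  have h2' : HasFDerivAt (fun z => η (K * v z) / K)
      (K⁻¹ • (deriv η (K * v z) • (K • fderiv ℝ v z))) z := by
    simpa [div_eq_mul_inv] using h2.mul_const K⁻¹
  rw [HasFDerivAt.fderiv (f := fun z => θ z.1 * (η (K * v z) / K) * fderiv ℝ u z e)
    ((h1.mul h2').mul h3)]
  simp only [_root_.add_apply, _root_.smul_apply, smul_eq_mul, dd2, Pi.mul_apply,
    ContinuousLinearMap.coe_fst']
  field_simp
  ring

lemma eventually_test_eq_zero {θ η : ℝ → ℝ} (hv : ConstFreq U c v)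
    (hη : ∀ r, |r| ≤ 1 → η r = 0) {K : ℝ}
    (e : ℝ × (Fin (d+1) → ℝ)) {z : ℝ × (Fin (d+1) → ℝ)} (hz : z ∉ FullCyl U) :
    (fun z => θ z.1 * (η (K * v z) / K) * fderiv ℝ u z e) =ᶠ[nhds z] fun _ => 0 := by
  have hc : Continuous fun z => |K * v z| := (continuous_const.mul hv.cont).abs
  have h0 : |K * v z| < 1 := by simp [hv.zero z hz]
  filter_upwards [(isOpen_lt hc continuous_const).mem_nhds h0] with s hs
  simp [hη _ (le_of_lt hs)]

lemma contDiff_test (hU : IsOpen U) (hu : ConstFreq U c u) (hv : ConstFreq U c v)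
    {θ η : ℝ → ℝ} (hθ : ContDiff ℝ 1 θ) (hη : ContDiff ℝ 1 η) (hη0 : ∀ r, |r| ≤ 1 → η r = 0)
    {K : ℝ} (e : ℝ × (Fin (d+1) → ℝ)) :
    ContDiff ℝ 1 (fun z => θ z.1 * (η (K * v z) / K) * fderiv ℝ u z e) := by
  rw [contDiff_iff_contDiffAt]
  intro z
  by_cases hz : z ∈ FullCyl U
  · have hnz := (isOpen_fullCyl hU).mem_nhds hz
    have h3 : ContDiffAt ℝ 1 (fun z => fderiv ℝ u z e) z :=
      ((hu.c2.contDiffAt hnz).fderiv_right (m := 1) (by norm_num)).clm_apply contDiffAt_const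
    have h2 : ContDiffAt ℝ 1 (fun z => η (K * v z)) z :=
      hη.contDiffAt.comp z (contDiffAt_const.mul ((hv.c2.contDiffAt hnz).of_le one_le_two))
    exact ((hθ.comp contDiff_fst).contDiffAt.mul (h2.div_const K)).mul h3
  · exact contDiffAt_const.congr_of_eventuallyEq (eventually_test_eq_zero hv hη0 e hz)

lemma hasCompactSupport_test (hUb : Bornology.IsBounded U) (hv : ConstFreq U c v)
    {θ η : ℝ → ℝ} (hθc : HasCompactSupport θ) (hη0 : ∀ r, |r| ≤ 1 → η r = 0)
    {K : ℝ} (e : ℝ × (Fin (d+1) → ℝ)) :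
    HasCompactSupport (fun z => θ z.1 * (η (K * v z) / K) * fderiv ℝ u z e) := by
  refine HasCompactSupport.intro (hθc.isCompact.prod hUb.isCompact_closure) fun z hz => ?_
  by_cases h1 : z.1 ∈ tsupport θ
  · have h2 : z.2 ∉ U := fun h => hz ⟨h1, subset_closure h⟩
    simp [hv.zero z h2, hη0 0]
  · simp [image_eq_zero_of_notMem_tsupport h1]

/-- The weak formulation tested against a truncation of `v`. -/
lemma weak_identity_truncated (hU : IsOpen U) (hUb : Bornology.IsBounded U)
    (hu : ConstFreq U c u) (hv : ConstFreq U c v)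
    {θ η : ℝ → ℝ} (hθ : ContDiff ℝ 1 θ) (hθc : HasCompactSupport θ) (hη : ContDiff ℝ 1 η)
    (hη0 : ∀ r, |r| ≤ 1 → η r = 0) {K : ℝ} (hK : K ≠ 0) :
    ∫ z, (deriv θ z.1 * ((η (K * v z) / K) * fderiv ℝ u z (1, 0)) +
      θ z.1 * (deriv η (K * v z) * gradDot u v z)) ∂(volume.restrict (FullCyl U)) = 0 := by
  set F : ℝ × (Fin (d+1) → ℝ) → ℝ × (Fin (d+1) → ℝ) → ℝ :=
    fun e z => θ z.1 * (η (K * v z) / K) * fderiv ℝ u z e with hF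
  have hcd : ∀ e, ContDiff ℝ 1 (F e) := fun e => contDiff_test hU hu hv hθ hη hη0 e
  have hcs : ∀ e, HasCompactSupport (F e) := fun e => hasCompactSupport_test hUb hv hθc hη0 e
  have hint : ∀ e, Integrable (fun z => fderiv ℝ (F e) z e) (volume.restrict (FullCyl U)) :=
    fun e => ((((hcd e).continuous_fderiv one_ne_zero).clm_apply
      continuous_const).integrable_of_hasCompactSupport
        ((hcs e).fderiv_apply (𝕜 := ℝ) e)).restrict
  have hzero : ∀ e, ∫ z, fderiv ℝ (F e) z e ∂(volume.restrict (FullCyl U)) = 0 := fun e => by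
    rw [setIntegral_eq_integral_of_forall_compl_eq_zero]
    · exact integral_fderiv_apply_eq_zero volume (hcd e) (hcs e) e
    · intro z hz
      rw [(eventually_test_eq_zero hv hη0 e hz).fderiv_eq]
      simp
  have hsum : ∫ z, (fderiv ℝ (F (1, 0)) z (1, 0) + ∑ i : Fin (d+1),
      fderiv ℝ (F (0, Pi.single i 1)) z (0, Pi.single i 1))
      ∂(volume.restrict (FullCyl U)) = 0 := by
    rw [integral_add (hint _) (integrable_finsetSum _ fun i _ => hint _),
      integral_finsetSum _ fun i _ => hint _]
    simp [hzero]
  rw [← hsum]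
  refine setIntegral_congr_fun (isOpen_fullCyl hU).measurableSet fun z hz => ?_
  have hl := hu.harm z hz
  simp only [hF, fderiv_test_apply hU hu hv hθ hη hK _ hz, gradDot]
  rw [lap] at hl
  simp only [mul_zero, zero_mul, zero_add, Finset.sum_add_distrib, ← Finset.mul_sum]
  rw [Finset.sum_congr rfl fun i _ => mul_comm (fderiv ℝ u z (0, Pi.single i 1)) _]
  linear_combination -(θ z.1 * (η (K * v z) / K)) * hl

/-- The weak formulation of harmonicity for `u`, tested against `θ(x) v(x,y)`. -/
lemma weak_identity (hU : IsOpen U) (hUb : Bornology.IsBounded U)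
    (hu : ConstFreq U c u) (hv : ConstFreq U c v)
    {θ : ℝ → ℝ} (hθ : ContDiff ℝ 1 θ) (hθc : HasCompactSupport θ) :
    ∫ z, (deriv θ z.1 * (v z * fderiv ℝ u z (1, 0)) + θ z.1 * gradDot u v z)
      ∂(volume.restrict (FullCyl U)) = 0 := by
  obtain ⟨η, hη, hη0, hηle, hηid, hηd, C, hC⟩ := exists_truncation
  have hC0 : 0 ≤ C := (abs_nonneg _).trans (hC 0)
  have hms : MeasurableSet (FullCyl U) := (isOpen_fullCyl hU).measurableSet
  obtain ⟨M, hM⟩ := hθc.exists_bound_of_continuous hθ.continuous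
  have hdc : Continuous (deriv θ) := hθ.continuous_deriv le_rfl
  obtain ⟨M', hM'⟩ := hθc.deriv.exists_bound_of_continuous hdc
  obtain ⟨R, -, hR⟩ := exists_Ioo_of_hasCompactSupport hθc
  obtain ⟨R', -, hR'⟩ := exists_Ioo_of_hasCompactSupport hθc.deriv
  have i1 : Integrable (fun z => deriv θ z.1 * (v z * fderiv ℝ u z (1, 0)))
      (volume.restrict (FullCyl U)) :=
    integrable_fst_mul hU (hu.integrableOn_mul_fderiv hU hUb hv.cont _ _)
      hdc hM' hR'
  have i2 : Integrable (fun z => θ z.1 * gradDot u v z) (volume.restrict (FullCyl U)) :=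
    integrable_fst_mul hU ((hu.integrableOn_gradDot hv hU R).mono_set
      (prod_mono Ioo_subset_Iio_self subset_rfl)) hθ.continuous hM hR
  have hηc : ContinuousOn (fun r => deriv η r) univ := (hη.continuous_deriv le_rfl).continuousOn
  have hlim := tendsto_integral_of_dominated_convergence
    (μ := volume.restrict (FullCyl U))
    (F := fun (k : ℕ) z => deriv θ z.1 * ((η (((k : ℝ) + 1) * v z) / ((k : ℝ) + 1)) *
      fderiv ℝ u z (1, 0)) + θ z.1 * (deriv η (((k : ℝ) + 1) * v z) * gradDot u v z))
    (f := fun z => deriv θ z.1 * (v z * fderiv ℝ u z (1, 0)) + θ z.1 * gradDot u v z)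
    (fun z => |deriv θ z.1 * (v z * fderiv ℝ u z (1, 0))| + C * |θ z.1 * gradDot u v z|)
    ?_ (i1.abs.add (i2.abs.const_mul C)) ?_ ?_
  · have hz : ∀ k : ℕ, (∫ z, (deriv θ z.1 * ((η (((k : ℝ) + 1) * v z) / ((k : ℝ) + 1)) *
      fderiv ℝ u z (1, 0)) + θ z.1 * (deriv η (((k : ℝ) + 1) * v z) * gradDot u v z))
      ∂(volume.restrict (FullCyl U))) = 0 := fun k =>
      weak_identity_truncated hU hUb hu hv hθ hθc hη hη0 (by positivity)
    simp only [hz] at hlim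
    exact (tendsto_nhds_unique hlim tendsto_const_nhds)
  · intro k
    refine ContinuousOn.aestronglyMeasurable ?_ hms
    have hkv : Continuous fun z => ((k : ℝ) + 1) * v z := continuous_const.mul hv.cont
    refine ((hdc.comp continuous_fst).continuousOn.mul ((((hη.continuous.comp hkv).div_const
      _).continuousOn).mul (hu.continuousOn_fderiv hU _))).add
      ((hθ.continuous.comp continuous_fst).continuousOn.mul
      (((hη.continuous_deriv le_rfl).comp hkv).continuousOn.mul (hu.continuousOn_gradDot hv hU)))
  · intro k
    refine Eventually.of_forall fun z => ?_
    have hk : (0 : ℝ) < (k : ℝ) + 1 := by positivity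
    refine (norm_add_le _ _).trans (add_le_add ?_ ?_)
    · simp only [Real.norm_eq_abs, abs_mul, abs_div, abs_of_pos hk]
      gcongr
      rw [div_le_iff₀ hk]
      refine (hηle _).trans ?_
      rw [abs_mul, abs_of_pos hk, mul_comm]
    · simp only [Real.norm_eq_abs, abs_mul]
      have := mul_le_mul_of_nonneg_right (hC (((k : ℝ) + 1) * v z))
        (mul_nonneg (abs_nonneg (θ z.1)) (abs_nonneg (gradDot u v z)))
      linarith
  · filter_upwards [ae_fderiv_eq_zero_of_eq_zero volume (isOpen_fullCyl hU)
      (hv.c2.differentiableOn two_ne_zero) hv.cont] with z hz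
    refine tendsto_const_nhds.congr' ?_
    by_cases h0 : v z = 0
    · refine Eventually.of_forall fun k => ?_
      simp [h0, hz h0, gradDot, hη0 0]
    · have ht : Tendsto (fun k : ℕ => ((k : ℝ) + 1) * |v z|) atTop atTop :=
        (tendsto_natCast_atTop_atTop.atTop_add tendsto_const_nhds).atTop_mul_const
          (abs_pos.2 h0)
      filter_upwards [ht.eventually_gt_atTop 2] with k hk
      have hk0 : (0 : ℝ) < (k : ℝ) + 1 := by positivity
      have hk' : 2 < |((k : ℝ) + 1) * v z| := by rwa [abs_mul, abs_of_pos hk0]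
      rw [hηid _ hk'.le, hηd _ hk', mul_div_cancel_left₀ _ hk0.ne', one_mul]

end

/-- Translation of `u` along the axis of the cylinder. -/
def axisShift {d : ℕ} (a : ℝ) (u : ℝ × (Fin (d+1) → ℝ) → ℝ) (z : ℝ × (Fin (d+1) → ℝ)) : ℝ :=
  u (z + (a, 0))

/-- The right tail `∫_x^∞ φ`. -/
def tailInt (φ : ℝ → ℝ) (x : ℝ) : ℝ := ∫ t in Ioi x, φ t

section
variable {d : ℕ} {U : Set (Fin (d+1) → ℝ)} {c : ℝ} {u v : ℝ × (Fin (d+1) → ℝ) → ℝ}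

lemma fderiv_axisShift (a : ℝ) (z : ℝ × (Fin (d+1) → ℝ)) :
    fderiv ℝ (axisShift a u) z = fderiv ℝ u (z + (a, 0)) :=
  fderiv_comp_add_right (f := u) (a, 0)

lemma gradSq_axisShift (a : ℝ) (z : ℝ × (Fin (d+1) → ℝ)) :
    gradSq (axisShift a u) z = gradSq u (z + (a, 0)) := by
  simp only [gradSq, fderiv_axisShift]

lemma lap_axisShift (a : ℝ) (z : ℝ × (Fin (d+1) → ℝ)) :
    lap (axisShift a u) z = lap u (z + (a, 0)) := by
  have h (e : ℝ × (Fin (d+1) → ℝ)) : dd2 (axisShift a u) e z = dd2 u e (z + (a, 0)) := by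
    simp only [dd2, fderiv_axisShift]
    rw [fderiv_comp_add_right (f := fun z' => fderiv ℝ u z' e) (a, 0)]
  simp only [lap, h]

lemma preimage_add_prod (a x : ℝ) :
    (fun z : ℝ × (Fin (d+1) → ℝ) => z + (a, 0)) ⁻¹' (Iio (x + a) ×ˢ U) = Iio x ×ˢ U := by
  ext z; simp

lemma setIntegral_gradSq_axisShift (a x : ℝ) :
    ∫ z in Iio x ×ˢ U, gradSq (axisShift a u) z = ∫ z in Iio (x + a) ×ˢ U, gradSq u z := by
  have h := (measurePreserving_add_right volume ((a, 0) : ℝ × (Fin (d+1) → ℝ))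
    ).setIntegral_preimage_emb (measurableEmbedding_addRight _) (gradSq u) (Iio (x + a) ×ˢ U)
  rw [preimage_add_prod] at h
  simpa only [gradSq_axisShift] using h

lemma ConstFreq.shiftX (hu : ConstFreq U c u) (a : ℝ) : ConstFreq U c (axisShift a u) where
  cont := hu.cont.comp (continuous_add_const _)
  zero z hz := hu.zero _ (by simpa using hz)
  c2 := hu.c2.comp (contDiff_id.add contDiff_const).contDiffOn fun z hz => by
    simpa [FullCyl] using hz
  harm z hz := by
    rw [lap_axisShift]; exact hu.harm _ (by simpa [FullCyl] using hz)
  energy x := by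
    have h := ((measurePreserving_add_right volume ((a, 0) : ℝ × (Fin (d+1) → ℝ))
      ).integrableOn_comp_preimage (measurableEmbedding_addRight _)).2 (hu.energy (x + a))
    rw [preimage_add_prod] at h
    exact h.congr_fun_ae (Eventually.of_forall fun z => (gradSq_axisShift a z).symm)
  freq x := by
    rw [setIntegral_gradSq_axisShift, hu.freq (x + a)]
    simp [axisShift]

lemma ConstFreq.setIntegral_gradSq_mono (hu : ConstFreq U c u) {S : Set ℝ} {b : ℝ}
    (h : S ⊆ Iio b) :
    ∫ z in S ×ˢ U, gradSq u z ≤ ∫ z in Iio b ×ˢ U, gradSq u z :=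
  setIntegral_mono_set (hu.energy b) (Eventually.of_forall fun z => gradSq_nonneg z)
    (prod_mono h subset_rfl).eventuallyLE

lemma ConstFreq.setIntegral_sq_le (hu : ConstFreq U c u) (hc : 0 < c)
    (hUb : Bornology.IsBounded U) {a b : ℝ} (hab : a ≤ b) :
    ∫ z in Ioo a b ×ˢ U, (u z) ^ 2 ≤ (b - a) * ((∫ z in Iio b ×ˢ U, gradSq u z) / c) := by
  have hi : IntegrableOn (fun z => (u z) ^ 2) (Ioo a b ×ˢ U) :=
    integrableOn_of_continuous hUb (hu.cont.pow 2) a b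
  rw [Measure.volume_eq_prod] at hi ⊢
  rw [setIntegral_prod _ hi, ← Measure.volume_eq_prod]
  have hb : ∀ x ∈ Ioo a b, ‖∫ y in U, (u (x, y)) ^ 2‖ ≤
      (∫ z in Iio b ×ˢ U, gradSq u z) / c := fun x hx => by
    rw [Real.norm_of_nonneg (integral_nonneg fun y => sq_nonneg _), le_div_iff₀' hc, ← hu.freq x]
    exact hu.setIntegral_gradSq_mono (Iio_subset_Iio hx.2.le)
  have := norm_setIntegral_le_of_norm_le_const (μ := volume) (by simp) hb
  rw [Real.volume_real_Ioo_of_le hab] at this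
  linarith [le_abs_self (∫ x in Ioo a b, ∫ y in U, (u (x, y)) ^ 2),
    Real.norm_eq_abs (∫ x in Ioo a b, ∫ y in U, (u (x, y)) ^ 2)]

lemma ConstFreq.tendsto_energy (hu : ConstFreq U c u) (hU : IsOpen U) (b : ℝ) :
    Tendsto (fun n : ℕ => ∫ z in Iio (b - (n : ℝ)) ×ˢ U, gradSq u z) atTop (nhds 0) := by
  have h := tendsto_setIntegral_of_antitone (μ := volume) (f := gradSq u)
    (s := fun n : ℕ => Iio (b - (n : ℝ)) ×ˢ U)
    (fun n => measurableSet_Iio.prod hU.measurableSet)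
    (fun m n hmn => prod_mono (Iio_subset_Iio (by
      have : (m : ℝ) ≤ n := by exact_mod_cast hmn
      linarith)) subset_rfl) ⟨0, hu.energy _⟩
  have he : ⋂ n : ℕ, Iio (b - (n : ℝ)) ×ˢ U = ∅ := by
    refine eq_empty_of_forall_notMem fun z hz => ?_
    obtain ⟨n, hn⟩ := exists_nat_gt (b - z.1)
    have h1 : z.1 < b - n := ((mem_iInter.1 hz) n).1
    linarith
  simpa [he] using h

lemma tailInt_eq {φ : ℝ → ℝ} (hφ : Continuous φ) (hc : HasCompactSupport φ) (x : ℝ) :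
    tailInt φ x = tailInt φ 0 - ∫ t in (0 : ℝ)..x, φ t := by
  have hi := hφ.integrable_of_hasCompactSupport (μ := volume) hc
  rw [← intervalIntegral.integral_Ioi_sub_Ioi' hi.integrableOn hi.integrableOn]
  simp [tailInt]

lemma hasDerivAt_tailInt {φ : ℝ → ℝ} (hφ : Continuous φ) (hc : HasCompactSupport φ) (x : ℝ) :
    HasDerivAt (tailInt φ) (-φ x) x := by
  rw [funext (tailInt_eq hφ hc)]
  simpa using (intervalIntegral.integral_hasDerivAt_right (hφ.intervalIntegrable 0 x)
    hφ.aestronglyMeasurable.stronglyMeasurableAtFilter hφ.continuousAt).const_sub (tailInt φ 0)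

lemma contDiff_tailInt {φ : ℝ → ℝ} (hφ : Continuous φ) (hc : HasCompactSupport φ) :
    ContDiff ℝ 1 (tailInt φ) := by
  rw [contDiff_one_iff_deriv]
  refine ⟨fun x => (hasDerivAt_tailInt hφ hc x).differentiableAt, ?_⟩
  rw [funext fun x => (hasDerivAt_tailInt hφ hc x).deriv]
  exact hφ.neg

lemma abs_tailInt_le {φ : ℝ → ℝ} (hφ : Continuous φ) (hc : HasCompactSupport φ) (x : ℝ) :
    |tailInt φ x| ≤ ∫ t, |φ t| := by
  have hi := hφ.integrable_of_hasCompactSupport (μ := volume) hc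
  exact (norm_integral_le_integral_norm _).trans
    (setIntegral_le_integral hi.norm (Eventually.of_forall fun t => norm_nonneg _))

lemma tailInt_eq_zero {φ : ℝ → ℝ} {R : ℝ} (hR : ∀ x, x ∉ Ioo (-R) R → φ x = 0) {x : ℝ}
    (hx : R ≤ x) : tailInt φ x = 0 :=
  setIntegral_eq_zero_of_forall_eq_zero fun t ht => hR t fun h =>
    absurd h.2 (not_lt.2 (hx.trans (le_of_lt ht)))

/-- The derivative of the smooth step is bounded and supported in `[0, 1]`. -/
lemma exists_step : ∃ χ : ℝ → ℝ, ContDiff ℝ 1 χ ∧ (∀ x, |χ x| ≤ 1) ∧ (∀ x ≤ 0, χ x = 0) ∧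
    (∀ x, 1 ≤ x → χ x = 1) ∧ (∀ x, x ∉ Ioo (-1 : ℝ) 2 → deriv χ x = 0) ∧
    ∃ C, ∀ x, |deriv χ x| ≤ C := by
  have hd : ∀ x, x ∉ Ioo (-1 : ℝ) 2 → deriv Real.smoothTransition x = 0 := fun x hx => by
    rcases le_or_gt x (-1) with h | h
    · have : Real.smoothTransition =ᶠ[nhds x] fun _ => 0 := by
        filter_upwards [Iio_mem_nhds (show x < 0 by linarith)] with s hs
        exact Real.smoothTransition.zero_of_nonpos (le_of_lt hs)
      rw [this.deriv_eq, deriv_const]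
    · have h2 : 2 ≤ x := not_lt.1 fun h' => hx ⟨h, h'⟩
      have : Real.smoothTransition =ᶠ[nhds x] fun _ => 1 := by
        filter_upwards [Ioi_mem_nhds (show 1 < x by linarith)] with s hs
        exact Real.smoothTransition.one_of_one_le (le_of_lt hs)
      rw [this.deriv_eq, deriv_const]
  refine ⟨Real.smoothTransition, Real.smoothTransition.contDiff, fun x => ?_,
    fun x => Real.smoothTransition.zero_of_nonpos,
    fun x => Real.smoothTransition.one_of_one_le, hd, ?_⟩
  · rw [abs_of_nonneg (Real.smoothTransition.nonneg x)]
    exact Real.smoothTransition.le_one x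
  · have hcs : HasCompactSupport (deriv Real.smoothTransition) :=
      HasCompactSupport.intro (isCompact_Icc (a := (-1 : ℝ)) (b := 2)) fun x hx =>
        hd x fun h => hx (Ioo_subset_Icc_self h)
    exact hcs.exists_bound_of_continuous
      ((Real.smoothTransition.contDiff (n := 1)).continuous_deriv le_rfl)

/-- The contribution of a bounded strip is controlled by the energy. -/
lemma integral_norm_window_le (hU : IsOpen U) (hUb : Bornology.IsBounded U) (hc : 0 < c)
    (hu : ConstFreq U c u) (hv : ConstFreq U c v) {f : ℝ → ℝ}
    {B a b : ℝ} (hab : a ≤ b) (hB : ∀ x, |f x| ≤ B) (h0 : ∀ x, x ∉ Ioo a b → f x = 0) :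
    ∫ z, ‖f z.1 * (v z * fderiv ℝ u z (1, 0))‖ ∂(volume.restrict (FullCyl U)) ≤
      B * ((b - a) * ((∫ z in Iio b ×ˢ U, gradSq v z) / c) +
        ∫ z in Iio b ×ˢ U, gradSq u z) := by
  have hB0 : 0 ≤ B := (abs_nonneg _).trans (hB 0)
  have i1 := integrableOn_of_continuous hUb (hv.cont.pow 2) a b
  have i2 := (hu.energy b).mono_set
    (prod_mono (Ioo_subset_Iio_self (a := a)) (subset_refl U))
  have hz0 : ∀ z ∈ FullCyl U \ Ioo a b ×ˢ U, ‖f z.1 * (v z * fderiv ℝ u z (1, 0))‖ = 0 :=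
    fun z hz => by rw [h0 _ fun h => hz.2 ⟨h, hz.1⟩, zero_mul, norm_zero]
  rw [setIntegral_eq_of_subset_of_forall_sdiff_eq_zero
    (isOpen_fullCyl hU).measurableSet (prod_subset_fullCyl _) hz0]
  refine (integral_mono_of_nonneg (Eventually.of_forall fun z => norm_nonneg _)
    ((i1.add i2).const_mul B) (Eventually.of_forall fun z => ?_)).trans ?_
  · simp only [norm_mul (f z.1)]
    refine mul_le_mul (hB _) ((abs_mul_le_half_sq_add_sq _ _).trans ?_) (norm_nonneg _) hB0
    have := sq_fderiv_le_gradSq (u := u) z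
    simp only [Pi.add_apply, Pi.pow_apply]
    nlinarith [sq_nonneg (v z), gradSq_nonneg (u := u) z]
  · rw [integral_const_mul]
    refine mul_le_mul_of_nonneg_left ?_ hB0
    simp only [Pi.add_apply]
    rw [integral_add i1 i2]
    exact add_le_add (hv.setIntegral_sq_le hc hUb hab)
      (hu.setIntegral_gradSq_mono Ioo_subset_Iio_self)

/-- Energy identity on left half-cylinders, integrated against `φ`. -/
lemma integral_mul_fderiv_eq_tail (hU : IsOpen U) (hUb : Bornology.IsBounded U) (hc : 0 < c)
    (hu : ConstFreq U c u) (hv : ConstFreq U c v) {φ : ℝ → ℝ} (hφ : Continuous φ)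
    (hφc : HasCompactSupport φ) :
    ∫ z, φ z.1 * (v z * fderiv ℝ u z (1, 0)) ∂(volume.restrict (FullCyl U)) =
      ∫ z, tailInt φ z.1 * gradDot u v z ∂(volume.restrict (FullCyl U)) := by
  obtain ⟨χ, hχ, hχ1, hχ0, hχid, hχd, C, hC⟩ := exists_step
  obtain ⟨M, hM⟩ := hφc.exists_bound_of_continuous hφ
  obtain ⟨R, -, hR⟩ := exists_Ioo_of_hasCompactSupport hφc
  have hms : MeasurableSet (FullCyl U) := (isOpen_fullCyl hU).measurableSet
  set Θ := tailInt φ with hΘ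
  set I := ∫ t, |φ t|
  have hΘI : ∀ x, |Θ x| ≤ I := abs_tailInt_le hφ hφc
  have hI0 : 0 ≤ I := (abs_nonneg _).trans (hΘI 0)
  have hC0 : 0 ≤ C := (abs_nonneg _).trans (hC 0)
  have hΘc : ContDiff ℝ 1 Θ := contDiff_tailInt hφ hφc
  have hχn : ∀ n : ℕ, ContDiff ℝ 1 fun x : ℝ => χ (x + n) := fun n =>
    hχ.comp (contDiff_id.add contDiff_const)
  have hdχ : Continuous (deriv χ) := hχ.continuous_deriv le_rfl
  have i1 : Integrable (fun z => φ z.1 * (v z * fderiv ℝ u z (1, 0)))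
      (volume.restrict (FullCyl U)) :=
    integrable_fst_mul hU (hu.integrableOn_mul_fderiv hU hUb hv.cont _ _) hφ hM hR
  have i2 : Integrable (fun z => Θ z.1 * gradDot u v z) (volume.restrict (FullCyl U)) :=
    integrable_fst_mul hU (hu.integrableOn_gradDot hv hU R) hΘc.continuous hΘI
      fun x hx => tailInt_eq_zero hR (not_lt.1 hx)
  have bddχ : ∀ (n : ℕ) (μ : Measure (ℝ × (Fin (d+1) → ℝ))) (g : ℝ × (Fin (d+1) → ℝ) → ℝ),
      Integrable g μ → Integrable (fun z => χ (z.1 + n) * g z) μ := fun n μ g hg =>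
    hg.bdd_mul (c := 1) (((hχn n).continuous.comp continuous_fst).aestronglyMeasurable)
      (Eventually.of_forall fun z => hχ1 _)
  have hw0 : ∀ (n : ℕ) (x : ℝ), x ∉ Ioo (-1 - (n : ℝ)) (2 - n) →
      Θ x * deriv χ (x + n) = 0 := fun n x hx => by
    rw [hχd _ fun h => hx ⟨by linarith [h.1], by linarith [h.2]⟩, mul_zero]
  have hwB : ∀ (n : ℕ) (x : ℝ), |Θ x * deriv χ (x + n)| ≤ I * C := fun n x => by
    rw [abs_mul]; exact mul_le_mul (hΘI x) (hC _) (abs_nonneg _) hI0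
  have i3 : ∀ n : ℕ, Integrable (fun z => (Θ z.1 * deriv χ (z.1 + n)) *
      (v z * fderiv ℝ u z (1, 0))) (volume.restrict (FullCyl U)) := fun n =>
    integrable_fst_mul hU (hu.integrableOn_mul_fderiv hU hUb hv.cont _ _)
      (f := fun x => Θ x * deriv χ (x + n))
      (hΘc.continuous.mul (hdχ.comp (continuous_add_const _))) (hwB n) (hw0 n)
  have key : ∀ n : ℕ,
      (∫ z, χ (z.1 + n) * (Θ z.1 * gradDot u v z) ∂(volume.restrict (FullCyl U))) +
      (∫ z, (Θ z.1 * deriv χ (z.1 + n)) * (v z * fderiv ℝ u z (1, 0))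
        ∂(volume.restrict (FullCyl U))) =
      ∫ z, χ (z.1 + n) * (φ z.1 * (v z * fderiv ℝ u z (1, 0)))
        ∂(volume.restrict (FullCyl U)) := fun n => by
    have hcs : HasCompactSupport fun x : ℝ => Θ x * χ (x + n) := by
      refine HasCompactSupport.intro (isCompact_Icc (a := -(n : ℝ)) (b := R)) fun x hx => ?_
      by_cases h : x ≤ -(n : ℝ)
      · rw [hχ0 _ (by linarith), mul_zero]
      · rw [hΘ, tailInt_eq_zero hR (le_of_lt (not_le.1 fun h' => hx ⟨(not_le.1 h).le, h'⟩)),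
          zero_mul]
    have hder : ∀ x : ℝ, deriv (fun x : ℝ => Θ x * χ (x + n)) x =
        -φ x * χ (x + n) + Θ x * deriv χ (x + n) := fun x => by
      have h1 := hasDerivAt_tailInt hφ hφc x
      have h2 : HasDerivAt (fun x : ℝ => χ (x + n)) (deriv χ (x + n)) x :=
        (hχ.differentiable one_ne_zero (x + n)).hasDerivAt.comp_add_const x n
      exact (h1.mul h2).deriv
    have h := weak_identity hU hUb hu hv (hΘc.mul (hχn n)) hcs
    have i12 : Integrable (fun z => χ (z.1 + n) * (Θ z.1 * gradDot u v z) +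
        (Θ z.1 * deriv χ (z.1 + n)) * (v z * fderiv ℝ u z (1, 0)))
        (volume.restrict (FullCyl U)) := (bddχ n _ _ i2).add (i3 n)
    rw [← integral_add (bddχ n _ _ i2) (i3 n), ← sub_eq_zero,
      ← integral_sub i12 (bddχ n _ _ i1), ← h]
    refine integral_congr_ae (Eventually.of_forall fun z => ?_)
    simp only [hder]
    ring
  have tendχ : ∀ g : ℝ × (Fin (d+1) → ℝ) → ℝ, Integrable g (volume.restrict (FullCyl U)) →
      Tendsto (fun n : ℕ => ∫ z, χ (z.1 + n) * g z ∂(volume.restrict (FullCyl U))) atTop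
        (nhds (∫ z, g z ∂(volume.restrict (FullCyl U)))) := fun g hg => by
    refine tendsto_integral_of_dominated_convergence (fun z => |g z|)
      (fun n => (bddχ n _ g hg).aestronglyMeasurable) hg.abs
      (fun n => Eventually.of_forall fun z => ?_) (Eventually.of_forall fun z => ?_)
    · rw [norm_mul]
      exact mul_le_of_le_one_left (abs_nonneg _) (hχ1 _)
    · refine tendsto_const_nhds.congr' ?_
      filter_upwards [tendsto_natCast_atTop_atTop.eventually_ge_atTop (1 - z.1)] with n hn
      rw [hχid _ (by linarith), one_mul]
  have tend0 : Tendsto (fun n : ℕ => ∫ z, (Θ z.1 * deriv χ (z.1 + n)) *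
      (v z * fderiv ℝ u z (1, 0)) ∂(volume.restrict (FullCyl U))) atTop (nhds 0) := by
    have hb := ((((hv.tendsto_energy hU 2).div_const c).const_mul 3).add
      (hu.tendsto_energy hU 2)).const_mul (I * C)
    rw [zero_div, mul_zero, add_zero, mul_zero] at hb
    refine squeeze_zero_norm (fun n => ?_) hb
    have := integral_norm_window_le (f := fun x => Θ x * deriv χ (x + n)) hU hUb hc hu hv
      (by linarith) (hwB n) (hw0 n)
    rw [show (2 - (n : ℝ)) - (-1 - n) = 3 by ring] at this
    exact (norm_integral_le_integral_norm _).trans this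
  have hl := (tendχ _ i2).add tend0
  simp only [key, add_zero] at hl
  exact tendsto_nhds_unique (tendχ _ i1) hl

end

section
variable {d : ℕ} {U : Set (Fin (d+1) → ℝ)} {c : ℝ} {u v : ℝ × (Fin (d+1) → ℝ) → ℝ}

/-- The measure on the full cylinder is a product measure. -/
lemma volume_restrict_fullCyl : (volume : Measure (ℝ × (Fin (d+1) → ℝ))).restrict (FullCyl U) =
    (volume : Measure ℝ).prod (volume.restrict U) := by
  rw [fullCyl_eq_univ_prod, Measure.volume_eq_prod, ← Measure.prod_restrict,
    Measure.restrict_univ]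

lemma integrable_fst_mul_of_continuous (hU : IsOpen U)
    (hUb : Bornology.IsBounded U) {φ : ℝ → ℝ} (hφ : Continuous φ) (hφc : HasCompactSupport φ)
    {g : ℝ × (Fin (d+1) → ℝ) → ℝ} (hg : Continuous g) :
    Integrable (fun z => φ z.1 * g z) (volume.restrict (FullCyl U)) := by
  obtain ⟨M, hM⟩ := hφc.exists_bound_of_continuous hφ
  obtain ⟨R, -, hR⟩ := exists_Ioo_of_hasCompactSupport hφc
  exact integrable_fst_mul hU (integrableOn_of_continuous hUb hg _ _) hφ hM hR

lemma ConstFreq.integral_tailInt_mul_gradSq (hu : ConstFreq U c u) (hU : IsOpen U)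
    (hUb : Bornology.IsBounded U) {φ : ℝ → ℝ} (hφ : Continuous φ) (hφc : HasCompactSupport φ) :
    ∫ z, tailInt φ z.1 * gradSq u z ∂(volume.restrict (FullCyl U)) =
      c * ∫ z, φ z.1 * (u z) ^ 2 ∂(volume.restrict (FullCyl U)) := by
  obtain ⟨R, -, hR⟩ := exists_Ioo_of_hasCompactSupport hφc
  have hφi := hφ.integrable_of_hasCompactSupport (μ := volume) hφc
  have hms : MeasurableSet (Iio R ×ˢ U) := measurableSet_Iio.prod hU.measurableSet
  set G : ℝ × (Fin (d+1) → ℝ) → ℝ := (Iio R ×ˢ U).indicator (gradSq u) with hG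
  have hGi : Integrable G (volume.restrict (FullCyl U)) :=
    ((integrable_indicator_iff hms).2 (hu.energy R)).restrict
  have hS : MeasurableSet {p : (ℝ × (Fin (d+1) → ℝ)) × ℝ | p.1.1 < p.2} :=
    measurableSet_lt measurable_fst.fst measurable_snd
  have hF := (hGi.mul_prod hφi).indicator hS
  have hsw := integral_integral_swap (f := fun z t =>
    {p : (ℝ × (Fin (d+1) → ℝ)) × ℝ | p.1.1 < p.2}.indicator
      (fun p => G p.1 * φ p.2) (z, t)) hF
  have h1 : ∀ z ∈ FullCyl U, ∫ t, {p : (ℝ × (Fin (d+1) → ℝ)) × ℝ | p.1.1 < p.2}.indicator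
      (fun p => G p.1 * φ p.2) (z, t) = tailInt φ z.1 * gradSq u z := fun z hz => by
    have : (fun t => {p : (ℝ × (Fin (d+1) → ℝ)) × ℝ | p.1.1 < p.2}.indicator
      (fun p => G p.1 * φ p.2) (z, t)) = (Ioi z.1).indicator fun t => G z * φ t := by
      ext t; simp [indicator_apply]
    rw [this, integral_indicator measurableSet_Ioi, integral_const_mul]
    by_cases h : z.1 < R
    · rw [hG, indicator_of_mem (show z ∈ Iio R ×ˢ U from ⟨h, hz⟩), mul_comm]; rfl
    · have := tailInt_eq_zero hR (not_lt.1 h)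
      rw [this, zero_mul]
      exact mul_eq_zero_of_right _ this
  have h2 : ∀ t, ∫ z, {p : (ℝ × (Fin (d+1) → ℝ)) × ℝ | p.1.1 < p.2}.indicator
      (fun p => G p.1 * φ p.2) (z, t) ∂(volume.restrict (FullCyl U)) =
      c * ∫ y in U, φ t * (u (t, y)) ^ 2 := fun t => by
    by_cases ht : φ t = 0
    · have : (fun z => {p : (ℝ × (Fin (d+1) → ℝ)) × ℝ | p.1.1 < p.2}.indicator
        (fun p => G p.1 * φ p.2) (z, t)) = fun _ => 0 := by
        ext z; simp [indicator_apply, ht]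
      simp [this, ht]
    have htR : t < R := (not_not.1 fun h => ht (hR t h)).2
    have : ∀ z ∈ FullCyl U, {p : (ℝ × (Fin (d+1) → ℝ)) × ℝ | p.1.1 < p.2}.indicator
        (fun p => G p.1 * φ p.2) (z, t) =
        (Iio t ×ˢ U).indicator (fun z => φ t * gradSq u z) z := fun z hz => by
      by_cases h : z.1 < t
      · rw [indicator_of_mem (show (z, t) ∈ {p : (ℝ × (Fin (d+1) → ℝ)) × ℝ | p.1.1 < p.2}
          from h), indicator_of_mem (show z ∈ Iio t ×ˢ U from ⟨h, hz⟩), hG,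
          indicator_of_mem (show z ∈ Iio R ×ˢ U from ⟨h.trans htR, hz⟩), mul_comm]
      · rw [indicator_of_notMem (show (z, t) ∉ {p : (ℝ × (Fin (d+1) → ℝ)) × ℝ | p.1.1 < p.2}
          from h), indicator_of_notMem fun h' => h h'.1]
    rw [setIntegral_congr_fun (isOpen_fullCyl hU).measurableSet this,
      setIntegral_indicator (measurableSet_Iio.prod hU.measurableSet),
      inter_eq_self_of_subset_right (prod_subset_fullCyl _), integral_const_mul, hu.freq t,
      integral_const_mul]
    ring
  rw [setIntegral_congr_fun (isOpen_fullCyl hU).measurableSet h1] at hsw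
  simp only [h2] at hsw
  rw [hsw, integral_const_mul]
  have hi : Integrable (fun z => φ z.1 * (u z) ^ 2) (volume.restrict (FullCyl U)) :=
    integrable_fst_mul_of_continuous hU hUb hφ hφc (hu.cont.pow 2)
  rw [volume_restrict_fullCyl] at hi ⊢
  rw [integral_prod _ hi]

/-- The integrand of the derivative of `∫ φ u(x+αr,y) u(x+βr,y)` in `r`. -/
def shiftFlux {d : ℕ} (u : ℝ × (Fin (d+1) → ℝ) → ℝ) (φ : ℝ → ℝ) (α β r : ℝ)
    (z : ℝ × (Fin (d+1) → ℝ)) : ℝ :=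
  φ z.1 * (axisShift (β * r) u z * fderiv ℝ (axisShift (α * r) u) z (1, 0))

lemma ConstFreq.continuousOn_shiftFlux (hu : ConstFreq U c u) (hU : IsOpen U) {φ : ℝ → ℝ}
    (hφ : Continuous φ) (α β : ℝ) :
    ContinuousOn (fun p : ℝ × (ℝ × (Fin (d+1) → ℝ)) => shiftFlux u φ α β p.1 p.2)
      (univ ×ˢ FullCyl U) := by
  have h1 : ContinuousOn (fun p : ℝ × (ℝ × (Fin (d+1) → ℝ)) =>
      fderiv ℝ u (p.2 + (α * p.1, 0)) (1, 0)) (univ ×ˢ FullCyl U) :=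
    (hu.continuousOn_fderiv hU (1, 0)).comp (by fun_prop) fun p hp => by
      simpa [FullCyl] using hp.2
  have h2 : Continuous fun p : ℝ × (ℝ × (Fin (d+1) → ℝ)) => u (p.2 + (β * p.1, 0)) :=
    hu.cont.comp (by fun_prop)
  simp only [shiftFlux, fderiv_axisShift]
  exact (hφ.comp continuous_snd.fst).continuousOn.mul (h2.continuousOn.mul h1)

lemma ConstFreq.integrable_shiftFlux (hu : ConstFreq U c u) (hU : IsOpen U)
    (hUb : Bornology.IsBounded U) (hc : 0 < c) {φ : ℝ → ℝ} (hφ : Continuous φ)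
    (hφc : HasCompactSupport φ) (α β a b : ℝ) :
    Integrable (fun p : ℝ × (ℝ × (Fin (d+1) → ℝ)) => shiftFlux u φ α β p.1 p.2)
      ((volume.restrict (uIoc a b)).prod (volume.restrict (FullCyl U))) := by
  obtain ⟨M, hM⟩ := hφc.exists_bound_of_continuous hφ
  obtain ⟨R, hR0, hR⟩ := exists_Ioo_of_hasCompactSupport hφc
  have hM0 : 0 ≤ M := (norm_nonneg _).trans (hM 0)
  have hms : AEStronglyMeasurable
      (fun p : ℝ × (ℝ × (Fin (d+1) → ℝ)) => shiftFlux u φ α β p.1 p.2)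
      ((volume.restrict (uIoc a b)).prod (volume.restrict (FullCyl U))) := by
    rw [Measure.prod_restrict]
    exact ((hu.continuousOn_shiftFlux hU hφ α β).mono
      (prod_mono (subset_univ _) subset_rfl)).aestronglyMeasurable
        (measurableSet_uIoc.prod (isOpen_fullCyl hU).measurableSet)
  refine (integrable_prod_iff hms).2 ⟨Eventually.of_forall fun r => ?_, ?_⟩
  · exact integrable_fst_mul hU ((hu.shiftX (α * r)).integrableOn_mul_fderiv hU hUb
      (hu.shiftX (β * r)).cont _ _) hφ hM hR
  · set A := max |a| |b|
    have hA : ∀ r ∈ uIoc a b, |r| ≤ A := fun r hr => by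
      have := uIoc_subset_uIcc hr
      rw [mem_uIcc] at this
      rcases this with h | h
      · exact abs_le_max_abs_abs h.1 h.2
      · exact (abs_le_max_abs_abs h.1 h.2).trans_eq (max_comm _ _)
    have hD : ∀ γ, ∀ r ∈ uIoc a b, ∫ z in Iio R ×ˢ U, gradSq (axisShift (γ * r) u) z ≤
        ∫ z in Iio (R + |γ| * A) ×ˢ U, gradSq u z := fun γ r hr => by
      rw [setIntegral_gradSq_axisShift]
      refine hu.setIntegral_gradSq_mono (Iio_subset_Iio ?_)
      have := (le_abs_self (γ * r)).trans_eq (abs_mul γ r)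
      have := mul_le_mul_of_nonneg_left (hA r hr) (abs_nonneg γ)
      linarith
    have : IsFiniteMeasure (volume.restrict (uIoc a b)) :=
      ⟨by simp [uIoc]⟩
    refine Integrable.of_bound hms.norm.integral_prod_right' (M * ((R - -R) *
      ((∫ z in Iio (R + |β| * A) ×ˢ U, gradSq u z) / c) +
      ∫ z in Iio (R + |α| * A) ×ˢ U, gradSq u z)) ?_
    refine (ae_restrict_iff' measurableSet_uIoc).2 (Eventually.of_forall fun r hr => ?_)
    rw [Real.norm_of_nonneg (integral_nonneg fun z => norm_nonneg _)]
    refine (integral_norm_window_le hU hUb hc (hu.shiftX (α * r)) (hu.shiftX (β * r))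
      (by linarith) hM hR).trans ?_
    have h1 := hD α r hr
    have h2 := hD β r hr
    gcongr
    linarith

lemma ConstFreq.hasDerivAt_axisShift (hu : ConstFreq U c u) (hU : IsOpen U) (α r : ℝ)
    {z : ℝ × (Fin (d+1) → ℝ)} (hz : z ∈ FullCyl U) :
    HasDerivAt (fun r => axisShift (α * r) u z)
      (α * fderiv ℝ (axisShift (α * r) u) z (1, 0)) r := by
  have hmem : z + (α * r, 0) ∈ FullCyl U := by simpa [FullCyl] using hz
  have h1 : HasFDerivAt u (fderiv ℝ u (z + (α * r, 0))) (z + (α * r, 0)) :=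
    ((hu.c2.contDiffAt ((isOpen_fullCyl hU).mem_nhds hmem)).differentiableAt
      two_ne_zero).hasFDerivAt
  have h2 : HasDerivAt (fun r : ℝ => z + (α * r, (0 : Fin (d+1) → ℝ))) (α • (1, 0)) r := by
    have := (((hasDerivAt_id r).const_mul α).prodMk
      (hasDerivAt_const r (0 : Fin (d+1) → ℝ))).const_add z
    simpa using this
  have h := h1.comp_hasDerivAt r h2
  rw [map_smul, smul_eq_mul] at h
  rw [fderiv_axisShift]
  exact h

/-- The change of `∫ φ u(x+αh,y) u(x+βh,y)` in `h` in terms of the energy. -/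
lemma ConstFreq.integral_axisShift_mul_axisShift (hu : ConstFreq U c u) (hU : IsOpen U)
    (hUb : Bornology.IsBounded U) (hc : 0 < c) {φ : ℝ → ℝ} (hφ : Continuous φ)
    (hφc : HasCompactSupport φ) (α β h : ℝ) :
    ∫ z, φ z.1 * (axisShift (β * h) u z * axisShift (α * h) u z)
        ∂(volume.restrict (FullCyl U)) -
      ∫ z, φ z.1 * (u z) ^ 2 ∂(volume.restrict (FullCyl U)) =
    ∫ r in (0 : ℝ)..h, (α + β) * ∫ z, tailInt φ z.1 *
      gradDot (axisShift (α * r) u) (axisShift (β * r) u) z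
        ∂(volume.restrict (FullCyl U)) := by
  have iα := hu.integrable_shiftFlux hU hUb hc hφ hφc α β 0 h
  have iβ := hu.integrable_shiftFlux hU hUb hc hφ hφc β α 0 h
  have hi : Integrable (Function.uncurry fun r z => α * shiftFlux u φ α β r z +
      β * shiftFlux u φ β α r z)
      ((volume.restrict (uIoc 0 h)).prod (volume.restrict (FullCyl U))) :=
    (iα.const_mul α).add (iβ.const_mul β)
  have hz1 : ∀ γ δ r, Integrable (shiftFlux u φ γ δ r) (volume.restrict (FullCyl U)) :=
    fun γ δ r => by
      obtain ⟨M, hM⟩ := hφc.exists_bound_of_continuous hφ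
      obtain ⟨R, -, hR⟩ := exists_Ioo_of_hasCompactSupport hφc
      exact integrable_fst_mul hU ((hu.shiftX (γ * r)).integrableOn_mul_fderiv hU hUb
        (hu.shiftX (δ * r)).cont _ _) hφ hM hR
  have hr : ∀ r, (α + β) * ∫ z, tailInt φ z.1 *
      gradDot (axisShift (α * r) u) (axisShift (β * r) u) z
        ∂(volume.restrict (FullCyl U)) =
      ∫ z, (α * shiftFlux u φ α β r z + β * shiftFlux u φ β α r z)
        ∂(volume.restrict (FullCyl U)) := fun r => by
    rw [integral_add ((hz1 α β r).const_mul α) ((hz1 β α r).const_mul β), integral_const_mul,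
      integral_const_mul]
    simp only [shiftFlux]
    rw [integral_mul_fderiv_eq_tail hU hUb hc (hu.shiftX _) (hu.shiftX _) hφ hφc,
      integral_mul_fderiv_eq_tail hU hUb hc (hu.shiftX _) (hu.shiftX _) hφ hφc]
    simp only [gradDot_comm (u := axisShift (β * r) u)]
    ring
  have hsub : ∀ γ δ, Integrable (fun z => φ z.1 *
      (axisShift γ u z * axisShift δ u z)) (volume.restrict (FullCyl U)) := fun γ δ =>
    integrable_fst_mul_of_continuous hU hUb hφ hφc
      ((hu.shiftX γ).cont.mul (hu.shiftX δ).cont)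
  have hsq : Integrable (fun z => φ z.1 * (u z) ^ 2) (volume.restrict (FullCyl U)) :=
    integrable_fst_mul_of_continuous hU hUb hφ hφc (hu.cont.pow 2)
  simp only [hr]
  rw [intervalIntegral_integral_swap hi, ← integral_sub (hsub _ _) hsq]
  refine setIntegral_congr_fun (isOpen_fullCyl hU).measurableSet fun z hz => ?_
  have hcont : ∀ γ δ, Continuous fun r => shiftFlux u φ γ δ r z := fun γ δ =>
    (hu.continuousOn_shiftFlux hU hφ γ δ).comp_continuous (f := fun r : ℝ => (r, z))
      (by fun_prop) fun r => ⟨mem_univ _, hz⟩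
  have hd : ∀ r ∈ uIcc 0 h, HasDerivAt (fun r => φ z.1 *
      (axisShift (β * r) u z * axisShift (α * r) u z))
      (α * shiftFlux u φ α β r z + β * shiftFlux u φ β α r z) r := fun r _ => by
    refine (((hu.hasDerivAt_axisShift hU β r hz).mul
      (hu.hasDerivAt_axisShift hU α r hz)).const_mul (φ z.1)).congr_deriv ?_
    simp only [shiftFlux]; ring
  rw [intervalIntegral.integral_eq_sub_of_hasDerivAt hd
    (((continuous_const.mul (hcont α β)).add
      (continuous_const.mul (hcont β α))).intervalIntegrable _ _)]
  have h0 : ((0 : ℝ), (0 : Fin (d+1) → ℝ)) = 0 := rfl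
  simp [axisShift, sq, h0]

end

section
variable {d : ℕ} {U : Set (Fin (d+1) → ℝ)} {c : ℝ} {u v : ℝ × (Fin (d+1) → ℝ) → ℝ}

lemma ConstFreq.integral_axisShift_mul_axisShift_neg (hu : ConstFreq U c u) (hU : IsOpen U)
    (hUb : Bornology.IsBounded U) (hc : 0 < c) {φ : ℝ → ℝ} (hφ : Continuous φ)
    (hφc : HasCompactSupport φ) (h : ℝ) :
    ∫ z, φ z.1 * (axisShift (-h) u z * axisShift h u z)
        ∂(volume.restrict (FullCyl U)) =
      ∫ z, φ z.1 * (u z) ^ 2 ∂(volume.restrict (FullCyl U)) := by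
  have := hu.integral_axisShift_mul_axisShift hU hUb hc hφ hφc 1 (-1) h
  simpa [sub_eq_zero] using this

lemma ConstFreq.continuous_integral_axisShift_sq (hu : ConstFreq U c u)
    (hUb : Bornology.IsBounded U) {φ : ℝ → ℝ} (hφ : Continuous φ)
    (hφc : HasCompactSupport φ) :
    Continuous fun r => ∫ z, φ z.1 * (axisShift r u z) ^ 2
      ∂(volume.restrict (FullCyl U)) := by
  have hk := hφc.isCompact.prod hUb.isCompact_closure
  refine continuousOn_univ.1 (continuousOn_integral_of_compact_support hk
    (f := fun r z => φ z.1 * (axisShift r u z) ^ 2) ?_ fun r z _ hz => ?_)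
  · have : Continuous fun p : ℝ × (ℝ × (Fin (d+1) → ℝ)) => u (p.2 + (p.1, 0)) :=
      hu.cont.comp (by fun_prop)
    exact ((hφ.comp continuous_snd.fst).mul (this.pow 2)).continuousOn
  · by_cases h1 : z.1 ∈ tsupport φ
    · have h2 : z.2 ∉ U := fun h => hz ⟨h1, subset_closure h⟩
      simp [(hu.shiftX r).zero z h2]
    · simp [image_eq_zero_of_notMem_tsupport h1]

lemma ConstFreq.integral_axisShift_sq (hu : ConstFreq U c u) (hU : IsOpen U)
    (hUb : Bornology.IsBounded U) (hc : 0 < c) {φ : ℝ → ℝ} (hφ : Continuous φ)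
    (hφc : HasCompactSupport φ) (h : ℝ) :
    ∫ z, φ z.1 * (axisShift h u z) ^ 2 ∂(volume.restrict (FullCyl U)) =
      Real.exp (2 * c * h) * ∫ z, φ z.1 * (u z) ^ 2 ∂(volume.restrict (FullCyl U)) := by
  set H : ℝ → ℝ := fun r => ∫ z, φ z.1 * (axisShift r u z) ^ 2
      ∂(volume.restrict (FullCyl U)) with hH
  have hHc : Continuous H := hu.continuous_integral_axisShift_sq hUb hφ hφc
  have hH0 : H 0 = ∫ z, φ z.1 * (u z) ^ 2 ∂(volume.restrict (FullCyl U)) := by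
    have h0 : ((0 : ℝ), (0 : Fin (d+1) → ℝ)) = 0 := rfl
    simp [hH, axisShift, h0]
  have hI : ∀ h, H h = H 0 + ∫ r in (0 : ℝ)..h, 2 * c * H r := fun h => by
    have := hu.integral_axisShift_mul_axisShift hU hUb hc hφ hφc 1 1 h
    simp only [one_mul, ← gradSq_eq_gradDot, ← sq,
      (hu.shiftX _).integral_tailInt_mul_gradSq hU hUb hφ hφc] at this
    rw [hH0, ← sub_eq_iff_eq_add', hH]
    beta_reduce
    rw [this]
    refine intervalIntegral.integral_congr fun r _ => ?_
    ring
  have hd : ∀ r, HasDerivAt H (2 * c * H r) r := fun r => by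
    have h1 := (intervalIntegral.integral_hasDerivAt_right
      ((continuous_const.mul hHc).intervalIntegrable 0 r)
      (continuous_const.mul hHc).aestronglyMeasurable.stronglyMeasurableAtFilter
      (continuous_const.mul hHc).continuousAt (f := fun r => 2 * c * H r)).const_add (H 0)
    rwa [← funext hI] at h1
  have hE : ∀ r, HasDerivAt (fun r => H r * Real.exp (-(2 * c * r))) 0 r := fun r => by
    have h2 : HasDerivAt (fun r : ℝ => Real.exp (-(2 * c * r)))
        (Real.exp (-(2 * c * r)) * -(2 * c * 1)) r :=
      (((hasDerivAt_id r).const_mul (2 * c)).neg).exp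
    refine ((hd r).mul h2).congr_deriv ?_
    ring
  have := is_const_of_deriv_eq_zero (fun r => (hE r).differentiableAt) (fun r => (hE r).deriv)
    h 0
  simp only [mul_zero, neg_zero, Real.exp_zero, mul_one] at this
  rw [← hH0, ← this, mul_comm, mul_assoc, ← Real.exp_add, neg_add_cancel, Real.exp_zero, mul_one]

lemma ConstFreq.shiftX_eq (hu : ConstFreq U c u) (hU : IsOpen U)
    (hUb : Bornology.IsBounded U) (hc : 0 < c) (h : ℝ) {z : ℝ × (Fin (d+1) → ℝ)}
    (hz : z ∈ FullCyl U) :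
    axisShift h u z = Real.exp (2 * c * h) * axisShift (-h) u z := by
  obtain ⟨φ, hφ1, hφc, hφ0, hφ⟩ : ∃ φ : ℝ → ℝ, φ z.1 = 1 ∧ HasCompactSupport φ ∧
      (∀ x, 0 ≤ φ x) ∧ Continuous φ := by
    let f : ContDiffBump z.1 := ⟨1, 2, one_pos, one_lt_two⟩
    exact ⟨f, f.one_of_mem_closedBall (Metric.mem_closedBall_self zero_le_one),
      f.hasCompactSupport, fun x => f.nonneg,
      f.continuous⟩
  set E := Real.exp (2 * c * h)
  have hE : Real.exp (2 * c * -h) * E = 1 := by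
    rw [← Real.exp_add, ← Real.exp_zero]; congr 1; ring
  have hi : ∀ γ δ, Integrable (fun z => φ z.1 * (axisShift γ u z * axisShift δ u z))
      (volume.restrict (FullCyl U)) := fun γ δ =>
    integrable_fst_mul_of_continuous hU hUb hφ hφc
      ((hu.shiftX γ).cont.mul (hu.shiftX δ).cont)
  have hcont : Continuous fun z => φ z.1 *
      (axisShift h u z - E * axisShift (-h) u z) ^ 2 :=
    (hφ.comp continuous_fst).mul
      (((hu.shiftX h).cont.sub (continuous_const.mul (hu.shiftX (-h)).cont)).pow 2)
  have h0 : ∫ z, φ z.1 * (axisShift h u z - E * axisShift (-h) u z) ^ 2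
      ∂(volume.restrict (FullCyl U)) = 0 := by
    have he : ∀ z, φ z.1 * (axisShift h u z - E * axisShift (-h) u z) ^ 2 =
        φ z.1 * (axisShift h u z * axisShift h u z) -
          2 * E * (φ z.1 * (axisShift (-h) u z * axisShift h u z)) +
          E ^ 2 * (φ z.1 * (axisShift (-h) u z * axisShift (-h) u z)) := fun z => by
      ring
    simp only [he]
    have hi2 : Integrable (fun z => φ z.1 * (axisShift h u z * axisShift h u z) -
        2 * E * (φ z.1 * (axisShift (-h) u z * axisShift h u z)))
        (volume.restrict (FullCyl U)) := (hi _ _).sub ((hi _ _).const_mul _)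
    rw [integral_add hi2 ((hi _ _).const_mul _),
      integral_sub (hi _ _) ((hi _ _).const_mul _), integral_const_mul, integral_const_mul,
      hu.integral_axisShift_mul_axisShift_neg hU hUb hc hφ hφc]
    simp only [← sq]
    rw [hu.integral_axisShift_sq hU hUb hc hφ hφc, hu.integral_axisShift_sq hU hUb hc hφ hφc]
    linear_combination E * (∫ z, φ z.1 * (u z) ^ 2 ∂(volume.restrict (FullCyl U))) * hE
  have hint : Integrable (fun z => φ z.1 *
      (axisShift h u z - E * axisShift (-h) u z) ^ 2) (volume.restrict (FullCyl U)) :=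
    integrable_fst_mul_of_continuous hU hUb hφ hφc
      (((hu.shiftX h).cont.sub (continuous_const.mul (hu.shiftX (-h)).cont)).pow 2)
  rw [integral_eq_zero_iff_of_nonneg (fun z => mul_nonneg (hφ0 _) (sq_nonneg _)) hint] at h0
  have := Measure.eqOn_open_of_ae_eq h0 (isOpen_fullCyl hU) hcont.continuousOn
    continuousOn_const hz
  simpa [hφ1, sub_eq_zero] using this

/-- A function of constant positive frequency is a pure exponential along the axis. -/
lemma ConstFreq.eq_exp_mul (hu : ConstFreq U c u) (hU : IsOpen U)
    (hUb : Bornology.IsBounded U) (hc : 0 < c) (x : ℝ) (y : Fin (d+1) → ℝ) :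
    u (x, y) = Real.exp (c * x) * u (0, y) := by
  by_cases hy : y ∈ U
  · have h := hu.shiftX_eq hU hUb hc (x / 2) (z := (x / 2, y)) hy
    simpa [axisShift, show 2 * c * (x / 2) = c * x by ring] using h
  · rw [hu.zero (x, y) hy, hu.zero (0, y) hy, mul_zero]

end

section
variable {d : ℕ} {U : Set (Fin (d+1) → ℝ)} {c : ℝ} {u v : ℝ × (Fin (d+1) → ℝ) → ℝ}

lemma frontier_fullCyl : frontier (FullCyl U) = {z | z.2 ∈ frontier U} :=
  (isOpenMap_snd.preimage_frontier_eq_frontier_preimage continuous_snd U).symm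

lemma closure_fullCyl : closure (FullCyl U) = {z | z.2 ∈ closure U} :=
  (isOpenMap_snd.preimage_closure_eq_closure_preimage continuous_snd U).symm

lemma gradSq_congr {z : ℝ × (Fin (d+1) → ℝ)} (h : u =ᶠ[nhds z] v) : gradSq u z = gradSq v z := by
  simp only [gradSq, h.fderiv_eq]

lemma lap_congr {z : ℝ × (Fin (d+1) → ℝ)} (h : u =ᶠ[nhds z] v) : lap u z = lap v z := by
  have h2 (e : ℝ × (Fin (d+1) → ℝ)) : dd2 u e z = dd2 v e z := by
    have : (fun z' => fderiv ℝ u z' e) =ᶠ[nhds z] fun z' => fderiv ℝ v z' e := by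
      filter_upwards [h.fderiv (𝕜 := ℝ)] with z' hz'
      rw [hz']
    simp only [dd2, this.fderiv_eq]
  simp only [lap, h2]

/-- Exponential solutions have constant frequency. -/
lemma freqFull_eq_of_exp (hU : IsOpen U) (hd : DifferentiableOn ℝ u (FullCyl U)) {s : ℝ}
    {ψ : (Fin (d+1) → ℝ) → ℝ}
    (h : ∀ x : ℝ, ∀ y ∈ U, u (x, y) = Real.exp (s * x) * ψ y) (x : ℝ) :
    freqFull U u x = freqFull U u 0 := by
  have hE : ∀ z ∈ FullCyl U, axisShift x u z = Real.exp (s * x) * u z := fun z hz => by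
    obtain ⟨t, y⟩ := z
    simp only [axisShift, Prod.mk_add_mk, add_zero]
    rw [h _ y hz, h _ y hz, mul_add, Real.exp_add]; ring
  have hg : ∀ z ∈ FullCyl U, gradSq (axisShift x u) z = Real.exp (s * x) ^ 2 * gradSq u z :=
    fun z hz => by
      have hn := (isOpen_fullCyl hU).mem_nhds hz
      have : axisShift x u =ᶠ[nhds z] fun z => Real.exp (s * x) * u z := by
        filter_upwards [hn] using hE
      rw [gradSq_congr this]
      simp only [gradSq, fderiv_const_mul (hd.differentiableAt hn), mul_add, Finset.mul_sum,
        smul_apply, smul_eq_mul, mul_pow]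
  have hnum : ∫ z in Iio x ×ˢ U, gradSq u z =
      Real.exp (s * x) ^ 2 * ∫ z in Iio (0 : ℝ) ×ˢ U, gradSq u z := by
    have := setIntegral_gradSq_axisShift (U := U) (u := u) x 0
    rw [zero_add] at this
    rw [← this, ← integral_const_mul]
    exact setIntegral_congr_fun (measurableSet_Iio.prod hU.measurableSet) fun z hz => hg z hz.2
  have hden : ∫ y in U, (u (x, y)) ^ 2 = Real.exp (s * x) ^ 2 * ∫ y in U, (u (0, y)) ^ 2 := by
    rw [← integral_const_mul]
    refine setIntegral_congr_fun hU.measurableSet fun y hy => ?_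
    simp only [h _ y hy, mul_zero, Real.exp_zero, one_mul, mul_pow]
  rw [freqFull, hnum, hden, mul_div_mul_left _ _ (by positivity), freqFull]

lemma fderiv_eq_zero_of_gradSq_eq_zero {z : ℝ × (Fin (d+1) → ℝ)} (h : gradSq u z = 0) :
    fderiv ℝ u z = 0 := by
  have hs : 0 ≤ ∑ i : Fin (d+1), (fderiv ℝ u z (0, Pi.single i 1)) ^ 2 := by positivity
  have h1 : fderiv ℝ u z (1, 0) = 0 := by
    have := sq_nonneg (fderiv ℝ u z (1, 0))
    exact pow_eq_zero_iff two_ne_zero |>.1 (by unfold gradSq at h; linarith)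
  have h2 : ∀ i : Fin (d+1), fderiv ℝ u z (0, Pi.single i 1) = 0 := fun i => by
    have : ∑ i : Fin (d+1), (fderiv ℝ u z (0, Pi.single i 1)) ^ 2 = 0 := by
      unfold gradSq at h; rwa [h1, zero_pow two_ne_zero, zero_add] at h
    exact pow_eq_zero_iff two_ne_zero |>.1
      ((Finset.sum_eq_zero_iff_of_nonneg fun i _ => sq_nonneg _).1 this i (Finset.mem_univ i))
  refine ContinuousLinearMap.ext fun ⟨a, b⟩ => ?_
  have he : ((a, b) : ℝ × (Fin (d+1) → ℝ)) =
      a • ((1 : ℝ), (0 : Fin (d+1) → ℝ)) + ∑ i, b i • ((0 : ℝ), Pi.single i (1 : ℝ)) := by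
    refine Prod.ext ?_ ?_
    · simp [Prod.fst_sum]
    · ext j
      simp [Prod.snd_sum, Finset.sum_apply, Pi.single_apply]
  rw [he, map_add, map_sum]
  simp only [map_smul, h1, h2, smul_zero, Finset.sum_const_zero, add_zero, zero_apply]

/-- A nontrivial solution of constant frequency has positive frequency. -/
lemma constFreq_of_freqFull_eq (hU : IsOpen U) (hUb : Bornology.IsBounded U)
    (hUc : IsConnected U) (hcont : Continuous u) (hzero : ∀ z, z.2 ∉ U → u z = 0)
    (hC2 : ContDiffOn ℝ 2 u (FullCyl U)) (hharm : ∀ z ∈ FullCyl U, lap u z = 0)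
    (henergy : ∀ x : ℝ, IntegrableOn (gradSq u) (Iio x ×ˢ U))
    (hnontriv : ∃ z ∈ FullCyl U, u z ≠ 0) (hf : ∀ x, freqFull U u x = c) :
    0 < c ∧ ConstFreq U c u := by
  have hN0 : ∀ x, 0 ≤ ∫ z in Iio x ×ˢ U, gradSq u z := fun x =>
    integral_nonneg fun z => gradSq_nonneg z
  have hH0 : ∀ x, 0 ≤ ∫ y in U, (u (x, y)) ^ 2 := fun x => integral_nonneg fun y => sq_nonneg _
  have hc0 : 0 ≤ c := by rw [← hf 0]; exact div_nonneg (hN0 0) (hH0 0)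
  have hc : c ≠ 0 := fun hc => by
    obtain ⟨⟨x₀, y₀⟩, hy₀, hne⟩ := hnontriv
    have hux : Continuous fun y => u (x₀, y) ^ 2 := (hcont.comp (by fun_prop)).pow 2
    have hH : ∫ y in U, (u (x₀, y)) ^ 2 ≠ 0 := fun h0 => by
      rw [integral_eq_zero_iff_of_nonneg (fun y => sq_nonneg _)
        ((hux.continuousOn.integrableOn_compact hUb.isCompact_closure).mono_set
          subset_closure)] at h0
      have := Measure.eqOn_open_of_ae_eq h0 hU hux.continuousOn continuousOn_const hy₀
      exact hne (pow_eq_zero_iff two_ne_zero |>.1 this)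
    have hN : ∫ z in Iio x₀ ×ˢ U, gradSq u z = 0 :=
      ((div_eq_zero_iff.1 ((hf x₀).trans hc)).resolve_right hH)
    have hop : IsOpen (Iio x₀ ×ˢ U) := isOpen_Iio.prod hU
    have hfd : ∀ e, ContinuousOn (fun z => fderiv ℝ u z e) (Iio x₀ ×ˢ U) := fun e =>
      ((hC2.continuousOn_fderiv_of_isOpen (isOpen_fullCyl hU) one_le_two).clm_apply
        continuousOn_const).mono (prod_subset_fullCyl _)
    rw [integral_eq_zero_iff_of_nonneg (fun z => gradSq_nonneg z) (henergy x₀)] at hN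
    have hg := Measure.eqOn_open_of_ae_eq hN hop
      (((hfd _).pow 2).add (continuousOn_finsetSum _ fun i _ => (hfd _).pow 2))
      continuousOn_const
    obtain ⟨a, ha⟩ := hop.exists_is_const_of_fderiv_eq_zero
      (isPreconnected_Iio.prod hUc.isPreconnected)
      ((hC2.differentiableOn two_ne_zero).mono (prod_subset_fullCyl _))
      fun z hz => fderiv_eq_zero_of_gradSq_eq_zero (hg hz)
    have hcl : ∀ z ∈ closure (Iio x₀ ×ˢ U), u z = a := fun z hz =>
      closure_minimal ha (isClosed_eq hcont continuous_const) hz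
    simp only [closure_prod_eq, closure_Iio] at hcl
    obtain ⟨y₁, hy₁⟩ : (frontier U).Nonempty :=
      nonempty_frontier_iff.2 ⟨hUc.nonempty, fun h => NormedSpace.unbounded_univ ℝ _ (h ▸ hUb)⟩
    have ha0 : a = 0 := by
      rw [← hcl (x₀, y₁) ⟨self_mem_Iic, frontier_subset_closure hy₁⟩]
      exact hzero _ fun h => by
        rw [hU.frontier_eq] at hy₁; exact hy₁.2 h
    exact hne ((hcl (x₀, y₀) ⟨self_mem_Iic, subset_closure hy₀⟩).trans ha0)
  refine ⟨lt_of_le_of_ne hc0 hc.symm, hcont, hzero, hC2, hharm, henergy, fun x => ?_⟩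
  have hH : ∫ y in U, (u (x, y)) ^ 2 ≠ 0 := fun h0 => hc (by
    rw [← hf x, freqFull, h0, div_zero])
  exact (div_eq_iff hH).1 (hf x)

lemma fderiv_exp_axis {k : ℝ} {z : ℝ × (Fin (d+1) → ℝ)} (hd : DifferentiableAt ℝ u z)
    (h : ∀ x : ℝ, u (x, z.2) = Real.exp (c * x) * k) :
    fderiv ℝ u z (1, 0) = c * u z := by
  have h1 : HasDerivAt (fun x : ℝ => (x, z.2)) ((1 : ℝ), (0 : Fin (d+1) → ℝ)) z.1 :=
    (hasDerivAt_id _).prodMk (hasDerivAt_const _ _)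
  have h2 : HasDerivAt (fun x : ℝ => u (x, z.2)) (fderiv ℝ u z (1, 0)) z.1 :=
    HasFDerivAt.comp_hasDerivAt z.1 (f := fun x : ℝ => (x, z.2)) hd.hasFDerivAt h1
  rw [funext h] at h2
  have h3 : HasDerivAt (fun x : ℝ => Real.exp (c * x) * k)
      (Real.exp (c * z.1) * (c * 1) * k) z.1 :=
    (((hasDerivAt_id _).const_mul c).exp).mul_const k
  rw [h2.unique h3, show u z = _ from h z.1]
  ring

lemma fderiv_slice {y : Fin (d+1) → ℝ} (hd : DifferentiableAt ℝ u (0, y))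
    (e : Fin (d+1) → ℝ) :
    fderiv ℝ (fun y => u (0, y)) y e = fderiv ℝ u (0, y) (0, e) := by
  have h1 : HasFDerivAt (fun y : Fin (d+1) → ℝ => ((0 : ℝ), y))
      (ContinuousLinearMap.inr ℝ ℝ (Fin (d+1) → ℝ)) y := hasFDerivAt_prodMk_right 0 y
  have h2 := HasFDerivAt.comp y (f := fun y : Fin (d+1) → ℝ => ((0 : ℝ), y)) hd.hasFDerivAt h1
  have h3 : fderiv ℝ (fun y => u (0, y)) y = _ := h2.fderiv
  rw [h3]; simp

/-- The cross-section of an exponential harmonic function is an eigenfunction. -/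
lemma lapU_slice (hU : IsOpen U) (hC2 : ContDiffOn ℝ 2 u (FullCyl U))
    (hharm : ∀ z ∈ FullCyl U, lap u z = 0)
    (h : ∀ x : ℝ, ∀ y ∈ U, u (x, y) = Real.exp (c * x) * u (0, y))
    {y : Fin (d+1) → ℝ} (hy : y ∈ U) :
    lapU (fun y => u (0, y)) y = -(c ^ 2 * u (0, y)) := by
  have hop := isOpen_fullCyl hU
  have hd : ∀ z ∈ FullCyl U, DifferentiableAt ℝ u z := fun z hz =>
    (hC2.differentiableOn two_ne_zero).differentiableAt (hop.mem_nhds hz)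
  have hd2 : ∀ e, DifferentiableAt ℝ (fun z => fderiv ℝ u z e) (0, y) := fun e =>
    ((hC2.fderiv_of_isOpen hop (m := 1) (by norm_num)).differentiableOn
      one_ne_zero).differentiableAt (hop.mem_nhds hy) |>.clm_apply
      (differentiableAt_const e)
  have hx : dd2 u (1, 0) (0, y) = c ^ 2 * u (0, y) := by
    have : (fun z => fderiv ℝ u z (1, 0)) =ᶠ[nhds ((0 : ℝ), y)] fun z => c * u z := by
      filter_upwards [hop.mem_nhds (show ((0 : ℝ), y) ∈ FullCyl U from hy)] with z hz
      exact fderiv_exp_axis (hd z hz) fun x => h x z.2 hz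
    rw [dd2, this.fderiv_eq, fderiv_const_mul (hd _ hy), smul_apply,
      smul_eq_mul, fderiv_exp_axis (hd _ hy) fun x => h x y hy]
    ring
  have hyy : ∀ i, fderiv ℝ (fun y' => fderiv ℝ (fun y => u (0, y)) y' (Pi.single i 1)) y
      (Pi.single i 1) = dd2 u (0, Pi.single i 1) (0, y) := fun i => by
    have : (fun y' => fderiv ℝ (fun y => u (0, y)) y' (Pi.single i 1)) =ᶠ[nhds y]
        fun y' => fderiv ℝ u (0, y') (0, Pi.single i 1) := by
      filter_upwards [hU.mem_nhds hy] with y' hy'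
      exact fderiv_slice (hd (0, y') hy') _
    rw [this.fderiv_eq, dd2, ← fderiv_slice (hd2 _)]
  have := hharm (0, y) hy
  simp only [lap, hx] at this
  simp only [lapU, hyy]
  linarith

end

/-- Let `w` be harmonic on the full cylinder `ℝ × U`, continuous on its
closure, vanishing on `ℝ × ∂U`, not identically zero, with finite energy on `(-∞,x̄) × U`
for every `x̄`. Then `Ñ(w)` is constant iff `w(x,y) = e^{√λ_k x} ψ_k(y)` for some Dirichlet
eigenvalue `λ_k` of `-Δ` on `U` and some corresponding eigenfunction `ψ_k`. -/
theorem statement10 {d : ℕ} (U : Set (Fin (d+1) → ℝ))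
    (hUo : IsOpen U) (hUb : Bornology.IsBounded U) (hUc : IsConnected U)
    (hUs : HasSmoothBoundary U)
    (w : ℝ × (Fin (d+1) → ℝ) → ℝ)
    (hcont : ContinuousOn w (closure (FullCyl U)))
    (hC2 : ContDiffOn ℝ 2 w (FullCyl U))
    (hharm : ∀ z ∈ FullCyl U, lap w z = 0)
    (hbd : ∀ z : ℝ × (Fin (d+1) → ℝ), z.2 ∈ frontier U → w z = 0)
    (hnontriv : ∃ z ∈ FullCyl U, w z ≠ 0)
    (henergy : ∀ x : ℝ, (∫⁻ z in Iio x ×ˢ U, ENNReal.ofReal (gradSq w z)) < ⊤) :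
    (∃ c : ℝ, ∀ x : ℝ, freqFull U w x = c) ↔
    (∃ lam : ℝ, ∃ ψ : (Fin (d+1) → ℝ) → ℝ,
      IsDirichletEigenvalue U lam ∧ ψ ∈ eigSet U lam ∧ (∃ y ∈ U, ψ y ≠ 0) ∧
      ∀ x : ℝ, ∀ y ∈ U, w (x, y) = Real.exp (Real.sqrt lam * x) * ψ y) := by
  constructor
  · rintro ⟨c, hc⟩
    have hop := isOpen_fullCyl hUo
    set u : ℝ × (Fin (d+1) → ℝ) → ℝ := (FullCyl U).indicator w with hu
    have huw : ∀ z ∈ FullCyl U, u z = w z := fun z hz => indicator_of_mem hz w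
    have hev : ∀ z ∈ FullCyl U, u =ᶠ[nhds z] w := fun z hz => by
      filter_upwards [hop.mem_nhds hz] using huw
    have hucont : Continuous u := continuous_indicator
      (fun z hz => hbd z (by rwa [frontier_fullCyl] at hz)) hcont
    have huC2 : ContDiffOn ℝ 2 u (FullCyl U) := hC2.congr huw
    have hgrad : ∀ x, ∀ z ∈ Iio x ×ˢ U, gradSq u z = gradSq w z := fun x z hz =>
      gradSq_congr (hev z hz.2)
    have hms : ∀ x : ℝ, MeasurableSet (Iio x ×ˢ U) := fun x =>
      measurableSet_Iio.prod hUo.measurableSet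
    have huen : ∀ x : ℝ, IntegrableOn (gradSq u) (Iio x ×ˢ U) := fun x => by
      have hfd : ∀ e, ContinuousOn (fun z => fderiv ℝ w z e) (Iio x ×ˢ U) := fun e =>
        ((hC2.continuousOn_fderiv_of_isOpen hop one_le_two).clm_apply
          continuousOn_const).mono (prod_subset_fullCyl _)
      have hcg : ContinuousOn (gradSq w) (Iio x ×ˢ U) :=
        ((hfd _).pow 2).add (continuousOn_finsetSum _ fun i _ => (hfd _).pow 2)
      refine IntegrableOn.congr_fun (f := gradSq w) ⟨hcg.aestronglyMeasurable (hms x), ?_⟩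
        (fun z hz => (hgrad x z hz).symm) (hms x)
      exact (hasFiniteIntegral_iff_ofReal (Eventually.of_forall fun z => gradSq_nonneg z)).2
        (henergy x)
    have hfreq : ∀ x, freqFull U u x = c := fun x => by
      rw [← hc x, freqFull, freqFull, setIntegral_congr_fun (hms x) (hgrad x)]
      congr 1
      exact setIntegral_congr_fun hUo.measurableSet fun y hy => by
        simp only [huw (x, y) hy]
    obtain ⟨z₀, hz₀, hne⟩ := hnontriv
    obtain ⟨hcpos, hcf⟩ := constFreq_of_freqFull_eq hUo hUb hUc hucont
      (fun z hz => indicator_of_notMem (show z ∉ FullCyl U from hz) w) huC2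
      (fun z hz => by rw [lap_congr (hev z hz), hharm z hz]) huen
      ⟨z₀, hz₀, by rwa [huw z₀ hz₀]⟩ hfreq
    have hexp : ∀ x : ℝ, ∀ y ∈ U, w (x, y) = Real.exp (c * x) * w (0, y) := fun x y hy => by
      rw [← huw (x, y) hy, ← huw (0, y) hy, hcf.eq_exp_mul hUo hUb hcpos]
    have hψ : (fun y => w (0, y)) ∈ eigSet U (c ^ 2) := by
      refine ⟨hcont.comp (by fun_prop) fun y hy => ?_,
        hC2.comp (contDiff_const.prodMk contDiff_id).contDiffOn fun y hy => hy,
        fun y hy => lapU_slice hUo hC2 hharm hexp hy, fun y hy => hbd (0, y) hy⟩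
      rwa [closure_fullCyl]
    have hψ0 : ∃ y ∈ U, w (0, y) ≠ 0 :=
      ⟨z₀.2, hz₀, fun h => hne (by rw [← Prod.mk.eta (p := z₀), hexp _ _ hz₀, h, mul_zero])⟩
    refine ⟨c ^ 2, fun y => w (0, y), ⟨_, hψ, hψ0⟩, hψ, hψ0, fun x y hy => ?_⟩
    rw [Real.sqrt_sq hcpos.le, hexp x y hy]
  · rintro ⟨lam, ψ, -, -, -, h⟩
    exact ⟨_, freqFull_eq_of_exp hUo (hC2.differentiableOn two_ne_zero) h⟩
end
end
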